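/- For all sufficiently large γ, with probability 1 the following holds: for every φ ∈ ℓ²(ℤ^d), every θ ∈ S¹, and every ε > 0, there exists R > 0 such that sup_{t∈ℝ} Σ_{|j|>R} |(U(t,0;θ)φ)(j)|² < ε. In particular, Anderson localization is stable under the bounded, spatially localized, time-periodic perturbation λcos(2π(ωt+θ))W. -/

import Mathlib

open MeasureTheory Finset
open scoped NNReal ENNReal

noncomputable section

/-- Sites of the lattice `ℤ^d`. -/
abbrev Site (d : ℕ) := Fin d → ℤ

/-- The `ℓ¹`-norm `|i|` of a lattice site. -/
def l1 {d : ℕ} (i : Site d) : ℕ := ∑ k, (i k).natAbs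

/-- The `k`-th unit coordinate vector in `ℤ^d`. -/
def unitVec {d : ℕ} (k : Fin d) : Site d := fun l => if l = k then 1 else 0

/-- `P` is the product measure `∏_{j ∈ ℤ^d} g(dv_j)` on `Ω = ℝ^{ℤ^d}`: it is a probability
measure whose finite-dimensional cylinder marginals are products of copies of `g`. -/
def IsProductMeasure {d : ℕ} (g : Measure ℝ) (P : Measure (Site d → ℝ)) : Prop :=
  IsProbabilityMeasure P ∧
    ∀ (s : Finset (Site d)) (A : Site d → Set ℝ), (∀ j, MeasurableSet (A j)) →
      P {v | ∀ j ∈ s, v j ∈ A j} = ∏ j ∈ s, g (A j)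

/-- The single-site distribution `g` is a probability measure supported in `[-1,1]`,
absolutely continuous with a bounded density. -/
def NiceDisorder (g : Measure ℝ) : Prop :=
  IsProbabilityMeasure g ∧ g (Set.Icc (-1 : ℝ) 1)ᶜ = 0 ∧
    ∃ C : ℝ≥0, ∀ A : Set ℝ, g A ≤ (C : ℝ≥0∞) * volume A

section

/-- A complete real orthonormal eigenbasis of a matrix. -/
structure IsEig {I : Type*} [Fintype I] [DecidableEq I] (K : Matrix I I ℝ) (E : I → ℝ)
    (Ψ : I → I → ℝ) : Prop where
  orth : ∀ k l, ∑ p, Ψ k p * Ψ l p = if k = l then 1 else 0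
  comp : ∀ p q, ∑ k, Ψ k p * Ψ k q = if p = q then 1 else 0
  eig : ∀ k p, ∑ q, K p q * Ψ k q = E k * Ψ k p

lemma exists_isEig {I : Type*} [Fintype I] [DecidableEq I] (K : Matrix I I ℝ)
    (hK : ∀ p q, K p q = K q p) : ∃ E Ψ, IsEig K E Ψ := by
  have hH : K.IsHermitian := by
    ext p q
    simp [Matrix.conjTranspose_apply, hK p q]
  refine ⟨hH.eigenvalues, fun k p => hH.eigenvectorBasis k p, ?_, ?_, ?_⟩
  · intro k l
    have := orthonormal_iff_ite.1 hH.eigenvectorBasis.orthonormal k l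
    rw [← this]
    simp [PiLp.inner_apply, mul_comm]
  · intro p q
    have := (hH.eigenvectorUnitary).2
    rw [Matrix.mem_unitaryGroup_iff] at this
    have h2 := congrFun (congrFun this p) q
    simpa [Matrix.mul_apply, Matrix.star_apply, Matrix.one_apply] using h2
  · intro k p
    have := congrFun (hH.mulVec_eigenvectorBasis k) p
    simpa [Matrix.mulVec, dotProduct] using this

/-- Resampling one coordinate. -/
lemma resample {d : ℕ} {g : Measure ℝ} (hg : IsProbabilityMeasure g) {P : Measure (Site d → ℝ)}
    (hP : IsProductMeasure g P) (x : Site d) (F : (Site d → ℝ) → ℝ≥0∞) (hF : Measurable F) :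
    ∫⁻ v, F v ∂P = ∫⁻ v, ∫⁻ t, F (Function.update v x t) ∂g ∂P := by
  have hp := hP.1
  have hPinf : P = Measure.infinitePi (fun _ : Site d => g) := by
    apply Measure.eq_infinitePi
    intro s t ht
    have := hP.2 s (fun i => if i ∈ s then t i else Set.univ) (fun j => by
      split_ifs
      · exact ht _ 
      · exact MeasurableSet.univ)
    rw [Finset.prod_congr rfl (fun i hi => by rw [if_pos hi])] at this
    rw [← this]
    congr 1
    ext v
    simp only [Set.mem_pi, Finset.mem_coe, Set.mem_setOf_eq]
    exact forall₂_congr fun j hj => by rw [if_pos hj]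
  have hm : Measurable (fun z : (Site d → ℝ) × ℝ => Function.update z.1 x z.2) := by
    apply measurable_pi_lambda
    intro j
    by_cases h : j = x
    · subst h; simpa using measurable_snd
    · simp only [Function.update_of_ne h]
      exact (measurable_pi_apply j).comp measurable_fst
  have hmap : (P.prod g).map (fun z : (Site d → ℝ) × ℝ => Function.update z.1 x z.2) = P := by
    conv_rhs => rw [hPinf]
    apply Measure.eq_infinitePi
    intro s t ht
    rw [Measure.map_apply hm (MeasurableSet.pi s.countable_toSet (fun i _ => ht i))]
    have hset : (fun z : (Site d → ℝ) × ℝ => Function.update z.1 x z.2) ⁻¹' (Set.pi s t)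
        = {v | ∀ j ∈ s.erase x, v j ∈ t j} ×ˢ (if x ∈ s then t x else Set.univ) := by
      ext z
      simp only [Set.mem_preimage, Set.mem_pi, Finset.mem_coe, Set.mem_prod, Set.mem_setOf_eq,
        Finset.mem_erase]
      constructor
      · intro h
        refine ⟨fun j hj => ?_, ?_⟩
        · have := h j hj.2
          rwa [Function.update_of_ne hj.1] at this
        · split_ifs with hx
          · have := h x hx
            rwa [Function.update_self] at this
          · trivial
      · rintro ⟨h1, h2⟩ j hj
        by_cases hjx : j = x
        · subst hjx
          rw [if_pos hj] at h2
          rwa [Function.update_self]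
        · rw [Function.update_of_ne hjx]
          exact h1 j ⟨hjx, hj⟩
    rw [hset, Measure.prod_prod, hP.2 _ _ (fun i => ht i)]
    split_ifs with hx
    · rw [Finset.prod_erase_mul _ _ hx]
    · rw [Finset.erase_eq_of_notMem hx]; simp
  conv_lhs => rw [← hmap]
  rw [lintegral_map hF hm, lintegral_prod]
  exact (hF.comp hm).aemeasurable

end

section

/-- the shifted matrix `A + c χ - z`. -/
def Mz {I : Type*} [DecidableEq I] (A : Matrix I I ℝ) (χ : I → ℝ) (c z : ℂ) :
    Matrix I I ℂ := fun p q => (A p q : ℂ) + if p = q then c * χ p - z else 0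

section avg
variable {I : Type*} [Fintype I] [DecidableEq I]

lemma Mz_mulVec (A : Matrix I I ℝ) (χ : I → ℝ) (c z : ℂ) (u : I → ℂ) (p : I) :
    (Mz A χ c z).mulVec u p = ∑ q, (A p q : ℂ) * u q + (c * χ p - z) * u p := by
  simp [Matrix.mulVec, dotProduct, Mz, add_mul, Finset.sum_add_distrib, ite_mul]

lemma Mz_form (A : Matrix I I ℝ) (hA : ∀ p q, A p q = A q p) (χ : I → ℝ) (c z : ℂ) (u : I → ℂ) :
    (∑ p, (starRingEnd ℂ) (u p) * (Mz A χ c z).mulVec u p).im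
      = c.im * ∑ p, χ p * ‖u p‖ ^ 2 - z.im * ∑ p, ‖u p‖ ^ 2 := by
  have h1 : (∑ p, (starRingEnd ℂ) (u p) * ∑ q, (A p q : ℂ) * u q).im = 0 := by
    rw [← Complex.conj_eq_iff_im]
    simp only [map_sum, map_mul, Complex.conj_conj, Complex.conj_ofReal, Finset.mul_sum]
    rw [Finset.sum_comm]
    refine Finset.sum_congr rfl fun p _ => Finset.sum_congr rfl fun q _ => ?_
    rw [hA q p]; ring
  simp only [Mz_mulVec, mul_add, Finset.sum_add_distrib, Complex.add_im, h1, zero_add]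
  rw [Complex.im_sum, Finset.mul_sum, Finset.mul_sum, ← Finset.sum_sub_distrib]
  refine Finset.sum_congr rfl fun p _ => ?_
  have : (starRingEnd ℂ) (u p) * ((c * χ p - z) * u p) = (c * χ p - z) * ((‖u p‖ ^ 2 : ℝ) : ℂ) := by
    rw [Complex.ofReal_pow, ← Complex.mul_conj']; ring
  rw [this, Complex.im_mul_ofReal]
  simp
  ring

lemma Mz_det (A : Matrix I I ℝ) (hA : ∀ p q, A p q = A q p) (χ : I → ℝ) (hχ : ∀ p, 0 ≤ χ p)
    (c z : ℂ) (hc : c.im ≤ 0) (hz : 0 < z.im) : (Mz A χ c z).det ≠ 0 := by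
  intro h
  obtain ⟨u, hu, hu2⟩ := Matrix.exists_mulVec_eq_zero_iff.2 h
  have := Mz_form A hA χ c z u
  simp only [hu2, Pi.zero_apply, mul_zero, Finset.sum_const_zero, Complex.zero_im] at this
  have h1 : 0 ≤ ∑ p, χ p * ‖u p‖ ^ 2 := Finset.sum_nonneg fun p _ => mul_nonneg (hχ p) (by positivity)
  have h2 : 0 < ∑ p, ‖u p‖ ^ 2 := by
    obtain ⟨p, hp⟩ := Function.ne_iff.1 hu
    refine Finset.sum_pos' (fun _ _ => by positivity) ⟨p, Finset.mem_univ _, ?_⟩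
    have : 0 < ‖u p‖ := norm_pos_iff.2 hp
    positivity
  nlinarith [mul_pos hz h2, mul_nonneg (neg_nonneg.2 hc) h1]

/-- diagonal resolvent entry -/
def hz (A : Matrix I I ℝ) (χ : I → ℝ) (p0 : I) (c z : ℂ) : ℂ := (Mz A χ c z)⁻¹ p0 p0

lemma hz_im (A : Matrix I I ℝ) (hA : ∀ p q, A p q = A q p) (χ : I → ℝ) (hχ : ∀ p, 0 ≤ χ p)
    (p0 : I) (h0 : χ p0 = 1)
    (c z : ℂ) (hc : c.im ≤ 0) (hz' : 0 < z.im) :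
    z.im * ‖hz A χ p0 c z‖ ^ 2 - c.im * ‖hz A χ p0 c z‖ ^ 2 ≤ (hz A χ p0 c z).im := by
  set u : I → ℂ := fun p => (Mz A χ c z)⁻¹ p p0 with hu
  have hunit : IsUnit (Mz A χ c z).det := (Mz_det A hA χ hχ c z hc hz').isUnit
  have hMu : (Mz A χ c z).mulVec u = Pi.single p0 1 := by
    ext p
    have := congrFun (congrFun (Matrix.mul_nonsing_inv _ hunit) p) p0
    rw [Matrix.mul_apply] at this
    simp only [Matrix.mulVec, dotProduct, hu, this, Matrix.one_apply, Pi.single_apply]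
  have hf := Mz_form A hA χ c z u
  rw [hMu] at hf
  have e1 : (∑ p, (starRingEnd ℂ) (u p) * (Pi.single p0 1 : I → ℂ) p) = (starRingEnd ℂ) (u p0) := by
    simp [Pi.single_apply]
  rw [e1, Complex.conj_im] at hf
  have hup : u p0 = hz A χ p0 c z := rfl
  rw [hup] at hf
  have h1 : ‖hz A χ p0 c z‖ ^ 2 ≤ ∑ p, ‖u p‖ ^ 2 := by
    rw [← hup]
    exact Finset.single_le_sum (f := fun p => ‖u p‖ ^ 2) (fun _ _ => by positivity) (Finset.mem_univ p0)
  have h2 : ‖hz A χ p0 c z‖ ^ 2 ≤ ∑ p, χ p * ‖u p‖ ^ 2 := by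
    have := Finset.single_le_sum (f := fun p => χ p * ‖u p‖ ^ 2)
      (fun p _ => mul_nonneg (hχ p) (by positivity)) (Finset.mem_univ p0)
    simpa [h0, hup] using this
  nlinarith [mul_le_mul_of_nonneg_left h1 hz'.le, mul_le_mul_of_nonneg_left h2 (neg_nonneg.2 hc)]

lemma hz_im_nonneg (A : Matrix I I ℝ) (hA : ∀ p q, A p q = A q p) (χ : I → ℝ) (hχ : ∀ p, 0 ≤ χ p)
    (p0 : I) (h0 : χ p0 = 1)
    (c z : ℂ) (hc : c.im ≤ 0) (hz' : 0 < z.im) : 0 ≤ (hz A χ p0 c z).im := by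
  have := hz_im A hA χ hχ p0 h0 c z hc hz'
  have h3 : 0 ≤ ‖hz A χ p0 c z‖ ^ 2 := by positivity
  nlinarith [mul_nonneg hz'.le h3, mul_nonneg (neg_nonneg.2 hc) h3]

lemma hz_bound (A : Matrix I I ℝ) (hA : ∀ p q, A p q = A q p) (χ : I → ℝ) (hχ : ∀ p, 0 ≤ χ p)
    (p0 : I) (h0 : χ p0 = 1)
    (c z : ℂ) (hc : c.im ≤ 0) (hz' : 0 < z.im) (m : ℝ) (hm : 0 < m) (hm2 : m ≤ z.im - c.im) :
    (hz A χ p0 c z).im ≤ 1 / m := by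
  have h := hz_im A hA χ hχ p0 h0 c z hc hz'
  have h2 : (hz A χ p0 c z).im ≤ ‖hz A χ p0 c z‖ := (le_abs_self _).trans (Complex.abs_im_le_norm _)
  set a := ‖hz A χ p0 c z‖
  have ha : 0 ≤ a := norm_nonneg _
  have h4 : m * a ^ 2 ≤ a := by nlinarith [mul_le_mul_of_nonneg_right hm2 (sq_nonneg a)]
  have h5 : m * a ≤ 1 := by
    rcases eq_or_lt_of_le ha with h | h
    · rw [← h]; simp
    · nlinarith
  calc _ ≤ a := h2
    _ ≤ 1 / m := by rw [le_div_iff₀ hm]; linarith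

lemma det_differentiable {f : I → I → ℂ → ℂ} (c : ℂ) (hf : ∀ p q, DifferentiableAt ℂ (f p q) c) :
    DifferentiableAt ℂ (fun c => (Matrix.of fun p q => f p q c).det) c := by
  simp only [Matrix.det_apply']
  refine DifferentiableAt.fun_sum fun σ _ => ?_
  refine (differentiableAt_const _).mul ?_
  refine DifferentiableAt.fun_finsetProd fun p _ => ?_
  exact hf _ _

lemma hz_differentiable (A : Matrix I I ℝ) (hA : ∀ p q, A p q = A q p) (χ : I → ℝ)
    (hχ : ∀ p, 0 ≤ χ p) (p0 : I) (c z : ℂ) (hc : c.im ≤ 0) (hz' : 0 < z.im) :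
    DifferentiableAt ℂ (fun c => hz A χ p0 c z) c := by
  have hent : ∀ p q, DifferentiableAt ℂ (fun c => Mz A χ c z p q) c := by
    intro p q
    unfold Mz
    split_ifs <;> fun_prop
  have e : (fun c => hz A χ p0 c z) = fun c =>
      (Mz A χ c z).det⁻¹ * ((Mz A χ c z).updateRow p0 (Pi.single p0 1)).det := by
    ext c
    unfold hz
    rw [Matrix.inv_def, Matrix.smul_apply, Matrix.adjugate_apply, Ring.inverse_eq_inv', smul_eq_mul]
  rw [e]
  refine DifferentiableAt.mul (DifferentiableAt.inv ?_ (Mz_det A hA χ hχ c z hc hz')) ?_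
  · exact det_differentiable c hent
  · refine det_differentiable (f := fun p q c => (Mz A χ c z).updateRow p0 (Pi.single p0 1) p q) c ?_
    intro p q
    by_cases h : p = p0
    · subst h; simp
    · simp only [Matrix.updateRow_ne h]; exact hent p q

end avg
end

section

/-- Cayley map from the disc to the lower half plane -/
def cay (w : ℂ) : ℂ := -Complex.I * (1 + w) / (1 - w)

lemma cay_im (w : ℂ) (hw : ‖w‖ ≤ 1) : (cay w).im ≤ 0 := by
  have h : (cay w).im = -(1 - ‖w‖ ^ 2) / Complex.normSq (1 - w) := by
    unfold cay
    rw [Complex.div_im]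
    simp only [Complex.mul_im, Complex.mul_re, Complex.neg_re, Complex.neg_im, Complex.I_re,
      Complex.I_im, Complex.add_re, Complex.add_im, Complex.sub_re, Complex.sub_im, Complex.one_re,
      Complex.one_im]
    rw [← Complex.normSq_eq_norm_sq, Complex.normSq_apply w]
    ring
  rw [h]
  apply div_nonpos_of_nonpos_of_nonneg
  · have : ‖w‖ ^ 2 ≤ 1 := by
      have := norm_nonneg w
      nlinarith
    linarith
  · exact Complex.normSq_nonneg _

lemma cay_diff (w : ℂ) (hw : w ≠ 1) : DifferentiableAt ℂ cay w := by
  unfold cay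
  have : 1 - w ≠ 0 := sub_ne_zero.2 hw.symm
  fun_prop (disch := assumption)

lemma cay_exp (v : ℝ) :
    cay (circleMap 0 1 (Real.pi - 2 * Real.arctan v)) = v := by
  have h1 : (0:ℝ) < 1 + v ^ 2 := by positivity
  have hs : Real.sqrt (1 + v ^ 2) ^ 2 = 1 + v ^ 2 := Real.sq_sqrt h1.le
  have hs0 : Real.sqrt (1 + v ^ 2) ≠ 0 := (Real.sqrt_pos.2 h1).ne'
  have hc : Real.cos (Real.pi - 2 * Real.arctan v) = -(1 - v ^ 2) / (1 + v ^ 2) := by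
    rw [Real.cos_pi_sub, Real.cos_two_mul, Real.cos_arctan]
    rw [div_pow, hs]
    field_simp
    ring
  have hsn : Real.sin (Real.pi - 2 * Real.arctan v) = 2 * v / (1 + v ^ 2) := by
    rw [Real.sin_pi_sub, Real.sin_two_mul, Real.cos_arctan, Real.sin_arctan]
    rw [show 2 * (v / √(1 + v ^ 2)) * (1 / √(1 + v ^ 2)) = 2 * v / (√(1 + v ^ 2)) ^ 2 by
      field_simp, hs]
  have hw : circleMap 0 1 (Real.pi - 2 * Real.arctan v)
      = ((-(1 - v ^ 2) / (1 + v ^ 2) : ℝ) : ℂ) + ((2 * v / (1 + v ^ 2) : ℝ) : ℂ) * Complex.I := by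
    rw [← hc, ← hsn]
    rw [circleMap, Complex.exp_mul_I]
    push_cast
    ring
  rw [hw, cay]
  have h2 : (1 : ℂ) + (v:ℂ) ^ 2 ≠ 0 := by exact_mod_cast h1.ne'
  have h3 : (1 : ℂ) + Complex.I * v ≠ 0 := by
    intro h
    have := congrArg Complex.re h
    simp at this
  have h4 : (1 : ℂ) - Complex.I * v ≠ 0 := by
    intro h
    have := congrArg Complex.re h
    simp at this
  have hI : Complex.I ^ 2 = -1 := Complex.I_sq
  have hfac : (1 : ℂ) + (v:ℂ) ^ 2 = (1 + Complex.I * v) * (1 - Complex.I * v) := by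
    linear_combination (v:ℂ) ^ 2 * hI
  have hden : (1 : ℂ) - (((-(1 - v ^ 2) / (1 + v ^ 2) : ℝ) : ℂ)
      + ((2 * v / (1 + v ^ 2) : ℝ) : ℂ) * Complex.I) = 2 / (1 + Complex.I * v) := by
    rw [eq_div_iff h3]
    push_cast
    field_simp
    linear_combination (-2*(v:ℂ)^2) * hI
  have hnum : (1 : ℂ) + (((-(1 - v ^ 2) / (1 + v ^ 2) : ℝ) : ℂ)
      + ((2 * v / (1 + v ^ 2) : ℝ) : ℂ) * Complex.I) = 2 * Complex.I * v / (1 + Complex.I * v) := by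
    rw [eq_div_iff h3]
    push_cast
    field_simp
    linear_combination (2*(v:ℂ)^2) * hI
  rw [hden, hnum]
  field_simp
  linear_combination (-(v:ℂ)) * hI

lemma herglotz_avg (h : ℂ → ℂ) (hd : ∀ c : ℂ, c.im ≤ 0 → DifferentiableAt ℂ h c)
    (hn : ∀ c : ℂ, c.im ≤ 0 → 0 ≤ (h c).im) (B : ℝ) (hB : ∀ c : ℂ, c.im ≤ 0 → (h c).im ≤ B) :
    ∫ v in (-1:ℝ)..1, (h v).im ≤ 2 * Real.pi * (h (-Complex.I)).im := by
  have hpi := Real.pi_pos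
  set Φ : ℂ → ℂ := fun w => h (cay w) with hΦ
  have hΦd : ∀ w, ‖w‖ ≤ 1 → w ≠ 1 → DifferentiableAt ℂ Φ w := fun w hw hw1 =>
    (hd _ (cay_im w hw)).comp w (cay_diff w hw1)
  have hnorm : ∀ r : ℝ, 0 ≤ r → ∀ θ, ‖circleMap 0 r θ‖ = r := by
    intro r hr θ
    simp [abs_of_nonneg hr]
  have hcont : ∀ r : ℝ, 0 ≤ r → r < 1 → Continuous fun θ => (Φ (circleMap 0 r θ)).im := by
    intro r hr hr1
    refine Complex.continuous_im.comp (continuous_iff_continuousAt.2 fun θ => ?_)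
    refine ContinuousAt.comp (f := circleMap 0 r) (hΦd _ ?_ ?_).continuousAt
      (continuous_circleMap 0 r).continuousAt
    · rw [hnorm r hr]; exact hr1.le
    · intro h1
      have := hnorm r hr θ
      rw [h1] at this
      simp at this
      linarith
  -- mean value at radius r
  have hmv : ∀ r : ℝ, 0 ≤ r → r < 1 →
      ∫ θ in (Real.pi/2)..(3*Real.pi/2), (Φ (circleMap 0 r θ)).im ≤ 2 * Real.pi * (h (-Complex.I)).im := by
    intro r hr hr1
    have hdc : DiffContOnCl ℂ Φ (Metric.ball 0 |r|) := by
      refine DifferentiableOn.diffContOnCl (fun w hw => ?_)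
      have hw' : ‖w‖ ≤ r := by
        have := Metric.closure_ball_subset_closedBall hw
        simpa [abs_of_nonneg hr] using this
      refine (hΦd w (by linarith) ?_).differentiableWithinAt
      rintro rfl
      simp at hw'
      linarith
    have h1 := hdc.circleAverage
    rw [Real.circleAverage_def] at h1
    have h0 : Φ 0 = h (-Complex.I) := by simp [hΦ, cay]
    rw [h0] at h1
    have hcΦ : Continuous fun θ => Φ (circleMap 0 r θ) := by
      refine continuous_iff_continuousAt.2 fun θ => ?_
      refine ContinuousAt.comp (f := circleMap 0 r) (hΦd _ ?_ ?_).continuousAt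
        (continuous_circleMap 0 r).continuousAt
      · rw [hnorm r hr]; exact hr1.le
      · intro h1
        have := hnorm r hr θ
        rw [h1] at this
        simp at this
        linarith
    have h2 : ∫ θ in (0:ℝ)..(2*Real.pi), (Φ (circleMap 0 r θ)).im = 2 * Real.pi * (h (-Complex.I)).im := by
      have h3 := intervalIntegral.intervalIntegral_eq_integral_uIoc
        (fun θ => Φ (circleMap 0 r θ)) 0 (2*Real.pi) volume
      have h4 := Complex.imCLM.intervalIntegral_comp_comm
        (hcΦ.intervalIntegrable (μ := volume) 0 (2*Real.pi))
      simp only [Complex.imCLM_apply] at h4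
      rw [h4, ← h1]
      simp
      field_simp
    rw [← h2]
    have hii : ∀ a b, IntervalIntegrable (fun θ => (Φ (circleMap 0 r θ)).im) volume a b :=
      fun a b => (hcont r hr hr1).intervalIntegrable a b
    apply intervalIntegral.integral_mono_interval (by positivity) (by linarith) (by linarith)
    · refine Filter.Eventually.of_forall fun θ => ?_
      exact hn _ (cay_im _ (by rw [hnorm r hr]; exact hr1.le))
    · exact hii _ _
  -- boundary continuity
  have hne : ∀ θ ∈ Set.Icc (Real.pi/2) (3*Real.pi/2), circleMap 0 1 θ ≠ 1 := by
    intro θ hθ h1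
    have h2 := congrArg Complex.re h1
    rw [circleMap, Complex.exp_mul_I] at h2
    simp [Complex.cos_ofReal_re] at h2
    have h3 : Real.cos θ ≤ 0 := Real.cos_nonpos_of_pi_div_two_le_of_le hθ.1 (by linarith [hθ.2])
    linarith
  have hlim : Filter.Tendsto (fun r : ℝ => ∫ θ in (Real.pi/2)..(3*Real.pi/2), (Φ (circleMap 0 r θ)).im)
      (nhdsWithin 1 (Set.Ico 0 1))
      (nhds (∫ θ in (Real.pi/2)..(3*Real.pi/2), (Φ (circleMap 0 1 θ)).im)) := by
    apply intervalIntegral.tendsto_integral_filter_of_dominated_convergence (fun _ => B)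
    · filter_upwards [self_mem_nhdsWithin] with r hr
      exact (hcont r hr.1 hr.2).aestronglyMeasurable
    · filter_upwards [self_mem_nhdsWithin] with r hr
      refine Filter.Eventually.of_forall fun θ _ => ?_
      have him := cay_im (circleMap 0 r θ) (by rw [hnorm r hr.1]; exact hr.2.le)
      rw [Real.norm_of_nonneg (hn _ him)]
      exact hB _ him
    · exact intervalIntegrable_const
    · refine Filter.Eventually.of_forall fun θ hθ => ?_
      rw [Set.uIoc_of_le (by linarith)] at hθ
      have hθ' : θ ∈ Set.Icc (Real.pi/2) (3*Real.pi/2) := ⟨hθ.1.le, hθ.2⟩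
      have hca : ContinuousAt (fun r : ℝ => (Φ (circleMap 0 r θ)).im) 1 := by
        refine Complex.continuous_im.continuousAt.comp ?_
        refine ContinuousAt.comp (f := fun r : ℝ => circleMap 0 r θ)
          (hΦd _ (by rw [hnorm 1 zero_le_one]) (hne θ hθ')).continuousAt ?_
        have : Continuous fun r : ℝ => circleMap 0 r θ := by unfold circleMap; fun_prop
        exact this.continuousAt
      exact hca.tendsto.mono_left nhdsWithin_le_nhds
  have hbd : ∫ θ in (Real.pi/2)..(3*Real.pi/2), (Φ (circleMap 0 1 θ)).im
      ≤ 2 * Real.pi * (h (-Complex.I)).im := by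
    have : (nhdsWithin (1:ℝ) (Set.Ico 0 1)).NeBot := by
      rw [nhdsWithin_Ico_eq_nhdsLT one_pos]
      infer_instance
    refine le_of_tendsto hlim ?_
    filter_upwards [self_mem_nhdsWithin] with r hr
    exact hmv r hr.1 hr.2
  -- change of variables
  have hcG : ContinuousOn (fun θ => (Φ (circleMap 0 1 θ)).im) (Set.Icc (Real.pi/2) (3*Real.pi/2)) := by
    intro θ hθ
    refine ContinuousAt.continuousWithinAt ?_
    refine Complex.continuous_im.continuousAt.comp ?_
    exact ContinuousAt.comp (f := circleMap 0 1)
      (hΦd _ (by rw [hnorm 1 zero_le_one]) (hne θ hθ)).continuousAt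
      (continuous_circleMap 0 1).continuousAt
  have hat : ∀ v ∈ Set.Icc (-1:ℝ) 1, |Real.arctan v| ≤ Real.pi / 4 := by
    intro v hv
    rw [abs_le]
    constructor
    · have := Real.arctan_mono hv.1
      rw [Real.arctan_neg, Real.arctan_one] at this
      exact this
    · have := Real.arctan_mono hv.2
      rw [Real.arctan_one] at this
      exact this
  have hcv := intervalIntegral.integral_comp_mul_deriv' (a := -1) (b := 1)
    (f := fun v => Real.pi - 2 * Real.arctan v) (f' := fun v => -(2 * (1 / (1 + v ^ 2))))
    (g := fun θ => (Φ (circleMap 0 1 θ)).im)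
    (fun v _ => by
      have := ((Real.hasDerivAt_arctan v).const_mul 2).const_sub Real.pi
      simpa using this)
    (by
      refine Continuous.continuousOn ?_
      have : ∀ v : ℝ, 1 + v ^ 2 ≠ 0 := fun v => by positivity
      fun_prop (disch := exact this))
    (by
      refine hcG.mono ?_
      rintro _ ⟨v, hv, rfl⟩
      rw [Set.uIcc_of_le (by norm_num)] at hv
      have := abs_le.1 (hat v hv)
      constructor <;> simp only <;> linarith)
  simp only [Function.comp, Real.arctan_neg, Real.arctan_one, hΦ, cay_exp] at hcv
  rw [show Real.pi - 2 * (Real.pi/4) = Real.pi/2 by ring,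
    show Real.pi - 2 * -(Real.pi/4) = 3*Real.pi/2 by ring] at hcv
  have hcv2 : ∫ v in (-1:ℝ)..1, (h v).im * (2 * (1 / (1 + v ^ 2)))
      = ∫ θ in (Real.pi/2)..(3*Real.pi/2), (Φ (circleMap 0 1 θ)).im := by
    rw [intervalIntegral.integral_symm (Real.pi/2) (3*Real.pi/2)] at hcv
    refine neg_injective ?_
    refine Eq.trans ?_ hcv
    rw [← intervalIntegral.integral_neg]
    congr 1; ext v; ring
  refine le_trans ?_ (hcv2.le.trans hbd)
  have hch : Continuous fun v : ℝ => (h v).im := by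
    refine Complex.continuous_im.comp (continuous_iff_continuousAt.2 fun v => ?_)
    exact ContinuousAt.comp (f := fun v : ℝ => (v:ℂ)) (hd _ (by simp)).continuousAt
      Complex.continuous_ofReal.continuousAt
  have hne2 : ∀ v : ℝ, 1 + v ^ 2 ≠ 0 := fun v => by positivity
  apply intervalIntegral.integral_mono_on (by norm_num) (hch.intervalIntegrable _ _)
  · exact Continuous.intervalIntegrable (by fun_prop (disch := exact hne2)) _ _
  · intro v hv
    have h0 := hn (v:ℂ) (by simp)
    refine le_mul_of_one_le_right h0 ?_
    have : v ^ 2 ≤ 1 := by nlinarith [hv.1, hv.2]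
    rw [mul_one_div, le_div_iff₀ (by positivity)]
    linarith

/-- Spectral averaging: averaging the diagonal resolvent entry over one coupling. -/
lemma spectral_avg {I : Type*} [Fintype I] [DecidableEq I]
    {g : Measure ℝ} (hg : g (Set.Icc (-1 : ℝ) 1)ᶜ = 0) (C : ℝ≥0)
    (hC : ∀ A : Set ℝ, g A ≤ (C : ℝ≥0∞) * volume A)
    (A : Matrix I I ℝ) (hA : ∀ p q, A p q = A q p) (χ : I → ℝ) (hχ : ∀ p, 0 ≤ χ p)
    (p0 : I) (h0 : χ p0 = 1) (γ : ℝ) (hγ : 1 ≤ γ) (z : ℂ) (hz' : 0 < z.im) :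
    ∫⁻ t, ENNReal.ofReal (hz A χ p0 ((γ * t : ℝ) : ℂ) z).im ∂g ≤ C * ENNReal.ofReal (2 * Real.pi) := by
  set h : ℂ → ℂ := fun v => hz A χ p0 (γ * v) z with hh
  have him : ∀ c : ℂ, c.im ≤ 0 → ((γ:ℂ) * c).im ≤ 0 := by
    intro c hc
    simp
    nlinarith
  have hd : ∀ c : ℂ, c.im ≤ 0 → DifferentiableAt ℂ h c := fun c hc =>
    DifferentiableAt.comp (g := fun c => hz A χ p0 c z) c
      (hz_differentiable A hA χ hχ p0 _ z (him c hc) hz') (by fun_prop)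
  have hn : ∀ c : ℂ, c.im ≤ 0 → 0 ≤ (h c).im := fun c hc =>
    hz_im_nonneg A hA χ hχ p0 h0 _ z (him c hc) hz'
  have hB : ∀ c : ℂ, c.im ≤ 0 → (h c).im ≤ 1 / z.im := fun c hc =>
    hz_bound A hA χ hχ p0 h0 _ z (him c hc) hz' _ hz' (by linarith [him c hc])
  have h1 := herglotz_avg h hd hn _ hB
  have h2 : (h (-Complex.I)).im ≤ 1 := by
    have := hz_bound A hA χ hχ p0 h0 ((γ:ℂ) * -Complex.I) z (him _ (by simp)) hz' 1 one_pos
      (by simp; linarith)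
    simpa only [div_one] using this
  have h3 : ∫ v in (-1:ℝ)..1, (h v).im ≤ 2 * Real.pi := by
    refine h1.trans ?_
    have := Real.pi_pos
    nlinarith
  have hch : Continuous fun v : ℝ => (h v).im := by
    refine Complex.continuous_im.comp (continuous_iff_continuousAt.2 fun v => ?_)
    exact ContinuousAt.comp (f := fun v : ℝ => (v:ℂ)) (hd _ (by simp)).continuousAt
      Complex.continuous_ofReal.continuousAt
  have hle : g ≤ (C : ℝ≥0∞) • (volume.restrict (Set.Icc (-1:ℝ) 1)) := by
    refine Measure.le_iff.2 fun s hs => ?_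
    rw [Measure.smul_apply, smul_eq_mul, Measure.restrict_apply hs]
    calc g s ≤ g (s ∩ Set.Icc (-1) 1) + g (Set.Icc (-1:ℝ) 1)ᶜ := by
          refine (measure_mono ?_).trans (measure_union_le _ _)
          intro y hy
          by_cases h : y ∈ Set.Icc (-1:ℝ) 1
          · exact Or.inl ⟨hy, h⟩
          · exact Or.inr h
      _ ≤ _ := by rw [hg, add_zero]; exact hC _
  calc ∫⁻ t, ENNReal.ofReal (hz A χ p0 ((γ * t : ℝ) : ℂ) z).im ∂g
      = ∫⁻ t, ENNReal.ofReal (h (t:ℂ)).im ∂g := by simp [hh]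
    _ ≤ ∫⁻ t, ENNReal.ofReal (h (t:ℂ)).im ∂((C : ℝ≥0∞) • (volume.restrict (Set.Icc (-1:ℝ) 1))) :=
        lintegral_mono' hle le_rfl
    _ = C * ∫⁻ t in Set.Icc (-1:ℝ) 1, ENNReal.ofReal (h (t:ℂ)).im := by
        rw [lintegral_smul_measure, smul_eq_mul]
    _ ≤ _ := by
        gcongr
        rw [← ofReal_integral_eq_lintegral_ofReal]
        · rw [integral_Icc_eq_integral_Ioc, ← intervalIntegral.integral_of_le (by norm_num)]
          exact ENNReal.ofReal_le_ofReal h3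
        · exact hch.continuousOn.integrableOn_Icc
        · exact Filter.Eventually.of_forall fun t => hn _ (by simp)
end

section

section eigexp
variable {I : Type*} [Fintype I] [DecidableEq I]

lemma hz_eig (A : Matrix I I ℝ) (hA : ∀ p q, A p q = A q p) (χ : I → ℝ) (hχ : ∀ p, 0 ≤ χ p)
    (p0 : I) (c : ℝ) (z : ℂ) (hz' : 0 < z.im) (E : I → ℝ) (Ψ : I → I → ℝ)
    (h : IsEig (fun p q => A p q + if p = q then c * χ p else 0) E Ψ) :
    hz A χ p0 (c:ℂ) z = ∑ k, ((Ψ k p0 ^ 2 : ℝ) : ℂ) / (E k - z) := by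
  have hne : ∀ k, ((E k : ℂ) - z) ≠ 0 := by
    intro k hk
    have := congrArg Complex.im hk
    simp at this
    linarith
  set u : I → ℂ := fun p => ∑ k, (Ψ k p0 : ℂ) * (Ψ k p : ℂ) / (E k - z) with hu
  have hunit : IsUnit (Mz A χ c z).det := (Mz_det A hA χ hχ c z (by simp) hz').isUnit
  have hMu : (Mz A χ c z).mulVec u = Pi.single p0 1 := by
    ext p
    rw [Mz_mulVec]
    have h1 : ∀ k, ∑ q, (A p q : ℂ) * (Ψ k q : ℂ) = (E k : ℂ) * Ψ k p - c * χ p * Ψ k p := by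
      intro k
      have := h.eig k p
      simp only [add_mul, Finset.sum_add_distrib, ite_mul, zero_mul, Finset.sum_ite_eq,
        Finset.mem_univ, if_true] at this
      have h2 : ∑ q, A p q * Ψ k q = E k * Ψ k p - c * χ p * Ψ k p := by linarith
      exact_mod_cast h2
    have h3 : ∑ q, (A p q : ℂ) * u q
        = ∑ k, (Ψ k p0 : ℂ) / (E k - z) * ((E k : ℂ) * Ψ k p - c * χ p * Ψ k p) := by
      simp only [hu, Finset.mul_sum]
      rw [Finset.sum_comm]
      refine Finset.sum_congr rfl fun k _ => ?_
      rw [← h1 k, Finset.mul_sum]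
      refine Finset.sum_congr rfl fun q _ => ?_
      ring
    rw [h3, hu]
    simp only [Finset.mul_sum, ← Finset.sum_add_distrib]
    have h4 : ∀ k, (Ψ k p0 : ℂ) / (E k - z) * ((E k : ℂ) * Ψ k p - c * χ p * Ψ k p)
        + (c * χ p - z) * ((Ψ k p0 : ℂ) * (Ψ k p : ℂ) / (E k - z)) = Ψ k p0 * Ψ k p := by
      intro k
      have := hne k
      field_simp
      ring
    rw [Finset.sum_congr rfl fun k _ => h4 k]
    have h5 := h.comp p0 p
    have h6 : (∑ k, (Ψ k p0 : ℂ) * Ψ k p) = if p0 = p then 1 else 0 := by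
      have := congrArg (fun r : ℝ => (r : ℂ)) h5
      push_cast at this
      rw [this]
      split_ifs <;> simp
    rw [h6]
    by_cases hpp : p0 = p
    · subst hpp; simp
    · simp [hpp, Pi.single_apply, Ne.symm hpp]
  have hinv : u = (Mz A χ c z)⁻¹.mulVec (Pi.single p0 1) := by
    rw [← hMu, Matrix.mulVec_mulVec, Matrix.nonsing_inv_mul _ hunit, Matrix.one_mulVec]
  have : hz A χ p0 c z = u p0 := by
    rw [hinv]
    simp [hz]
  rw [this, hu]
  refine Finset.sum_congr rfl fun k _ => ?_
  push_cast
  ring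

lemma hz_eig_im (A : Matrix I I ℝ) (hA : ∀ p q, A p q = A q p) (χ : I → ℝ) (hχ : ∀ p, 0 ≤ χ p)
    (p0 : I) (c : ℝ) (e η : ℝ) (hη : 0 < η) (E : I → ℝ) (Ψ : I → I → ℝ)
    (h : IsEig (fun p q => A p q + if p = q then c * χ p else 0) E Ψ) :
    (hz A χ p0 (c:ℂ) ⟨e, η⟩).im = ∑ k, Ψ k p0 ^ 2 * (η / ((E k - e) ^ 2 + η ^ 2)) := by
  rw [hz_eig A hA χ hχ p0 c _ hη E Ψ h, Complex.im_sum]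
  refine Finset.sum_congr rfl fun k _ => ?_
  rw [Complex.div_im]
  simp [Complex.normSq_apply, - Complex.ofReal_pow]
  ring_nf

end eigexp

lemma measurable_det' {I X : Type*} [Fintype I] [DecidableEq I] [MeasurableSpace X] {𝕜 : Type*} [RCLike 𝕜]
    {f : X → Matrix I I 𝕜} (hf : ∀ p q, Measurable fun x => f x p q) :
    Measurable fun x => (f x).det := by
  simp only [Matrix.det_apply']
  refine Finset.measurable_sum _ fun σ _ => ?_
  refine measurable_const.mul ?_
  refine Finset.measurable_prod _ fun p _ => hf _ _

lemma measurable_inv_entry {I X : Type*} [Fintype I] [DecidableEq I] [MeasurableSpace X] {𝕜 : Type*} [RCLike 𝕜]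
    {f : X → Matrix I I 𝕜} (hf : ∀ p q, Measurable fun x => f x p q) (p q : I) :
    Measurable fun x => (f x)⁻¹ p q := by
  have e : (fun x => (f x)⁻¹ p q) = fun x => (f x).det⁻¹ * ((f x).updateRow q (Pi.single p 1)).det := by
    ext x
    rw [Matrix.inv_def, Matrix.smul_apply, Ring.inverse_eq_inv', smul_eq_mul, Matrix.adjugate_apply]
  rw [e]
  refine (measurable_det' hf).inv.mul (measurable_det' fun p' q' => ?_)
  by_cases h : p' = q
  · subst h; simp only [Matrix.updateRow_self]; exact measurable_const
  · simp only [Matrix.updateRow_ne h]; exact hf _ _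

/-- Averaged Wegner-type bound with an energy set that does not depend on the resampled site. -/
lemma wegner {d : ℕ} {I : Type*} [Fintype I] [DecidableEq I]
    {g : Measure ℝ} (hgp : IsProbabilityMeasure g) (hg : g (Set.Icc (-1 : ℝ) 1)ᶜ = 0) (C : ℝ≥0)
    (hC : ∀ A : Set ℝ, g A ≤ (C : ℝ≥0∞) * volume A)
    {P : Measure (Site d → ℝ)} (hP : IsProductMeasure g P) (x : Site d)
    (A : (Site d → ℝ) → Matrix I I ℝ) (hA : ∀ v p q, A v p q = A v q p)
    (hAm : ∀ p q, Measurable fun v => A v p q)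
    (hAx : ∀ v t, A (Function.update v x t) = A v)
    (χ : I → ℝ) (hχ : ∀ p, 0 ≤ χ p)
    (p0 : I) (h0 : χ p0 = 1) (γ : ℝ) (hγ : 1 ≤ γ)
    (B : Set ((Site d → ℝ) × ℝ)) (hB : IsOpen B)
    (hBx : ∀ v t e, (Function.update v x t, e) ∈ B ↔ (v, e) ∈ B) :
    ∃ Y : (Site d → ℝ) → ℝ≥0∞, Measurable Y ∧
      (∫⁻ v, Y v ∂P ≤ 2 * (C * ENNReal.ofReal (2 * Real.pi)) * (P.prod volume) B) ∧
      ∀ v E Ψ, IsEig (fun p q => A v p q + if p = q then (γ * v x) * χ p else 0) E Ψ →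
        ∀ s : Finset I, (∀ k ∈ s, (v, E k) ∈ B) →
        ENNReal.ofReal (∑ k ∈ s, Ψ k p0 ^ 2) ≤ Y v := by
  have hp := hP.1
  set η : ℕ → ℝ := fun j => 1 / ((j:ℝ) + 1) with hη
  have hη0 : ∀ j, 0 < η j := fun j => by positivity
  set f : ℕ → (Site d → ℝ) × ℝ → ℝ≥0∞ := fun j w =>
    B.indicator (fun w => ENNReal.ofReal (hz (A w.1) χ p0 ((γ * w.1 x : ℝ) : ℂ) ⟨w.2, η j⟩).im) w
    with hf
  have hfm : ∀ j, Measurable (f j) := by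
    intro j
    refine Measurable.indicator ?_ hB.measurableSet
    refine ENNReal.measurable_ofReal.comp (Complex.measurable_im.comp ?_)
    unfold hz
    refine measurable_inv_entry (fun p q => ?_) _ _
    unfold Mz
    refine Measurable.add (Complex.measurable_ofReal.comp ((hAm p q).comp measurable_fst)) ?_
    have hz0 : Measurable fun w : (Site d → ℝ) × ℝ => (⟨w.2, η j⟩ : ℂ) := by
      have : (fun w : (Site d → ℝ) × ℝ => (⟨w.2, η j⟩ : ℂ)) = fun w => (w.2 : ℂ) + (η j : ℂ) * Complex.I := by
        ext w; apply Complex.ext <;> simp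
      rw [this]; fun_prop
    have hv0 : Measurable fun w : (Site d → ℝ) × ℝ => ((γ * w.1 x : ℝ) : ℂ) := by fun_prop
    split_ifs
    · exact (hv0.mul_const _).sub hz0
    · exact measurable_const
  have hFm : ∀ j, Measurable fun v => ∫⁻ e, f j (v, e) := fun j =>
    Measurable.lintegral_prod_right' (hfm j)
  refine ⟨fun v => 2 * Filter.liminf (fun j => ∫⁻ e, f j (v, e)) Filter.atTop, ?_, ?_, ?_⟩
  · exact measurable_const.mul (Measurable.liminf hFm)
  · rw [lintegral_const_mul _ (Measurable.liminf hFm), mul_assoc]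
    gcongr
    refine (lintegral_liminf_le hFm).trans ?_
    refine Filter.liminf_le_of_le (by isBoundedDefault) ?_
    intro b hb
    obtain ⟨j, hj⟩ := hb.exists
    refine hj.trans ?_
    rw [resample hgp hP x _ (hFm j), Measure.prod_apply hB.measurableSet,
      ← lintegral_const_mul]
    swap
    · exact measurable_measure_prodMk_left hB.measurableSet
    refine lintegral_mono fun v => ?_
    rw [lintegral_lintegral_swap]
    swap
    · refine Measurable.aemeasurable ?_
      refine (hfm j).comp ?_
      refine Measurable.prodMk ?_ measurable_snd
      exact (measurable_update' (a := x)).comp ((measurable_const (a := v)).prodMk measurable_fst)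
    have : ∀ e, ∫⁻ t, f j (Function.update v x t, e) ∂g
        ≤ (Prod.mk v ⁻¹' B).indicator (fun _ => C * ENNReal.ofReal (2 * Real.pi)) e := by
      intro e
      by_cases he : (v, e) ∈ B
      · rw [Set.indicator_of_mem (by exact he)]
        refine le_trans (le_of_eq ?_) (spectral_avg hg C hC (A v) (hA v) χ hχ p0 h0 γ hγ ⟨e, η j⟩ (hη0 j))
        refine lintegral_congr fun t => ?_
        simp only [hf]
        rw [Set.indicator_of_mem (by rw [hBx]; exact he)]
        simp [hAx]
      · rw [Set.indicator_of_notMem (by exact he)]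
        simp only [hf]
        rw [nonpos_iff_eq_zero]
        refine (lintegral_congr fun t => ?_).trans (lintegral_zero (μ := g))
        rw [Set.indicator_of_notMem (by rw [hBx]; exact he)]
    refine (lintegral_mono this).trans ?_
    rw [lintegral_indicator_const (hB.measurableSet.preimage measurable_prodMk_left)]
  · intro v E Ψ hE s hs
    have key : ∀ᶠ j in Filter.atTop, ∀ k ∈ s, Set.Ico (E k) (E k + η j) ⊆ Prod.mk v ⁻¹' B := by
      rw [Filter.eventually_all_finset]
      intro k hk
      have ho : IsOpen (Prod.mk v ⁻¹' B) := hB.preimage (by fun_prop)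
      obtain ⟨r, hr, hr2⟩ := Metric.isOpen_iff.1 ho (E k) (hs k hk)
      obtain ⟨N, hN⟩ := exists_nat_one_div_lt hr
      filter_upwards [Filter.eventually_ge_atTop N] with j hj e he
      apply hr2
      rw [Metric.mem_ball, Real.dist_eq, abs_of_nonneg (by linarith [he.1])]
      have : η j ≤ 1 / ((N:ℝ) + 1) := by
        simp only [hη]
        gcongr
      linarith [he.2]
    have hh : ENNReal.ofReal (∑ k ∈ s, Ψ k p0 ^ 2) / 2
        ≤ Filter.liminf (fun j => ∫⁻ e, f j (v, e)) Filter.atTop := by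
      refine Filter.le_liminf_of_le (by isBoundedDefault) ?_
      filter_upwards [key] with j hj
      have hpt : ∀ e, ∑ k ∈ s, (Set.Ico (E k) (E k + η j)).indicator
          (fun _ => ENNReal.ofReal (Ψ k p0 ^ 2 * (1 / (2 * η j)))) e ≤ f j (v, e) := by
        intro e
        by_cases he : (v, e) ∈ B
        · simp only [hf]
          rw [Set.indicator_of_mem he]
          simp only
          rw [hz_eig_im (A v) (hA v) χ hχ p0 _ e (η j) (hη0 j) E Ψ hE,
            ENNReal.ofReal_sum_of_nonneg]
          swap
          · intro k _; have := hη0 j; positivity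
          refine (Finset.sum_le_sum fun k _ => ?_).trans
            (Finset.sum_le_sum_of_subset (Finset.subset_univ s))
          by_cases hk : e ∈ Set.Ico (E k) (E k + η j)
          · rw [Set.indicator_of_mem hk]
            apply ENNReal.ofReal_le_ofReal
            refine mul_le_mul_of_nonneg_left ?_ (sq_nonneg _)
            have h1 := hη0 j
            have h2 : (E k - e) ^ 2 ≤ η j ^ 2 := by
              apply sq_le_sq'
              · linarith [hk.2]
              · linarith [hk.1]
            rw [div_le_div_iff₀ (by positivity) (by positivity)]
            nlinarith
          · rw [Set.indicator_of_notMem hk]; exact zero_le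
        · have : ∀ k ∈ s, (Set.Ico (E k) (E k + η j)).indicator
            (fun _ => ENNReal.ofReal (Ψ k p0 ^ 2 * (1 / (2 * η j)))) e = 0 := by
            intro k hk
            apply Set.indicator_of_notMem
            intro h
            exact he (hj k hk h)
          rw [Finset.sum_eq_zero this]
          exact zero_le
      refine le_trans ?_ (lintegral_mono hpt)
      rw [lintegral_finsetSum _ (fun k _ => measurable_const.indicator measurableSet_Ico)]
      simp only [lintegral_indicator_const measurableSet_Ico, Real.volume_Ico]
      have : ∀ k, ENNReal.ofReal (Ψ k p0 ^ 2 * (1 / (2 * η j))) * ENNReal.ofReal (E k + η j - E k)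
          = ENNReal.ofReal (Ψ k p0 ^ 2 / 2) := by
        intro k
        have h1 := hη0 j
        rw [← ENNReal.ofReal_mul (by positivity)]
        congr 1
        field_simp
        ring
      rw [Finset.sum_congr rfl fun k _ => this k, ← ENNReal.ofReal_sum_of_nonneg (fun k _ => by positivity),
        ← Finset.sum_div, ENNReal.ofReal_div_of_pos (by norm_num)]
      simp
    calc ENNReal.ofReal (∑ k ∈ s, Ψ k p0 ^ 2) = 2 * (ENNReal.ofReal (∑ k ∈ s, Ψ k p0 ^ 2) / 2) := by
          rw [ENNReal.mul_div_cancel (by norm_num) (by norm_num)]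
      _ ≤ _ := mul_le_mul_right hh 2

end

section

section BMsec
variable {I : Type*} [Fintype I] [DecidableEq I]

/-- The matrix `M` restricted to `S`, completed by the identity off `S`. -/
def BM (M : Matrix I I ℝ) (S : Finset I) : Matrix I I ℝ := fun p q =>
  if p ∈ S then (if q ∈ S then M p q else 0) else if p = q then 1 else 0

lemma BM_mulVec (M : Matrix I I ℝ) (S : Finset I) (u : I → ℝ) (p : I) :
    (BM M S).mulVec u p = if p ∈ S then ∑ q ∈ S, M p q * u q else u p := by
  simp only [Matrix.mulVec, dotProduct, BM]
  split_ifs with h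
  · simp [ite_mul, Finset.sum_ite_mem]
  · simp

/-- Solving a linear system on `S`. -/
lemma BM_solve (M : Matrix I I ℝ) (S : Finset I) (hdet : (BM M S).det ≠ 0) (u f : I → ℝ)
    (h : ∀ p ∈ S, ∑ q ∈ S, M p q * u q = f p) (r : I) (hr : r ∈ S) :
    u r = ∑ p ∈ S, (BM M S)⁻¹ r p * f p := by
  set u' : I → ℝ := fun p => if p ∈ S then u p else 0
  set f' : I → ℝ := fun p => if p ∈ S then f p else 0
  have h1 : (BM M S).mulVec u' = f' := by
    ext p
    rw [BM_mulVec]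
    by_cases hp : p ∈ S
    · simp only [hp, if_true, u', f']
      rw [← h p hp]
      refine Finset.sum_congr rfl fun q hq => by rw [if_pos hq]
    · simp [hp, u', f']
  have h2 : u' = (BM M S)⁻¹.mulVec f' := by
    rw [← h1, Matrix.mulVec_mulVec, Matrix.nonsing_inv_mul _ hdet.isUnit, Matrix.one_mulVec]
  have h3 := congrFun h2 r
  simp only [u', hr, if_true, Matrix.mulVec, dotProduct, f'] at h3
  rw [h3]
  simp [mul_ite, Finset.sum_ite_mem]

lemma BM_step_core (M : Matrix I I ℝ) (S : Finset I) (x : I) (hx : x ∉ S) (hdet : (BM M S).det ≠ 0)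
    (u f : I → ℝ) (h : (BM M (insert x S)).mulVec u = f) :
    (M x x - ∑ q ∈ S, ∑ p ∈ S, M x q * (BM M S)⁻¹ q p * M p x) * u x
      = f x - ∑ q ∈ S, ∑ p ∈ S, M x q * (BM M S)⁻¹ q p * f p := by
  have h1 : ∀ p ∈ S, ∑ q ∈ S, M p q * u q = f p - M p x * u x := by
    intro p hp
    have := congrFun h p
    rw [BM_mulVec, if_pos (Finset.mem_insert_of_mem hp), Finset.sum_insert hx] at this
    linarith
  have h2 := congrFun h x
  rw [BM_mulVec, if_pos (Finset.mem_insert_self _ _), Finset.sum_insert hx] at h2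
  have h3 : ∑ q ∈ S, M x q * u q
      = ∑ q ∈ S, ∑ p ∈ S, M x q * (BM M S)⁻¹ q p * f p
        - (∑ q ∈ S, ∑ p ∈ S, M x q * (BM M S)⁻¹ q p * M p x) * u x := by
    rw [Finset.sum_mul, ← Finset.sum_sub_distrib]
    refine Finset.sum_congr rfl fun q hq => ?_
    rw [BM_solve M S hdet u (fun p => f p - M p x * u x) h1 q hq, Finset.mul_sum, Finset.sum_mul,
      ← Finset.sum_sub_distrib]
    refine Finset.sum_congr rfl fun p hp => ?_
    ring
  linarith

lemma BM_step (M : Matrix I I ℝ) (S : Finset I) (x : I) (hx : x ∉ S) (hdet : (BM M S).det ≠ 0)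
    (hc : M x x - ∑ q ∈ S, ∑ p ∈ S, M x q * (BM M S)⁻¹ q p * M p x ≠ 0) :
    (BM M (insert x S)).det ≠ 0 ∧
    (BM M (insert x S))⁻¹ x x
      = (M x x - ∑ q ∈ S, ∑ p ∈ S, M x q * (BM M S)⁻¹ q p * M p x)⁻¹ ∧
    ∀ y ∈ S, (BM M (insert x S))⁻¹ x y
      = -((M x x - ∑ q ∈ S, ∑ p ∈ S, M x q * (BM M S)⁻¹ q p * M p x)⁻¹ *
        ∑ q ∈ S, M x q * (BM M S)⁻¹ q y) := by
  have hd : (BM M (insert x S)).det ≠ 0 := by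
    intro h0
    obtain ⟨u, hu, hu2⟩ := Matrix.exists_mulVec_eq_zero_iff.2 h0
    have h1 := BM_step_core M S x hx hdet u 0 hu2
    simp only [Pi.zero_apply, mul_zero, Finset.sum_const_zero, sub_zero] at h1
    have hux : u x = 0 := (mul_eq_zero.1 h1).resolve_left hc
    apply hu
    ext p
    have h2 := congrFun hu2 p
    rw [BM_mulVec] at h2
    by_cases hp : p = x
    · rw [hp, hux]; rfl
    · by_cases hpS : p ∈ S
      · rw [BM_solve M S hdet u 0 ?_ p hpS]
        · simp
        · intro p' hp'
          have h3 := congrFun hu2 p'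
          rw [BM_mulVec, if_pos (Finset.mem_insert_of_mem hp'), Finset.sum_insert hx, hux] at h3
          simpa using h3
      · rw [if_neg (by simp [hp, hpS])] at h2
        exact h2
  have hcol : ∀ y, (BM M (insert x S)).mulVec (fun p => (BM M (insert x S))⁻¹ p y)
      = fun p => if p = y then 1 else 0 := by
    intro y
    ext p
    have := congrFun (congrFun (Matrix.mul_nonsing_inv _ hd.isUnit) p) y
    rw [Matrix.mul_apply, Matrix.one_apply] at this
    exact this
  refine ⟨hd, ?_, ?_⟩
  · have h1 := BM_step_core M S x hx hdet _ _ (hcol x)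
    simp only [if_true] at h1
    rw [Finset.sum_eq_zero (s := S) (f := fun q => ∑ p ∈ S, M x q * (BM M S)⁻¹ q p * if p = x then 1 else 0),
      sub_zero] at h1
    · exact eq_inv_of_mul_eq_one_right h1
    · intro q _
      refine Finset.sum_eq_zero fun p hp => ?_
      have hpx : p ≠ x := fun h => hx (h ▸ hp)
      rw [if_neg hpx, mul_zero]
  · intro y hy
    have h1 := BM_step_core M S x hx hdet _ _ (hcol y)
    have hxy : x ≠ y := fun h => hx (h ▸ hy)
    simp only [hxy, if_false, mul_ite, mul_one, mul_zero, Finset.sum_ite_eq', hy, if_true] at h1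
    rw [zero_sub] at h1
    field_simp
    linarith

end BMsec

/-- Hopping matrix of the discrete Laplacian. -/
def hop {d : ℕ} (i j : Site d) : ℝ :=
  ∑ k, ((if j = i + unitVec k then 1 else 0) + (if j = i - unitVec k then 1 else 0))

lemma l1_add_le {d : ℕ} (i j : Site d) : l1 (i + j) ≤ l1 i + l1 j := by
  unfold l1
  rw [← Finset.sum_add_distrib]
  exact Finset.sum_le_sum fun k _ => Int.natAbs_add_le _ _

lemma l1_neg {d : ℕ} (i : Site d) : l1 (-i) = l1 i := by simp [l1]

lemma l1_unitVec {d : ℕ} (k : Fin d) : l1 (unitVec k : Site d) = 1 := by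
  unfold l1 unitVec
  rw [Finset.sum_eq_single k] <;> simp +contextual

lemma hop_symm {d : ℕ} (i j : Site d) : hop i j = hop j i := by
  unfold hop
  refine Finset.sum_congr rfl fun k _ => ?_
  rw [add_comm]
  congr 1
  · congr 1
    rw [eq_iff_iff, eq_sub_iff_add_eq, eq_comm]
  · congr 1
    rw [eq_iff_iff, eq_sub_iff_add_eq, eq_comm]

lemma hop_nonneg {d : ℕ} (i j : Site d) : 0 ≤ hop i j := by
  unfold hop
  refine Finset.sum_nonneg fun k _ => ?_
  split_ifs <;> norm_num

lemma hop_nat {d : ℕ} (i j : Site d) : ∃ n : ℕ, hop i j = n := by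
  refine ⟨∑ k, ((if j = i + unitVec k then 1 else 0) + (if j = i - unitVec k then 1 else 0)), ?_⟩
  unfold hop
  push_cast
  rfl

lemma hop_ne {d : ℕ} {i j : Site d} (h : hop i j ≠ 0) : l1 (i - j) = 1 := by
  unfold hop at h
  obtain ⟨k, _, hk⟩ := Finset.exists_ne_zero_of_sum_ne_zero h
  by_cases h1 : j = i + unitVec k
  · rw [h1, show i - (i + unitVec k) = -unitVec k by abel, l1_neg, l1_unitVec]
  · by_cases h2 : j = i - unitVec k
    · rw [h2, show i - (i - unitVec k) = unitVec k by abel, l1_unitVec]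
    · simp [h1, h2] at hk

lemma hop_self {d : ℕ} (i : Site d) : hop i i = 0 := by
  by_contra h
  have := hop_ne h
  simp [l1] at this

lemma hop_sum_le {d : ℕ} (i : Site d) (s : Finset (Site d)) : ∑ j ∈ s, hop i j ≤ 2 * d := by
  unfold hop
  rw [Finset.sum_comm]
  calc _ ≤ ∑ k : Fin d, (2:ℝ) := by
        refine Finset.sum_le_sum fun k _ => ?_
        rw [Finset.sum_add_distrib]
        simp only [Finset.sum_ite_eq']
        split_ifs <;> norm_num
    _ = _ := by simp [mul_comm]

lemma hop_le {d : ℕ} (i j : Site d) : hop i j ≤ 2 * d := by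
  simpa using hop_sum_le i {j}

/-- Static Hamiltonian entries. -/
def hst {d : ℕ} (γ : ℝ) (v : Site d → ℝ) (i j : Site d) : ℝ :=
  hop i j + if i = j then γ * v i else 0

lemma hst_symm {d : ℕ} (γ : ℝ) (v : Site d → ℝ) (i j : Site d) : hst γ v i j = hst γ v j i := by
  unfold hst
  rw [hop_symm]
  by_cases h : i = j
  · subst h; rfl
  · simp [h, Ne.symm h]

/-- The constant in the one-site fractional moment. -/
def kap (C : ℝ≥0) : ℝ≥0∞ := 1 + C * ∫⁻ s in Set.Icc (-1:ℝ) 1, ENNReal.ofReal (Real.sqrt |s|⁻¹)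

lemma kap_lt (C : ℝ≥0) : kap C < ⊤ := by
  unfold kap
  refine ENNReal.add_lt_top.2 ⟨ENNReal.one_lt_top, ENNReal.mul_lt_top ENNReal.coe_lt_top ?_⟩
  have h1 : IntegrableOn (fun s : ℝ => s ^ (-(1/2) : ℝ)) (Set.Ioc 0 1) := by
    have := intervalIntegral.intervalIntegrable_rpow' (a := 0) (b := 1) (r := -(1/2)) (by norm_num)
    rwa [intervalIntegrable_iff_integrableOn_Ioc_of_le (by norm_num)] at this
  have h2 : ∫⁻ s in Set.Ioc (0:ℝ) 1, ENNReal.ofReal (Real.sqrt |s|⁻¹) < ⊤ := by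
    refine lt_of_le_of_lt (le_of_eq ?_) h1.lintegral_lt_top
    refine setLIntegral_congr_fun measurableSet_Ioc fun s hs => ?_
    rw [abs_of_pos hs.1, Real.sqrt_eq_rpow, Real.inv_rpow hs.1.le, Real.rpow_neg hs.1.le]
  have h3 : ∫⁻ s in Set.Ico (-1:ℝ) 0, ENNReal.ofReal (Real.sqrt |s|⁻¹) < ⊤ := by
    have hmp : MeasurePreserving (fun s : ℝ => -s) volume volume := Measure.measurePreserving_neg _
    have := hmp.setLIntegral_comp_preimage (s := Set.Ioc (0:ℝ) 1) measurableSet_Ioc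
      (f := fun s => ENNReal.ofReal (Real.sqrt |s|⁻¹)) (by fun_prop)
    rw [← this] at h2
    simpa using h2
  have h4 : Set.Icc (-1:ℝ) 1 ⊆ Set.Ico (-1) 0 ∪ (Set.Ioc 0 1 ∪ {0}) := by
    intro s hs
    rcases lt_trichotomy s 0 with h | h | h
    · exact Or.inl ⟨hs.1, h⟩
    · exact Or.inr (Or.inr h)
    · exact Or.inr (Or.inl ⟨h, hs.2⟩)
  refine (lintegral_mono_set h4).trans_lt ?_
  refine (lintegral_union_le _ _ _).trans_lt (ENNReal.add_lt_top.2 ⟨h3, ?_⟩)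
  refine (lintegral_union_le _ _ _).trans_lt (ENNReal.add_lt_top.2 ⟨h2, ?_⟩)
  simp

lemma one_site {g : Measure ℝ} (hgp : IsProbabilityMeasure g) (C : ℝ≥0)
    (hC : ∀ A : Set ℝ, g A ≤ (C : ℝ≥0∞) * volume A) (γ : ℝ) (hγ : 0 < γ) (c : ℝ) :
    ∫⁻ t, ENNReal.ofReal (Real.sqrt |(γ * t - c)⁻¹|) ∂g ≤ ENNReal.ofReal (Real.sqrt γ⁻¹) * kap C := by
  have h1 : ∀ t, ENNReal.ofReal (Real.sqrt |(γ * t - c)⁻¹|)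
      ≤ ENNReal.ofReal (Real.sqrt γ⁻¹) * (1 + (Set.Icc (c/γ - 1) (c/γ+1)).indicator
        (fun t => ENNReal.ofReal (Real.sqrt |t - c/γ|⁻¹)) t) := by
    intro t
    have e : |(γ * t - c)⁻¹| = γ⁻¹ * |t - c/γ|⁻¹ := by
      rw [show γ * t - c = γ * (t - c/γ) by field_simp, mul_inv, abs_mul, abs_of_pos (inv_pos.2 hγ),
        abs_inv]
    rw [e, Real.sqrt_mul (inv_pos.2 hγ).le, ENNReal.ofReal_mul (Real.sqrt_nonneg _)]
    refine mul_le_mul_right ?_ _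
    by_cases ht : t ∈ Set.Icc (c/γ - 1) (c/γ+1)
    · rw [Set.indicator_of_mem ht]; exact le_add_self
    · rw [Set.indicator_of_notMem ht, add_zero]
      rw [← ENNReal.ofReal_one]
      apply ENNReal.ofReal_le_ofReal
      rw [Real.sqrt_le_one]
      apply inv_le_one_of_one_le₀
      by_contra hlt
      push Not at hlt
      rw [abs_lt] at hlt
      exact ht ⟨by linarith, by linarith⟩
  have hle : g ≤ (C : ℝ≥0∞) • (volume : Measure ℝ) := Measure.le_iff.2 fun s hs => hC s
  refine (lintegral_mono h1).trans ?_
  have hm : Measurable ((Set.Icc (c/γ - 1) (c/γ+1)).indicator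
        (fun t => ENNReal.ofReal (Real.sqrt |t - c/γ|⁻¹))) :=
    Measurable.indicator (by fun_prop) measurableSet_Icc
  rw [lintegral_const_mul' _ _ ENNReal.ofReal_ne_top, lintegral_add_left measurable_const]
  refine mul_le_mul_right ?_ _
  unfold kap
  refine add_le_add (by simp) ?_
  refine (lintegral_mono' hle le_rfl).trans ?_
  rw [lintegral_smul_measure, smul_eq_mul]
  refine mul_le_mul_right ?_ _
  rw [← lintegral_add_right_eq_self _ (c/γ), ← lintegral_indicator measurableSet_Icc]
  refine lintegral_mono fun s => le_of_eq ?_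
  by_cases hs : s ∈ Set.Icc (-1:ℝ) 1
  · have hs2 : s + c/γ ∈ Set.Icc (c/γ - 1) (c/γ+1) := ⟨by linarith [hs.1], by linarith [hs.2]⟩
    rw [Set.indicator_of_mem hs, Set.indicator_of_mem hs2]
    simp
  · rw [Set.indicator_of_notMem hs, Set.indicator_of_notMem]
    intro h
    exact hs ⟨by linarith [h.1], by linarith [h.2]⟩

end

section

/-- `h - e` on the finite box `L`. -/
def Mst {d : ℕ} (γ : ℝ) (L : Finset (Site d)) (e : ℝ) (v : Site d → ℝ) : Matrix L L ℝ :=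
  fun p q => hst γ v p q - if p = q then e else 0

lemma Mst_meas {d : ℕ} (γ : ℝ) (L : Finset (Site d)) (e : ℝ) (p q : L) :
    Measurable fun v => Mst γ L e v p q := by
  unfold Mst hst
  refine Measurable.sub (Measurable.add measurable_const ?_) measurable_const
  split_ifs <;> fun_prop

lemma BM_meas {d : ℕ} (γ : ℝ) (L : Finset (Site d)) (e : ℝ) (S : Finset L) (p q : L) :
    Measurable fun v => BM (Mst γ L e v) S p q := by
  unfold BM
  split_ifs
  · exact Mst_meas γ L e p q
  all_goals exact measurable_const

lemma Mst_update {d : ℕ} (γ : ℝ) (L : Finset (Site d)) (e : ℝ) (v : Site d → ℝ) (x : L) (t : ℝ)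
    (p q : L) (h : p ≠ x ∨ q ≠ x) : Mst γ L e (Function.update v x t) p q = Mst γ L e v p q := by
  unfold Mst hst
  by_cases hpq : p = q
  · subst hpq
    have : (p : Site d) ≠ x := fun h' => by simp [Subtype.ext_iff, h'] at h
    simp [this]
  · have : (p : Site d) ≠ q := fun h => hpq (Subtype.ext h)
    simp [this]

lemma BM_update {d : ℕ} (γ : ℝ) (L : Finset (Site d)) (e : ℝ) (v : Site d → ℝ) (x : L) (t : ℝ)
    (S : Finset L) (hx : x ∉ S) : BM (Mst γ L e (Function.update v x t)) S = BM (Mst γ L e v) S := by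
  ext p q
  unfold BM
  split_ifs with h1 h2
  · exact Mst_update γ L e v x t p q (Or.inl fun h => hx (h ▸ h1))
  all_goals rfl

lemma Mst_diag {d : ℕ} (γ : ℝ) (L : Finset (Site d)) (e : ℝ) (v : Site d → ℝ) (x : L) (t : ℝ) :
    Mst γ L e (Function.update v x t) x x = γ * t - e := by
  simp [Mst, hst, hop_self]

lemma sqrt_sum_le {ι : Type*} (s : Finset ι) (f : ι → ℝ) :
    Real.sqrt |∑ i ∈ s, f i| ≤ ∑ i ∈ s, Real.sqrt |f i| := by
  classical
  induction s using Finset.induction with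
  | empty => simp
  | insert a s ha ih =>
    rw [Finset.sum_insert ha, Finset.sum_insert ha]
    refine (Real.sqrt_le_sqrt (abs_add_le _ _)).trans ?_
    have h1 := Real.sqrt_nonneg |f a|
    have h2 := Real.sqrt_nonneg |∑ x ∈ s, f x|
    have h3 : Real.sqrt (|f a| + |∑ x ∈ s, f x|) ≤ Real.sqrt |f a| + Real.sqrt |∑ x ∈ s, f x| := by
      apply Real.sqrt_le_iff.2
      refine ⟨by positivity, ?_⟩
      nlinarith [Real.sq_sqrt (abs_nonneg (f a)), Real.sq_sqrt (abs_nonneg (∑ x ∈ s, f x))]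
    linarith

/-- Fractional moment bound. -/
lemma fmm {d : ℕ} {g : Measure ℝ} (hgp : IsProbabilityMeasure g) (C : ℝ≥0)
    (hC : ∀ A : Set ℝ, g A ≤ (C : ℝ≥0∞) * volume A)
    {P : Measure (Site d → ℝ)} (hP : IsProductMeasure g P)
    (γ : ℝ) (hγ : 0 < γ) (KF : ℝ≥0) (hKF : ENNReal.ofReal (Real.sqrt γ⁻¹) * kap C ≤ KF)
    (hKd : 4 * d * (KF:ℝ) ≤ 1)
    (L : Finset (Site d)) (e : ℝ) (n : ℕ) :
    ∀ S : Finset L, S.card = n →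
      (∀ᵐ v ∂P, (BM (Mst γ L e v) S).det ≠ 0) ∧
      ∀ x : L, x ∈ S → ∀ y : L, y ∈ S → ∫⁻ v, ENNReal.ofReal (Real.sqrt |(BM (Mst γ L e v) S)⁻¹ x y|) ∂P
        ≤ ENNReal.ofReal (KF * (1/2) ^ (l1 ((x:Site d) - (y:Site d)))) := by
  have hp := hP.1
  induction n with
  | zero =>
    intro S hS
    rw [Finset.card_eq_zero] at hS
    subst hS
    refine ⟨Filter.Eventually.of_forall fun v => ?_, by simp⟩
    have : BM (Mst γ L e v) ∅ = 1 := by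
      ext p q
      simp [BM, Matrix.one_apply]
    rw [this]; simp
  | succ n ih =>
    intro S hS
    have hbase : ∀ x ∈ S, ∃ S' : Finset L, x ∉ S' ∧ insert x S' = S ∧ S'.card = n := by
      intro x hx
      refine ⟨S.erase x, Finset.notMem_erase _ _, Finset.insert_erase hx, ?_⟩
      rw [Finset.card_erase_of_mem hx, hS]; rfl
    -- for a.e. v, for a.e. t: nonresonance
    have hae : ∀ (x : L) (S' : Finset L), x ∉ S' → S'.card = n → ∀ᵐ v ∂P, (BM (Mst γ L e v) S').det ≠ 0 ∧
        ∀ᵐ t ∂g, (Mst γ L e (Function.update v x t)) x x - ∑ q ∈ S', ∑ p ∈ S',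
          (Mst γ L e (Function.update v x t)) x q * (BM (Mst γ L e (Function.update v x t)) S')⁻¹ q p
            * (Mst γ L e (Function.update v x t)) p x ≠ 0 := by
      intro x S' hx hc
      filter_upwards [(ih S' hc).1] with v hv
      refine ⟨hv, ?_⟩
      simp only [BM_update γ L e v x _ S' hx, Mst_diag]
      have e1 : ∀ t, ∑ q ∈ S', ∑ p ∈ S',
          (Mst γ L e (Function.update v x t)) x q * (BM (Mst γ L e v) S')⁻¹ q p
            * (Mst γ L e (Function.update v x t)) p x = ∑ q ∈ S', ∑ p ∈ S',
          (Mst γ L e v) x q * (BM (Mst γ L e v) S')⁻¹ q p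
            * (Mst γ L e v) p x := by
        intro t
        refine Finset.sum_congr rfl fun q hq => Finset.sum_congr rfl fun p hp => ?_
        rw [Mst_update γ L e v x t x q (Or.inr fun h => hx (h ▸ hq)),
          Mst_update γ L e v x t p x (Or.inl fun h => hx (h ▸ hp))]
      simp only [e1]
      set c := ∑ q ∈ S', ∑ p ∈ S', (Mst γ L e v) x q * (BM (Mst γ L e v) S')⁻¹ q p
            * (Mst γ L e v) p x
      have hsub : {t | ¬ (γ * t - e - c ≠ 0)} ⊆ {(e + c)/γ} := by
        intro t ht
        simp only [ne_eq, not_not, Set.mem_ofPred_eq] at ht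
        rw [Set.mem_singleton_iff]
        field_simp
        linarith
      rw [ae_iff]
      refine measure_mono_null hsub (le_antisymm ((hC _).trans ?_) zero_le)
      simp
    have hstep : ∀ (x : L) (S' : Finset L), x ∉ S' → S'.card = n → (∀ᵐ v ∂P, (BM (Mst γ L e v) (insert x S')).det ≠ 0) := by
      intro x S' hx hc
      have hms : MeasurableSet {v | ¬ (BM (Mst γ L e v) (insert x S')).det ≠ 0} := by
        have : Measurable fun v => (BM (Mst γ L e v) (insert x S')).det :=
          measurable_det' (BM_meas γ L e _)
        simp only [ne_eq, not_not]
        exact this (measurableSet_singleton 0)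
      rw [ae_iff, ← lintegral_indicator_one hms,
        resample hgp hP x _ (measurable_one.indicator hms)]
      rw [← lintegral_zero (μ := P)]
      refine lintegral_congr_ae ?_
      filter_upwards [hae x S' hx hc] with v hv
      rw [← lintegral_zero (μ := g)]
      refine lintegral_congr_ae ?_
      filter_upwards [hv.2] with t ht
      apply Set.indicator_of_notMem
      simp only [ne_eq, not_not, Set.mem_ofPred_eq]
      exact (BM_step _ S' x hx (by rw [BM_update γ L e v x _ S' hx]; exact hv.1) ht).1
    refine ⟨?_, ?_⟩
    · have hne : S.Nonempty := Finset.card_pos.1 (by omega)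
      obtain ⟨x, hx⟩ := hne
      obtain ⟨S', h1, h2, h3⟩ := hbase x hx
      rw [← h2]; exact hstep x S' h1 h3
    · intro x hxS y hyS
      obtain ⟨S', hx, h2, hc⟩ := hbase x hxS
      subst h2
      have hmeas : ∀ S'' : Finset L, ∀ q y : L, Measurable fun v =>
          ENNReal.ofReal (Real.sqrt |(BM (Mst γ L e v) S'')⁻¹ q y|) := by
        intro S'' q y
        have := measurable_inv_entry (𝕜 := ℝ) (BM_meas γ L e S'') q y
        exact ENNReal.measurable_ofReal.comp (Real.continuous_sqrt.measurable.comp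
          (continuous_abs.measurable.comp this))
      rw [resample hgp hP x _ (hmeas _ x y)]
      have e1 : ∀ v t, ∑ q ∈ S', ∑ p ∈ S',
          (Mst γ L e (Function.update v x t)) x q * (BM (Mst γ L e (Function.update v x t)) S')⁻¹ q p
            * (Mst γ L e (Function.update v x t)) p x = ∑ q ∈ S', ∑ p ∈ S',
          (Mst γ L e v) x q * (BM (Mst γ L e v) S')⁻¹ q p
            * (Mst γ L e v) p x := by
        intro v t
        refine Finset.sum_congr rfl fun q hq => Finset.sum_congr rfl fun p hp => ?_
        rw [Mst_update γ L e v x t x q (Or.inr fun h => hx (h ▸ hq)),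
          Mst_update γ L e v x t p x (Or.inl fun h => hx (h ▸ hp)), BM_update γ L e v x _ S' hx]
      by_cases hxy : x = y
      · subst hxy
        have hK : (ENNReal.ofReal (KF * (1/2) ^ (l1 ((x:Site d) - (x:Site d))))) = KF := by
          simp [l1]
        rw [hK]
        calc _ ≤ ∫⁻ v, (KF : ℝ≥0∞) ∂P := by
              refine lintegral_mono_ae ?_
              filter_upwards [hae x S' hx hc] with v hv
              refine le_trans ?_ ((one_site hgp C hC γ hγ (e + ∑ q ∈ S', ∑ p ∈ S',
                (Mst γ L e v) x q * (BM (Mst γ L e v) S')⁻¹ q p * (Mst γ L e v) p x)).trans hKF)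
              refine lintegral_mono_ae ?_
              filter_upwards [hv.2] with t ht
              have h4 := (BM_step _ S' x hx (by rw [BM_update γ L e v x _ S' hx]; exact hv.1) ht).2.1
              rw [h4, e1, Mst_diag, sub_sub]
          _ = KF := by simp
      · have hyS' : y ∈ S' := (Finset.mem_insert.1 hyS).resolve_left (Ne.symm hxy)
        calc _ ≤ ∫⁻ v, (KF : ℝ≥0∞) * ∑ q ∈ S', ENNReal.ofReal (hop (x:Site d) q) *
                  ENNReal.ofReal (Real.sqrt |(BM (Mst γ L e v) S')⁻¹ q y|) ∂P := by
              refine lintegral_mono_ae ?_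
              filter_upwards [hae x S' hx hc] with v hv
              set X := ∑ q ∈ S', ENNReal.ofReal (hop (x:Site d) q) *
                  ENNReal.ofReal (Real.sqrt |(BM (Mst γ L e v) S')⁻¹ q y|) with hX
              refine le_trans ?_ (mul_le_mul_left ((one_site hgp C hC γ hγ (e + ∑ q ∈ S', ∑ p ∈ S',
                (Mst γ L e v) x q * (BM (Mst γ L e v) S')⁻¹ q p * (Mst γ L e v) p x)).trans hKF) X)
              rw [← lintegral_mul_const' _ _ (by
                rw [hX]; exact (ENNReal.sum_lt_top.2 fun q _ => ENNReal.mul_lt_top ENNReal.ofReal_lt_top ENNReal.ofReal_lt_top).ne)]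
              refine lintegral_mono_ae ?_
              filter_upwards [hv.2] with t ht
              have h4 := (BM_step _ S' x hx (by rw [BM_update γ L e v x _ S' hx]; exact hv.1) ht).2.2 y hyS'
              rw [h4, e1, Mst_diag, sub_sub, abs_neg, abs_mul, Real.sqrt_mul (abs_nonneg _),
                ENNReal.ofReal_mul (Real.sqrt_nonneg _)]
              refine mul_le_mul_right ?_ _
              rw [hX]
              have h5 : ∀ q ∈ S', ENNReal.ofReal (hop (x:Site d) q) *
                  ENNReal.ofReal (Real.sqrt |(BM (Mst γ L e v) S')⁻¹ q y|)
                  = ENNReal.ofReal (hop (x:Site d) q * Real.sqrt |(BM (Mst γ L e v) S')⁻¹ q y|) :=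
                fun q _ => (ENNReal.ofReal_mul (hop_nonneg _ _)).symm
              rw [Finset.sum_congr rfl h5, ← ENNReal.ofReal_sum_of_nonneg]
              swap
              · intro q _; exact mul_nonneg (hop_nonneg _ _) (Real.sqrt_nonneg _)
              apply ENNReal.ofReal_le_ofReal
              refine (sqrt_sum_le _ _).trans (Finset.sum_le_sum fun q hq => ?_)
              rw [abs_mul, Real.sqrt_mul (abs_nonneg _), BM_update γ L e v x _ S' hx]
              refine mul_le_mul_of_nonneg_right ?_ (Real.sqrt_nonneg _)
              have hxq : x ≠ q := fun h => hx (h ▸ hq)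
              have hxq' : (x:Site d) ≠ q := fun h => hxq (Subtype.ext h)
              have : Mst γ L e (Function.update v x t) x q = hop (x:Site d) q := by
                simp [Mst, hst, hxq, hxq']
              rw [this, abs_of_nonneg (hop_nonneg _ _)]
              obtain ⟨m, hm⟩ := hop_nat (x:Site d) q
              rw [hm, Real.sqrt_le_left (by positivity)]
              have : m ≤ m ^ 2 := Nat.le_self_pow (by norm_num) m
              exact_mod_cast this
          _ = (KF : ℝ≥0∞) * ∑ q ∈ S', ENNReal.ofReal (hop (x:Site d) q) * ∫⁻ v,
                  ENNReal.ofReal (Real.sqrt |(BM (Mst γ L e v) S')⁻¹ q y|) ∂P := by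
              rw [lintegral_const_mul' _ _ ENNReal.coe_ne_top,
                lintegral_finsetSum _ (fun q _ => (hmeas S' q y).const_mul _)]
              congr 1
              refine Finset.sum_congr rfl fun q _ => ?_
              rw [lintegral_const_mul' _ _ ENNReal.ofReal_ne_top]
          _ ≤ (KF : ℝ≥0∞) * ∑ q ∈ S', ENNReal.ofReal (hop (x:Site d) q *
                  (2 * KF * (1/2) ^ (l1 ((x:Site d) - (y:Site d))))) := by
              refine mul_le_mul_right (Finset.sum_le_sum fun q hq => ?_) _
              rw [ENNReal.ofReal_mul (hop_nonneg _ _)]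
              by_cases h0 : hop (x:Site d) q = 0
              · simp [h0]
              refine mul_le_mul_right (((ih S' hc).2 q hq y hyS').trans ?_) _
              apply ENNReal.ofReal_le_ofReal
              have h1 := hop_ne h0
              have h2 : l1 ((x:Site d) - (y:Site d)) ≤ l1 ((q:Site d) - (y:Site d)) + 1 := by
                have := l1_add_le ((x:Site d) - (q:Site d)) ((q:Site d) - (y:Site d))
                rw [h1] at this
                simp only [sub_add_sub_cancel] at this
                omega
              have h3 : ((1:ℝ)/2) ^ (l1 ((q:Site d) - (y:Site d)) + 1) ≤ (1/2) ^ (l1 ((x:Site d) - (y:Site d))) :=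
                pow_le_pow_of_le_one (by norm_num) (by norm_num) h2
              rw [pow_succ] at h3
              have h4 : (0:ℝ) ≤ KF := KF.2
              nlinarith
          _ ≤ _ := by
              rw [← ENNReal.ofReal_sum_of_nonneg (fun q _ => mul_nonneg (hop_nonneg _ _) (by positivity)),
                ← Finset.sum_mul, ← ENNReal.ofReal_coe_nnreal, ← ENNReal.ofReal_mul (NNReal.coe_nonneg KF)]
              apply ENNReal.ofReal_le_ofReal
              have h1 : ∑ q ∈ S', hop (x:Site d) q ≤ 2 * d := by
                have := hop_sum_le (x:Site d) (S'.map (Function.Embedding.subtype _))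
                simpa using this
              have h4 : (0:ℝ) ≤ KF := KF.2
              have h5 : (0:ℝ) ≤ KF * (1/2) ^ (l1 ((x:Site d) - (y:Site d))) := by positivity
              calc (KF:ℝ) * ((∑ q ∈ S', hop (x:Site d) q) * (2 * KF * (1/2) ^ (l1 ((x:Site d) - (y:Site d)))))
                  ≤ (KF:ℝ) * ((2 * d) * (2 * KF * (1/2) ^ (l1 ((x:Site d) - (y:Site d))))) := by gcongr
                _ = (4 * d * KF) * (KF * (1/2) ^ (l1 ((x:Site d) - (y:Site d)))) := by ring
                _ ≤ _ := by nlinarith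

end

section

lemma schur {I : Type*} (S : Finset I) (B : I → I → ℝ) (c : ℝ)
    (h1 : ∀ p ∈ S, ∑ q ∈ S, |B p q| ≤ c) (h2 : ∀ q ∈ S, ∑ p ∈ S, |B p q| ≤ c) (u : I → ℝ) :
    ∑ p ∈ S, (∑ q ∈ S, B p q * u q) ^ 2 ≤ c ^ 2 * ∑ p ∈ S, u p ^ 2 := by
  have hb : ∀ p ∈ S, (∑ q ∈ S, B p q * u q) ^ 2 ≤ c * ∑ q ∈ S, |B p q| * u q ^ 2 := by
    intro p hp
    refine (Finset.sum_sq_le_sum_mul_sum_of_sq_eq_mul S (f := fun q => |B p q|)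
      (g := fun q => |B p q| * u q ^ 2) (fun q _ => abs_nonneg _) (fun q _ => by positivity)
      (fun q _ => by rw [mul_pow, ← mul_assoc, ← sq, sq_abs])).trans ?_
    exact mul_le_mul_of_nonneg_right (h1 p hp) (Finset.sum_nonneg fun q _ => by positivity)
  refine (Finset.sum_le_sum hb).trans ?_
  rw [← Finset.mul_sum, Finset.sum_comm]
  have hc : S.Nonempty → 0 ≤ c := fun ⟨p, hp⟩ => (Finset.sum_nonneg fun q _ => abs_nonneg _).trans (h1 p hp)
  rcases S.eq_empty_or_nonempty with rfl | hne
  · simp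
  rw [sq, mul_assoc]
  refine mul_le_mul_of_nonneg_left ?_ (hc hne)
  rw [Finset.mul_sum]
  refine Finset.sum_le_sum fun q hq => ?_
  rw [← Finset.sum_mul]
  exact mul_le_mul_of_nonneg_right (h2 q hq) (sq_nonneg _)

lemma summable_int_pow {σ : ℝ} (h0 : 0 ≤ σ) (h1 : σ < 1) : Summable fun n : ℤ => σ ^ n.natAbs := by
  refine Summable.of_nat_of_neg ?_ ?_
  · simpa using summable_geometric_of_lt_one h0 h1
  · simpa using summable_geometric_of_lt_one h0 h1

lemma summable_l1 {d : ℕ} {σ : ℝ} (h0 : 0 ≤ σ) (h1 : σ < 1) : Summable fun z : Site d => σ ^ l1 z := by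
  refine summable_of_sum_le (c := (∑' n : ℤ, σ ^ n.natAbs) ^ d) (fun z => by positivity) fun s => ?_
  obtain ⟨m, hm⟩ : ∃ m : ℕ, ∀ z ∈ s, ∀ k, z k ∈ Finset.Icc (-(m:ℤ)) m := by
    refine ⟨s.sup l1, fun z hz k => ?_⟩
    have h1 : l1 z ≤ s.sup l1 := Finset.le_sup hz
    have h2 : (z k).natAbs ≤ l1 z := Finset.single_le_sum (f := fun k => (z k).natAbs) (fun _ _ => Nat.zero_le _) (Finset.mem_univ k)
    rw [Finset.mem_Icc]
    omega
  calc ∑ z ∈ s, σ ^ l1 z ≤ ∑ z ∈ Fintype.piFinset (fun _ : Fin d => Finset.Icc (-(m:ℤ)) m), σ ^ l1 z := by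
        refine Finset.sum_le_sum_of_subset_of_nonneg (fun z hz => ?_) (fun z _ _ => by positivity)
        rw [Fintype.mem_piFinset]; exact hm z hz
    _ = ∏ _k : Fin d, ∑ n ∈ Finset.Icc (-(m:ℤ)) m, σ ^ n.natAbs := by
        rw [Finset.prod_univ_sum]
        refine Finset.sum_congr rfl fun z _ => ?_
        rw [l1, Finset.prod_pow_eq_pow_sum]
    _ ≤ ∏ _k : Fin d, ∑' n : ℤ, σ ^ n.natAbs := by
        refine Finset.prod_le_prod (fun _ _ => Finset.sum_nonneg fun _ _ => by positivity) fun _ _ => ?_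
        exact (summable_int_pow h0 h1).sum_le_tsum _ (fun _ _ => by positivity)
    _ = _ := by simp

lemma summable_conv_aux {G : Type*} [AddCommGroup G] (f g : G → ℝ) (hf : Summable f) (hg : Summable g)
    (hf0 : ∀ z, 0 ≤ f z) (hg0 : ∀ z, 0 ≤ g z) : Summable fun w : G × G => f (w.1 - w.2) * g w.2 := by
  have h2 : Summable fun w : G × G => f w.1 * g w.2 := Summable.mul_of_nonneg hf hg hf0 hg0
  let e : G × G ≃ G × G :=
      { toFun := fun w => (w.1 - w.2, w.2), invFun := fun w => (w.1 + w.2, w.2),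
        left_inv := fun w => by simp, right_inv := fun w => by simp }
  exact (e.summable_iff (f := fun w : G × G => f w.1 * g w.2)).2 h2

lemma far_sum {d : ℕ} {σ : ℝ} (h0 : 0 ≤ σ) (h1 : σ < 1) (R0 : ℕ) (δ : ℝ) (hδ : 0 < δ) :
    ∃ R ≥ R0, ∀ L : Finset (Site d),
      ∑ y ∈ L.filter (fun y => R < l1 y), ∑ y' ∈ L, ((1:ℝ)/2) ^ l1 (y - y') * σ ^ l1 y' ≤ δ := by
  have hs : Summable fun w : Site d × Site d => ((1:ℝ)/2) ^ l1 (w.1 - w.2) * σ ^ l1 w.2 := by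
    have hg : Summable fun z : Site d => σ ^ l1 z := summable_l1 h0 h1
    have hf0 : ∀ z : Site d, 0 ≤ ((1:ℝ)/2) ^ l1 z := fun z => pow_nonneg (by norm_num) _
    have hg0 : ∀ z : Site d, 0 ≤ σ ^ l1 z := fun z => pow_nonneg h0 _
    exact summable_conv_aux (fun z : Site d => ((1:ℝ)/2) ^ l1 z) (fun z : Site d => σ ^ l1 z) (summable_l1 (by norm_num) (by norm_num)) hg hf0 hg0
  obtain ⟨T, hT⟩ := summable_iff_vanishing_norm.1 hs δ hδ
  refine ⟨max R0 (T.sup fun w => l1 w.1), le_max_left _ _, fun L => ?_⟩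
  rw [← Finset.sum_product']
  refine (le_abs_self _).trans (hT _ ?_).le
  rw [Finset.disjoint_left]
  intro w hw hw2
  rw [Finset.mem_product, Finset.mem_filter] at hw
  have : l1 w.1 ≤ T.sup fun w => l1 w.1 := Finset.le_sup (f := fun w : Site d × Site d => l1 w.1) hw2
  have h3 := hw.1.2
  have h4 := lt_of_le_of_lt (le_max_right R0 (T.sup fun w => l1 w.1)) h3
  omega

/-- Energies at which the static resolvent away from `x` is good. -/
def GoodE {d : ℕ} (γ : ℝ) (L : Finset (Site d)) (x : L) (σ : ℝ) (R : ℕ) (ε : ℝ)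
    (v : Site d → ℝ) (e : ℝ) : Prop :=
  ∀ u : L → ℝ, ∑ y ∈ univ.filter (fun y : L => R < l1 (y : Site d)), u y ^ 2
    ≤ ε ^ 4 * ∑ y ∈ univ.erase x, ((σ ^ l1 (y : Site d)) ^ 4)⁻¹ *
        (∑ y' ∈ univ.erase x, Mst γ L e v y y' * u y') ^ 2

lemma bad_open {d : ℕ} (γ : ℝ) (L : Finset (Site d)) (x : L) (σ : ℝ) (R : ℕ) (ε : ℝ) :
    IsOpen {w : (Site d → ℝ) × ℝ | ¬ GoodE γ L x σ R ε w.1 w.2} := by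
  have : {w : (Site d → ℝ) × ℝ | ¬ GoodE γ L x σ R ε w.1 w.2}
      = ⋃ u : L → ℝ, {w | ε ^ 4 * ∑ y ∈ univ.erase x, ((σ ^ l1 (y : Site d)) ^ 4)⁻¹ *
        (∑ y' ∈ univ.erase x, Mst γ L w.2 w.1 y y' * u y') ^ 2
        < ∑ y ∈ univ.filter (fun y : L => R < l1 (y : Site d)), u y ^ 2} := by
    ext w
    simp only [GoodE, not_forall, not_le, Set.mem_ofPred_eq, Set.mem_iUnion]
  rw [this]
  refine isOpen_iUnion fun u => isOpen_lt ?_ continuous_const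
  have hM : ∀ y y' : L, Continuous fun w : (Site d → ℝ) × ℝ => Mst γ L w.2 w.1 y y' := by
    intro y y'
    unfold Mst hst
    refine Continuous.sub (continuous_const.add ?_) ?_
    · split_ifs
      · fun_prop
      · fun_prop
    · split_ifs <;> fun_prop
  fun_prop

lemma good_update {d : ℕ} (γ : ℝ) (L : Finset (Site d)) (x : L) (σ : ℝ) (R : ℕ) (ε : ℝ)
    (v : Site d → ℝ) (t e : ℝ) :
    GoodE γ L x σ R ε (Function.update v x t) e ↔ GoodE γ L x σ R ε v e := by
  unfold GoodE
  refine forall_congr' fun u => ?_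
  have : ∀ y ∈ univ.erase x, ∀ y' : L, Mst γ L e (Function.update v x t) y y' = Mst γ L e v y y' :=
    fun y hy y' => Mst_update γ L e v x t y y' (Or.inl (Finset.ne_of_mem_erase hy))
  have hsum : ∑ y ∈ univ.erase x, ((σ ^ l1 (y : Site d)) ^ 4)⁻¹ *
        (∑ y' ∈ univ.erase x, Mst γ L e (Function.update v x t) y y' * u y') ^ 2
      = ∑ y ∈ univ.erase x, ((σ ^ l1 (y : Site d)) ^ 4)⁻¹ *
        (∑ y' ∈ univ.erase x, Mst γ L e v y y' * u y') ^ 2 := by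
    refine Finset.sum_congr rfl fun y hy => ?_
    congr 2
    exact Finset.sum_congr rfl fun y' _ => by rw [this y hy y']
  rw [hsum]

lemma hst_row {d : ℕ} (γ : ℝ) (hγ : 0 ≤ γ) (L : Finset (Site d)) (v : Site d → ℝ)
    (hv : ∀ j, |v j| ≤ 1) (p : L) : ∑ q : L, |hst γ v p q| ≤ 2 * d + γ := by
  have h1 : ∀ q : L, |hst γ v p q| ≤ hop (p:Site d) q + if p = q then γ else 0 := by
    intro q
    unfold hst
    refine (abs_add_le _ _).trans ?_
    rw [abs_of_nonneg (hop_nonneg _ _)]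
    by_cases h : p = q
    · subst h
      simp only [if_true, abs_mul, abs_of_nonneg hγ]
      nlinarith [hv p]
    · have : (p:Site d) ≠ q := fun h' => h (Subtype.ext h')
      simp [h, this]
  refine (Finset.sum_le_sum fun q _ => h1 q).trans ?_
  rw [Finset.sum_add_distrib]
  have h2 : ∑ q : L, hop (p:Site d) q ≤ 2 * d := by
    rw [Finset.sum_coe_sort L (fun q => hop (p:Site d) q)]
    exact hop_sum_le _ _
  have h3 : ∑ q : L, (if p = q then γ else 0) = γ := by simp
  rw [h3]
  linarith

/-- Large energies are automatically good. -/
lemma good_large {d : ℕ} (γ : ℝ) (hγ : 0 ≤ γ) (L : Finset (Site d)) (x : L) (σ : ℝ)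
    (hσ : 0 < σ) (hσ1 : σ < 1) (R : ℕ)
    (hR : l1 (x:Site d) ≤ R) (ε : ℝ) (hε : 0 < ε)
    (v : Site d → ℝ) (hv : ∀ j, |v j| ≤ 1) (e : ℝ) (he : 2 * (2 * d + γ) + 2 * (ε ^ 2)⁻¹ ≤ |e|) :
    GoodE γ L x σ R ε v e := by
  intro u
  set S : Finset L := univ.erase x
  set c0 : ℝ := 2 * d + γ
  have hc0 : 0 ≤ c0 := by positivity
  have hsub : univ.filter (fun y : L => R < l1 (y : Site d)) ⊆ S := by
    intro y hy
    rw [Finset.mem_filter] at hy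
    refine Finset.mem_erase.2 ⟨fun h => ?_, Finset.mem_univ _⟩
    rw [h] at hy; omega
  refine (Finset.sum_le_sum_of_subset_of_nonneg hsub fun y _ _ => sq_nonneg (u y)).trans ?_
  have hsch := schur S (fun p q : L => hst γ v p q) c0
    (fun p _ => (Finset.sum_le_sum_of_subset_of_nonneg (Finset.subset_univ _)
      fun _ _ _ => abs_nonneg _).trans (hst_row γ hγ L v hv p))
    (fun q _ => by
      simp only [hst_symm γ v _ (q:Site d)]
      exact (Finset.sum_le_sum_of_subset_of_nonneg (Finset.subset_univ _)
      fun _ _ _ => abs_nonneg _).trans (hst_row γ hγ L v hv q)) u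
  set f : L → ℝ := fun y => ∑ y' ∈ S, Mst γ L e v y y' * u y'
  have hf : ∀ y ∈ S, f y = ∑ q ∈ S, hst γ v y q * u q - e * u y := by
    intro y hy
    simp only [f, Mst, sub_mul, Finset.sum_sub_distrib, ite_mul, zero_mul, Finset.sum_ite_eq, hy, if_true]
  have h1 : e ^ 2 * ∑ y ∈ S, u y ^ 2 ≤ 2 * ∑ y ∈ S, f y ^ 2 + 2 * (c0 ^ 2 * ∑ y ∈ S, u y ^ 2) := by
    refine le_trans ?_ (add_le_add le_rfl (mul_le_mul_of_nonneg_left hsch (by norm_num : (0:ℝ) ≤ 2)))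
    rw [Finset.mul_sum, Finset.mul_sum, Finset.mul_sum, ← Finset.sum_add_distrib]
    refine Finset.sum_le_sum fun y hy => ?_
    rw [hf y hy]
    nlinarith [sq_nonneg (∑ q ∈ S, hst γ v y q * u q - e * u y + ∑ q ∈ S, hst γ v y q * u q)]
  have h2 : ∑ y ∈ S, f y ^ 2 ≤ ∑ y ∈ S, ((σ ^ l1 (y : Site d)) ^ 4)⁻¹ * f y ^ 2 := by
    refine Finset.sum_le_sum fun y _ => le_mul_of_one_le_left (sq_nonneg _) ?_
    have : σ ^ l1 (y : Site d) ≤ 1 := pow_le_one₀ hσ.le hσ1.le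
    exact (one_le_inv₀ (by positivity)).2 (pow_le_one₀ (by positivity) this)
  have hU : 0 ≤ ∑ y ∈ S, u y ^ 2 := Finset.sum_nonneg fun _ _ => sq_nonneg _
  refine le_trans ?_ (mul_le_mul_of_nonneg_left h2 (by positivity))
  have he2 : 4 * c0 ^ 2 + 4 * ((ε ^ 2)⁻¹) ^ 2 ≤ e ^ 2 := by
    rw [← sq_abs e]
    have : 0 < (ε ^ 2)⁻¹ := by positivity
    nlinarith [mul_nonneg hc0 this.le]
  have h3 : 2 * ((ε ^ 2)⁻¹) ^ 2 * ∑ y ∈ S, u y ^ 2 ≤ 2 * ∑ y ∈ S, f y ^ 2 := by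
    nlinarith [mul_le_mul_of_nonneg_right he2 hU, mul_nonneg (sq_nonneg ((ε ^ 2)⁻¹)) hU, mul_nonneg (sq_nonneg c0) hU]
  have h4 : ∑ y ∈ S, u y ^ 2 = ε ^ 4 * (((ε ^ 2)⁻¹) ^ 2 * ∑ y ∈ S, u y ^ 2) := by
    field_simp
  rw [h4]
  exact mul_le_mul_of_nonneg_left (by linarith) (by positivity)

lemma sum_pow4_le {ι : Type*} (s : Finset ι) (a : ι → ℝ) (ha : ∀ i ∈ s, 0 ≤ a i) :
    ∑ i ∈ s, a i ^ 4 ≤ (∑ i ∈ s, a i) ^ 4 := by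
  rw [pow_succ (∑ i ∈ s, a i) 3, Finset.mul_sum]
  refine Finset.sum_le_sum fun i hi => ?_
  rw [pow_succ (a i) 3]
  have : a i ≤ ∑ i ∈ s, a i := Finset.single_le_sum ha hi
  exact mul_le_mul_of_nonneg_right (pow_le_pow_left₀ (ha i hi) this 3) (ha i hi)

/-- At fixed energy, bad configurations are unlikely. -/
lemma bad_prob {d : ℕ} {g : Measure ℝ} (hgp : IsProbabilityMeasure g) (C : ℝ≥0)
    (hC : ∀ A : Set ℝ, g A ≤ (C : ℝ≥0∞) * volume A)
    {P : Measure (Site d → ℝ)} (hP : IsProductMeasure g P)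
    (γ : ℝ) (hγ : 0 < γ) (KF : ℝ≥0) (hKF : ENNReal.ofReal (Real.sqrt γ⁻¹) * kap C ≤ KF)
    (hKd : 4 * d * (KF:ℝ) ≤ 1) (L : Finset (Site d)) (x : L) (σ : ℝ)
    (hσ : 0 < σ) (R : ℕ) (hR : l1 (x:Site d) ≤ R) (ε : ℝ) (hε : 0 < ε) (β : ℝ)
    (hβ : ∑ y ∈ L.filter (fun y => R < l1 y), ∑ y' ∈ L, ((1:ℝ)/2) ^ l1 (y - y') * σ ^ l1 y' ≤ β)
    (e : ℝ) : P {v | ¬ GoodE γ L x σ R ε v e} ≤ ENNReal.ofReal (KF * β / ε) := by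
  have hp := hP.1
  set S : Finset L := univ.erase x with hS
  obtain ⟨hdet, hG⟩ := fmm hgp C hC hP γ hγ KF hKF hKd L e _ S rfl
  set F : Finset L := univ.filter (fun y : L => R < l1 (y : Site d)) with hF
  have hsub : F ⊆ S := by
    intro y hy
    rw [Finset.mem_filter] at hy
    refine Finset.mem_erase.2 ⟨fun h => ?_, Finset.mem_univ _⟩
    rw [h] at hy; omega
  set T : (Site d → ℝ) → ℝ := fun v => ∑ y ∈ F, ∑ y' ∈ S,
    Real.sqrt |(BM (Mst γ L e v) S)⁻¹ y y'| * σ ^ l1 (y' : Site d) with hT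
  have himp : ∀ᵐ v ∂P, v ∈ {v | ¬ GoodE γ L x σ R ε v e} → ENNReal.ofReal ε ≤ ENNReal.ofReal (T v) := by
    filter_upwards [hdet] with v hv hbad
    apply ENNReal.ofReal_le_ofReal
    by_contra hlt
    push Not at hlt
    apply hbad
    intro u
    set f : L → ℝ := fun y => ∑ y' ∈ S, Mst γ L e v y y' * u y' with hf
    set Q := ∑ y ∈ S, ((σ ^ l1 (y : Site d)) ^ 4)⁻¹ * f y ^ 2 with hQ
    have hQ0 : 0 ≤ Q := Finset.sum_nonneg fun y _ => by positivity
    have h1 : ∀ y ∈ F, u y ^ 2 ≤ (∑ y' ∈ S, (Real.sqrt |(BM (Mst γ L e v) S)⁻¹ y y'| * σ ^ l1 (y' : Site d)) ^ 4) * Q := by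
      intro y hy
      rw [BM_solve (Mst γ L e v) S hv u f (fun p _ => rfl) y (hsub hy)]
      refine Finset.sum_sq_le_sum_mul_sum_of_sq_eq_mul S (fun _ _ => by positivity)
        (fun _ _ => by positivity) fun y' _ => ?_
      have h2 : Real.sqrt |(BM (Mst γ L e v) S)⁻¹ y y'| ^ 4 = (BM (Mst γ L e v) S)⁻¹ y y' ^ 2 := by
        rw [show 4 = 2 * 2 by norm_num, pow_mul, Real.sq_sqrt (abs_nonneg _), sq_abs]
      rw [mul_pow, mul_pow, h2]
      field_simp
    have h3 : ∑ y ∈ F, ∑ y' ∈ S, (Real.sqrt |(BM (Mst γ L e v) S)⁻¹ y y'| * σ ^ l1 (y' : Site d)) ^ 4 ≤ T v ^ 4 := by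
      rw [hT]
      simp only [← Finset.sum_product']
      exact sum_pow4_le _ _ fun _ _ => by positivity
    have hT0 : 0 ≤ T v := Finset.sum_nonneg fun _ _ => Finset.sum_nonneg fun _ _ => by positivity
    calc ∑ y ∈ F, u y ^ 2 ≤ ∑ y ∈ F, (∑ y' ∈ S, (Real.sqrt |(BM (Mst γ L e v) S)⁻¹ y y'| * σ ^ l1 (y' : Site d)) ^ 4) * Q :=
          Finset.sum_le_sum h1
      _ ≤ T v ^ 4 * Q := by rw [← Finset.sum_mul]; exact mul_le_mul_of_nonneg_right h3 hQ0
      _ ≤ ε ^ 4 * Q := mul_le_mul_of_nonneg_right (pow_le_pow_left₀ hT0 hlt.le 4) hQ0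
  have hent : ∀ y y' : L, Measurable fun v => Real.sqrt |(BM (Mst γ L e v) S)⁻¹ y y'| := fun y y' =>
    Real.continuous_sqrt.measurable.comp (continuous_abs.measurable.comp
      (measurable_inv_entry (𝕜 := ℝ) (BM_meas γ L e S) y y'))
  have hTm : Measurable T := by
    rw [hT]
    exact Finset.measurable_sum _ fun y _ => Finset.measurable_sum _ fun y' _ => (hent y y').mul_const _
  have hint : ∫⁻ v, ENNReal.ofReal (T v) ∂P ≤ ENNReal.ofReal (KF * β) := by
    calc ∫⁻ v, ENNReal.ofReal (T v) ∂P = ∫⁻ v, ∑ y ∈ F, ∑ y' ∈ S,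
          ENNReal.ofReal (Real.sqrt |(BM (Mst γ L e v) S)⁻¹ y y'|) * ENNReal.ofReal (σ ^ l1 (y' : Site d)) ∂P := by
          refine lintegral_congr fun v => ?_
          rw [hT]
          simp only
          rw [ENNReal.ofReal_sum_of_nonneg (fun _ _ => Finset.sum_nonneg fun _ _ => by positivity)]
          refine Finset.sum_congr rfl fun y _ => ?_
          rw [ENNReal.ofReal_sum_of_nonneg (fun _ _ => by positivity)]
          exact Finset.sum_congr rfl fun y' _ => ENNReal.ofReal_mul (Real.sqrt_nonneg _)
      _ = ∑ y ∈ F, ∑ y' ∈ S, (∫⁻ v, 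
          ENNReal.ofReal (Real.sqrt |(BM (Mst γ L e v) S)⁻¹ y y'|) ∂P) * ENNReal.ofReal (σ ^ l1 (y' : Site d)) := by
          have hm : ∀ y y' : L, Measurable fun v => ENNReal.ofReal (Real.sqrt |(BM (Mst γ L e v) S)⁻¹ y y'|) * ENNReal.ofReal (σ ^ l1 (y' : Site d)) :=
            fun y y' => (ENNReal.measurable_ofReal.comp (hent y y')).mul_const _
          rw [lintegral_finsetSum _ (fun y _ => Finset.measurable_sum _ fun y' _ => hm y y')]
          refine Finset.sum_congr rfl fun y _ => ?_
          rw [lintegral_finsetSum _ (fun y' _ => hm y y')]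
          refine Finset.sum_congr rfl fun y' _ => ?_
          rw [lintegral_mul_const' _ _ ENNReal.ofReal_ne_top]
      _ ≤ ∑ y ∈ F, ∑ y' ∈ S, ENNReal.ofReal (KF * (((1:ℝ)/2) ^ l1 ((y:Site d) - (y':Site d)) * σ ^ l1 (y' : Site d))) := by
          refine Finset.sum_le_sum fun y hy => Finset.sum_le_sum fun y' hy' => ?_
          rw [← mul_assoc, ENNReal.ofReal_mul (by positivity)]
          exact mul_le_mul_left (hG y (hsub hy) y' hy') _
      _ = ENNReal.ofReal (∑ y ∈ F, ∑ y' ∈ S, KF * (((1:ℝ)/2) ^ l1 ((y:Site d) - (y':Site d)) * σ ^ l1 (y' : Site d))) := by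
          rw [ENNReal.ofReal_sum_of_nonneg (fun _ _ => Finset.sum_nonneg fun _ _ => by positivity)]
          refine Finset.sum_congr rfl fun y _ => ?_
          rw [ENNReal.ofReal_sum_of_nonneg (fun _ _ => by positivity)]
      _ ≤ _ := by
          apply ENNReal.ofReal_le_ofReal
          simp only [← Finset.mul_sum]
          refine mul_le_mul_of_nonneg_left (le_trans ?_ hβ) (NNReal.coe_nonneg KF)
          have e2 : ∀ G : Site d → ℝ, ∑ y ∈ L.filter (fun y => R < l1 y), G y
              = ∑ y : L, if R < l1 (y:Site d) then G y else 0 := fun G => by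
            rw [Finset.sum_filter, ← Finset.sum_coe_sort L]
          rw [e2, hF, Finset.sum_filter]
          refine Finset.sum_le_sum fun y _ => ?_
          split_ifs
          · rw [← Finset.sum_coe_sort L (fun y' => ((1:ℝ)/2) ^ l1 ((y:Site d) - y') * σ ^ l1 y')]
            exact Finset.sum_le_sum_of_subset_of_nonneg (Finset.subset_univ _) fun _ _ _ => by positivity
          · exact le_rfl
  calc P {v | ¬ GoodE γ L x σ R ε v e} ≤ P {v | ENNReal.ofReal ε ≤ ENNReal.ofReal (T v)} :=
        measure_mono_ae himp
    _ ≤ (∫⁻ v, ENNReal.ofReal (T v) ∂P) / ENNReal.ofReal ε :=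
        meas_ge_le_lintegral_div (ENNReal.measurable_ofReal.comp hTm).aemeasurable
          (by simpa using hε) ENNReal.ofReal_ne_top
    _ ≤ _ := by
        rw [ENNReal.ofReal_div_of_pos hε]
        exact ENNReal.div_le_div_right hint _

end

section

section Det
variable {I : Type*} [Fintype I] [DecidableEq I]

lemma parseval_comp {K : Matrix I I ℝ} {E : I → ℝ} {Ψ : I → I → ℝ} (h : IsEig K E Ψ) (B : I → ℝ) :
    ∑ k, (∑ q, B q * Ψ k q) ^ 2 = ∑ q, B q ^ 2 := by
  have h1 : ∀ k, (∑ q, B q * Ψ k q) ^ 2 = ∑ q, ∑ q', B q * B q' * (Ψ k q * Ψ k q') := by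
    intro k
    rw [sq, Finset.sum_mul_sum]
    refine Finset.sum_congr rfl fun q _ => Finset.sum_congr rfl fun q' _ => by ring
  simp only [h1]
  rw [Finset.sum_comm]
  refine Finset.sum_congr rfl fun q _ => ?_
  rw [Finset.sum_comm]
  simp only [← Finset.mul_sum, h.comp, mul_ite, mul_one, mul_zero, Finset.sum_ite_eq, Finset.mem_univ, if_true, sq]

/-- complex Parseval with real orthonormal vectors -/
lemma parseval_orth {K : Matrix I I ℝ} {E : I → ℝ} {Ψ : I → I → ℝ} (h : IsEig K E Ψ) (c : I → ℂ) :
    ∑ p, ‖∑ k, c k * (Ψ k p : ℂ)‖ ^ 2 = ∑ k, ‖c k‖ ^ 2 := by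
  have hre : ∀ c : I → ℝ, ∑ p, (∑ k, c k * Ψ k p) ^ 2 = ∑ k, c k ^ 2 := by
    intro c
    have h1 : ∀ p, (∑ k, c k * Ψ k p) ^ 2 = ∑ q, ∑ q', c q * c q' * (Ψ q p * Ψ q' p) := by
      intro k
      rw [sq, Finset.sum_mul_sum]
      refine Finset.sum_congr rfl fun q _ => Finset.sum_congr rfl fun q' _ => by ring
    simp only [h1]
    rw [Finset.sum_comm]
    refine Finset.sum_congr rfl fun q _ => ?_
    rw [Finset.sum_comm]
    simp only [← Finset.mul_sum, h.orth, mul_ite, mul_one, mul_zero, Finset.sum_ite_eq, Finset.mem_univ, if_true, sq]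
  have h2 : ∀ p, ‖∑ k, c k * (Ψ k p : ℂ)‖ ^ 2
      = (∑ k, (c k).re * Ψ k p) ^ 2 + (∑ k, (c k).im * Ψ k p) ^ 2 := by
    intro p
    rw [Complex.sq_norm, Complex.normSq_apply, Complex.re_sum, Complex.im_sum]
    simp only [Complex.re_mul_ofReal, Complex.im_mul_ofReal]
    ring
  simp only [h2, Finset.sum_add_distrib, hre]
  rw [← Finset.sum_add_distrib]
  refine Finset.sum_congr rfl fun k _ => ?_
  rw [Complex.sq_norm, Complex.normSq_apply]; ring

lemma eig_shift {K : Matrix I I ℝ} {E : I → ℝ} {Ψ : I → I → ℝ} (h : IsEig K E Ψ) (p : I) (α : ℝ) :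
    ∑ k, Ψ k p ^ 2 * (E k - α) ^ 2 = ∑ q, (K p q - if p = q then α else 0) ^ 2 := by
  rw [← parseval_comp h]
  refine Finset.sum_congr rfl fun k _ => ?_
  have : ∑ q, (K p q - if p = q then α else 0) * Ψ k q = (E k - α) * Ψ k p := by
    simp only [sub_mul, Finset.sum_sub_distrib, h.eig, ite_mul, zero_mul, Finset.sum_ite_eq, Finset.mem_univ, if_true]
  rw [this]; ring

lemma comp_one {K : Matrix I I ℝ} {E : I → ℝ} {Ψ : I → I → ℝ} (h : IsEig K E Ψ) (p : I) :
    ∑ k, Ψ k p ^ 2 = 1 := by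
  have := h.comp p p
  simpa [sq] using this

lemma sum_sq_le_abs (s : Finset I) (f : I → ℝ) (c : ℝ) (hc : ∑ q ∈ s, |f q| ≤ c) :
    ∑ q ∈ s, f q ^ 2 ≤ c ^ 2 := by
  have h0 : 0 ≤ ∑ q ∈ s, |f q| := Finset.sum_nonneg fun _ _ => abs_nonneg _
  calc ∑ q ∈ s, f q ^ 2 = ∑ q ∈ s, |f q| ^ 2 := by simp [sq_abs]
    _ ≤ (∑ q ∈ s, |f q|) ^ 2 := Finset.sum_sq_le_sq_sum_of_nonneg fun _ _ => abs_nonneg _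
    _ ≤ c ^ 2 := pow_le_pow_left₀ h0 hc 2

lemma eig_shift_le {K : Matrix I I ℝ} {E : I → ℝ} {Ψ : I → I → ℝ} (h : IsEig K E Ψ) (p : I) (α c : ℝ)
    (hc : ∑ q, |K p q - if p = q then α else 0| ≤ c) :
    ∑ k, Ψ k p ^ 2 * (E k - α) ^ 2 ≤ c ^ 2 := by
  rw [eig_shift h]
  exact sum_sq_le_abs _ _ _ hc

lemma Q_le {K : Matrix I I ℝ} {E : I → ℝ} {Ψ : I → I → ℝ} (h : IsEig K E Ψ) (p : I) (α c : ℝ)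
    (hc : ∑ q, |K p q - if p = q then α else 0| ≤ c) :
    ∑ k, Ψ k p ^ 2 * (1 + E k ^ 2)⁻¹ ≤ 2 * (1 + c ^ 2) * (1 + α ^ 2)⁻¹ := by
  have h1 := eig_shift_le h p α c hc
  have h2 := comp_one h p
  calc ∑ k, Ψ k p ^ 2 * (1 + E k ^ 2)⁻¹
      ≤ ∑ k, (2 * (1 + α ^ 2)⁻¹) * (Ψ k p ^ 2 + Ψ k p ^ 2 * (E k - α) ^ 2) := by
        refine Finset.sum_le_sum fun k _ => ?_
        have : (1 + E k ^ 2)⁻¹ ≤ (2 * (1 + α ^ 2)⁻¹) * (1 + (E k - α) ^ 2) := by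
          rw [mul_comm 2, mul_assoc, inv_mul_eq_div, le_div_iff₀ (by positivity), inv_mul_eq_div,
            div_le_iff₀ (by positivity)]
          nlinarith [sq_nonneg (E k * (E k - α)), sq_nonneg (E k + (E k - α)), sq_nonneg (E k - (E k - α)), sq_nonneg (E k), sq_nonneg (α - 2 * E k)]
        calc _ ≤ Ψ k p ^ 2 * ((2 * (1 + α ^ 2)⁻¹) * (1 + (E k - α) ^ 2)) :=
              mul_le_mul_of_nonneg_left this (sq_nonneg _)
          _ = _ := by ring
    _ = (2 * (1 + α ^ 2)⁻¹) * (1 + ∑ k, Ψ k p ^ 2 * (E k - α) ^ 2) := by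
        rw [← Finset.mul_sum, Finset.sum_add_distrib, h2]
    _ ≤ (2 * (1 + α ^ 2)⁻¹) * (1 + c ^ 2) := by gcongr
    _ = _ := by ring

lemma norm_sq_add_le (z w : ℂ) : ‖z + w‖ ^ 2 ≤ 2 * ‖z‖ ^ 2 + 2 * ‖w‖ ^ 2 := by
  have := norm_add_le z w
  nlinarith [norm_nonneg (z + w), norm_nonneg z, norm_nonneg w, sq_nonneg (‖z‖ - ‖w‖)]

/-- splitting the evolved delta function into good and bad spectral parts -/
lemma evo_split {K : Matrix I I ℝ} {E : I → ℝ} {Ψ : I → I → ℝ} (h : IsEig K E Ψ) (p0 : I)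
    (z : I → ℂ) (hz : ∀ k, ‖z k‖ = 1) (G : Finset I) (F : Finset I) (C1 T : ℝ)
    (hC1 : ∑ k, Ψ k p0 ^ 2 * (1 + E k ^ 2) ≤ C1)
    (hT : ∑ p ∈ F, ∑ k ∈ G, Ψ k p ^ 2 * (1 + E k ^ 2)⁻¹ ≤ T) :
    ∑ p ∈ F, ‖∑ k, z k * Ψ k p0 * (Ψ k p : ℂ)‖ ^ 2 ≤ 2 * ∑ k ∈ Gᶜ, Ψ k p0 ^ 2 + 2 * (C1 * T) := by
  have hC10 : 0 ≤ C1 := (Finset.sum_nonneg fun k _ => by positivity).trans hC1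
  have h1 : ∑ p ∈ F, ‖∑ k ∈ Gᶜ, z k * Ψ k p0 * (Ψ k p : ℂ)‖ ^ 2 ≤ ∑ k ∈ Gᶜ, Ψ k p0 ^ 2 := by
    have := parseval_orth h (fun k => if k ∈ Gᶜ then z k * Ψ k p0 else 0)
    simp only [ite_mul, zero_mul, Finset.sum_ite_mem, Finset.univ_inter] at this
    have h3 : ∑ k, ‖if k ∈ Gᶜ then z k * (Ψ k p0 : ℂ) else 0‖ ^ 2 = ∑ k ∈ Gᶜ, Ψ k p0 ^ 2 := by
      rw [← Finset.sum_filter_add_sum_filter_not univ (fun k => k ∈ Gᶜ)]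
      rw [Finset.sum_eq_zero (s := univ.filter fun k => ¬ k ∈ Gᶜ)
        (fun k hk => by rw [if_neg (Finset.mem_filter.1 hk).2]; simp)]
      rw [add_zero, Finset.filter_mem_eq_inter, Finset.univ_inter]
      refine Finset.sum_congr rfl fun k hk => ?_
      rw [if_pos hk, norm_mul, hz, one_mul, Complex.norm_real, Real.norm_eq_abs, sq_abs]
    rw [h3] at this
    rw [← this]
    exact Finset.sum_le_sum_of_subset_of_nonneg (Finset.subset_univ _) fun _ _ _ => by positivity
  have h2 : ∀ p, ‖∑ k ∈ G, z k * Ψ k p0 * (Ψ k p : ℂ)‖ ^ 2 ≤ C1 * ∑ k ∈ G, Ψ k p ^ 2 * (1 + E k ^ 2)⁻¹ := by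
    intro p
    have h3 : ‖∑ k ∈ G, z k * Ψ k p0 * (Ψ k p : ℂ)‖ ≤ ∑ k ∈ G, |Ψ k p0| * |Ψ k p| := by
      refine (norm_sum_le _ _).trans (le_of_eq (Finset.sum_congr rfl fun k _ => ?_))
      rw [norm_mul, norm_mul, hz, one_mul, Complex.norm_real, Complex.norm_real, Real.norm_eq_abs, Real.norm_eq_abs]
    refine (pow_le_pow_left₀ (norm_nonneg _) h3 2).trans ?_
    refine (Finset.sum_sq_le_sum_mul_sum_of_sq_le_mul G (f := fun k => Ψ k p0 ^ 2 * (1 + E k ^ 2))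
      (g := fun k => Ψ k p ^ 2 * (1 + E k ^ 2)⁻¹) (fun _ _ => by positivity) (fun _ _ => by positivity)
      (fun k _ => ?_)).trans ?_
    · rw [mul_pow, sq_abs, sq_abs]
      have : (1 + E k ^ 2) ≠ 0 := by positivity
      apply le_of_eq; field_simp
    · refine mul_le_mul_of_nonneg_right (le_trans ?_ hC1) (Finset.sum_nonneg fun _ _ => by positivity)
      exact Finset.sum_le_sum_of_subset_of_nonneg (Finset.subset_univ _) fun _ _ _ => by positivity
  calc ∑ p ∈ F, ‖∑ k, z k * Ψ k p0 * (Ψ k p : ℂ)‖ ^ 2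
      ≤ ∑ p ∈ F, (2 * ‖∑ k ∈ Gᶜ, z k * Ψ k p0 * (Ψ k p : ℂ)‖ ^ 2
        + 2 * (C1 * ∑ k ∈ G, Ψ k p ^ 2 * (1 + E k ^ 2)⁻¹)) := by
        refine Finset.sum_le_sum fun p _ => ?_
        rw [← Finset.sum_add_sum_compl G, add_comm]
        exact (norm_sq_add_le _ _).trans (add_le_add le_rfl (mul_le_mul_of_nonneg_left (h2 p) (by norm_num)))
    _ = 2 * ∑ p ∈ F, ‖∑ k ∈ Gᶜ, z k * Ψ k p0 * (Ψ k p : ℂ)‖ ^ 2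
        + 2 * (C1 * ∑ p ∈ F, ∑ k ∈ G, Ψ k p ^ 2 * (1 + E k ^ 2)⁻¹) := by
        rw [Finset.sum_add_distrib, ← Finset.mul_sum, ← Finset.mul_sum, ← Finset.mul_sum]
    _ ≤ _ := by gcongr

/-- weighted bound in the layer direction -/
lemma evo_weight {K : Matrix I I ℝ} {E : I → ℝ} {Ψ : I → I → ℝ} (h : IsEig K E Ψ)
    (hK : ∀ p q, K p q = K q p) (p0 : I)
    (z : I → ℂ) (hz : ∀ k, ‖z k‖ = 1) (α : I → ℝ) (C1 c : ℝ)
    (hC1 : ∑ k, Ψ k p0 ^ 2 * (1 + E k ^ 2) ≤ C1)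
    (hc : ∀ p, ∑ q, |K p q - if p = q then α p else 0| ≤ c) :
    ∑ p, (1 + α p ^ 2) * ‖∑ k, z k * Ψ k p0 * (Ψ k p : ℂ)‖ ^ 2 ≤ 1 + 2 * C1 + 2 * c ^ 2 := by
  set a : I → ℂ := fun p => ∑ k, z k * Ψ k p0 * (Ψ k p : ℂ) with ha
  set D : I → I → ℝ := fun p q => K p q - if p = q then α p else 0 with hD
  have hDs : ∀ p q, D p q = D q p := by
    intro p q
    simp only [hD]
    rw [hK p q]
    by_cases hpq : p = q
    · subst hpq; rfl
    · simp [hpq, Ne.symm hpq]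
  have hn : ∑ p, ‖a p‖ ^ 2 = 1 := by
    rw [ha, parseval_orth h, ← comp_one h p0]
    refine Finset.sum_congr rfl fun k _ => ?_
    rw [norm_mul, hz, one_mul, Complex.norm_real, Real.norm_eq_abs, sq_abs]
  have hKa : ∀ p, ∑ q, (K p q : ℂ) * a q = ∑ k, z k * Ψ k p0 * E k * (Ψ k p : ℂ) := by
    intro p
    simp only [ha, Finset.mul_sum]
    rw [Finset.sum_comm]
    refine Finset.sum_congr rfl fun k _ => ?_
    have := congrArg (fun r : ℝ => (r : ℂ)) (h.eig k p)
    push_cast at this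
    calc ∑ q, (K p q : ℂ) * (z k * Ψ k p0 * (Ψ k q : ℂ)) = (z k * Ψ k p0) * ∑ q, (K p q : ℂ) * (Ψ k q : ℂ) := by
          rw [Finset.mul_sum]; exact Finset.sum_congr rfl fun q _ => by ring
      _ = _ := by rw [this]; ring
  have hKn : ∑ p, ‖∑ q, (K p q : ℂ) * a q‖ ^ 2 ≤ C1 := by
    simp only [hKa]
    rw [parseval_orth h]
    refine le_trans (Finset.sum_le_sum fun k _ => ?_) hC1
    rw [norm_mul, norm_mul, hz, one_mul, Complex.norm_real, Complex.norm_real, Real.norm_eq_abs, Real.norm_eq_abs, mul_pow, sq_abs, sq_abs]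
    nlinarith [sq_nonneg (Ψ k p0)]
  have hDn : ∑ p, ‖∑ q, (D p q : ℂ) * a q‖ ^ 2 ≤ c ^ 2 := by
    have hs := schur univ (fun p q => |D p q|) c (fun p _ => by simpa using hc p)
      (fun q _ => by simp only [abs_abs, hDs _ q]; exact hc q) (fun p => ‖a p‖)
    rw [hn, mul_one] at hs
    refine le_trans (Finset.sum_le_sum fun p _ => ?_) hs
    refine pow_le_pow_left₀ (norm_nonneg _) ?_ 2
    refine (norm_sum_le _ _).trans (le_of_eq (Finset.sum_congr rfl fun q _ => ?_))
    rw [norm_mul, Complex.norm_real, Real.norm_eq_abs]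
  have hpt : ∀ p, (1 + α p ^ 2) * ‖a p‖ ^ 2 ≤ ‖a p‖ ^ 2 + (2 * ‖∑ q, (K p q : ℂ) * a q‖ ^ 2 + 2 * ‖∑ q, (D p q : ℂ) * a q‖ ^ 2) := by
    intro p
    have e1 : (α p : ℂ) * a p = ∑ q, (K p q : ℂ) * a q + -∑ q, (D p q : ℂ) * a q := by
      rw [← sub_eq_add_neg, ← Finset.sum_sub_distrib]
      simp only [← sub_mul, hD]
      have : ∀ q, ((K p q : ℂ) - ((K p q - if p = q then α p else 0 : ℝ) : ℂ)) * a q = if p = q then (α p : ℂ) * a q else 0 := by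
        intro q; split_ifs <;> simp
      rw [Finset.sum_congr rfl fun q _ => this q]
      simp
    have e2 := norm_sq_add_le (∑ q, (K p q : ℂ) * a q) (-∑ q, (D p q : ℂ) * a q)
    rw [← e1, norm_neg, norm_mul, mul_pow, Complex.norm_real, Real.norm_eq_abs, sq_abs] at e2
    linarith
  refine (Finset.sum_le_sum fun p _ => hpt p).trans ?_
  rw [Finset.sum_add_distrib, Finset.sum_add_distrib, ← Finset.mul_sum, ← Finset.mul_sum, hn]
  linarith

end Det
end

section

section Fl
variable {ι N : Type*} [Fintype ι] [DecidableEq ι] [Fintype N] [DecidableEq N]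

/-- The truncated Floquet matrix. -/
def Kfl (h : ι → ι → ℝ) (w : ι → ℝ) (a : N → ℝ) (nb : N → N → ℝ) : Matrix (ι × N) (ι × N) ℝ :=
  fun p q => (if p.2 = q.2 then h p.1 q.1 else 0) + (if p.1 = q.1 then w p.1 * nb p.2 q.2 else 0)
    + (if p = q then a p.2 else 0)

lemma Kfl_symm (h : ι → ι → ℝ) (w : ι → ℝ) (a : N → ℝ) (nb : N → N → ℝ)
    (hs : ∀ y y', h y y' = h y' y) (hn : ∀ n n', nb n n' = nb n' n) (p q : ι × N) :
    Kfl h w a nb p q = Kfl h w a nb q p := by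
  unfold Kfl
  rw [hs p.1 q.1, hn p.2 q.2]
  congr 1
  · congr 1
    · simp only [eq_comm]
    · by_cases hh : p.1 = q.1
      · simp [hh]
      · simp [hh, Ne.symm hh]
  · by_cases hh : p = q
    · simp [hh]
    · simp [hh, Ne.symm hh]

lemma Kfl_row (h : ι → ι → ℝ) (w : ι → ℝ) (a : N → ℝ) (nb : N → N → ℝ) (C0 Lc : ℝ)
    (hh : ∀ y, ∑ y', |h y y'| ≤ C0) (hw : ∀ y, |w y| ≤ Lc) (hnb : ∀ n n', 0 ≤ nb n n')
    (hnb2 : ∀ n, ∑ n', nb n n' ≤ 2) (p : ι × N) :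
    ∑ q, |Kfl h w a nb p q - if p = q then a p.2 else 0| ≤ C0 + 2 * Lc := by
  have h1 : ∀ q : ι × N, |Kfl h w a nb p q - if p = q then a p.2 else 0|
      ≤ (if p.2 = q.2 then |h p.1 q.1| else 0) + (if p.1 = q.1 then |w p.1| * nb p.2 q.2 else 0) := by
    intro q
    unfold Kfl
    rw [add_sub_cancel_right]
    refine (abs_add_le _ _).trans (add_le_add ?_ ?_)
    · split_ifs <;> simp
    · split_ifs
      · rw [abs_mul, abs_of_nonneg (hnb _ _)]
      · simp
  refine (Finset.sum_le_sum fun q _ => h1 q).trans ?_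
  rw [Finset.sum_add_distrib, Fintype.sum_prod_type, Fintype.sum_prod_type]
  simp only [Finset.sum_ite_eq, Finset.mem_univ, if_true]
  rw [Finset.sum_comm (s := univ (α := ι))]
  simp only [Finset.sum_ite_eq, Finset.mem_univ, if_true]
  rw [← Finset.mul_sum]
  have := hh p.1
  have h2 := mul_le_mul (hw p.1) (hnb2 p.2) (Finset.sum_nonneg fun _ _ => hnb _ _) ((abs_nonneg _).trans (hw p.1))
  linarith

lemma Kfl_eq (h : ι → ι → ℝ) (w : ι → ℝ) (a : N → ℝ) (nb : N → N → ℝ) (u : ι × N → ℝ) (y : ι) (n : N) :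
    ∑ q, Kfl h w a nb (y, n) q * u q
      = ∑ y', h y y' * u (y', n) + w y * ∑ n', nb n n' * u (y, n') + a n * u (y, n) := by
  unfold Kfl
  simp only [add_mul, Finset.sum_add_distrib, ite_mul, zero_mul]
  congr 1
  · congr 1
    · rw [Fintype.sum_prod_type]
      simp
    · rw [Fintype.sum_prod_type, Finset.sum_comm]
      simp [Finset.mul_sum, mul_assoc]
  · simp

/-- Resolvent decay in good columns. -/
lemma good_tail (h : ι → ι → ℝ) (w : ι → ℝ) (a : N → ℝ) (nb : N → N → ℝ) (C2 Lc D1 Sρ Sa ε4 : ℝ)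
    (ρ : ι → ℝ) (hρ : ∀ y, 0 < ρ y) (x : ι)
    (hw : ∀ y, |w y| ≤ Lc * ρ y) (hnb : ∀ n n', 0 ≤ nb n n') (hnbs : ∀ n n', nb n n' = nb n' n)
    (hnb2 : ∀ n, ∑ n', nb n n' ≤ 2) (hhx : ∀ y, y ≠ x → |h y x| ≤ D1 * ρ y)
    (hSρ : ∑ y, ρ y ≤ Sρ) (hSa : ∑ n, (1 + a n ^ 2)⁻¹ ≤ Sa) (hC2 : 0 ≤ C2) (hε : 0 ≤ ε4)
    {E : ι × N → ℝ} {Ψ : ι × N → ι × N → ℝ} (hE : IsEig (Kfl h w a nb) E Ψ)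
    (hQ : ∀ p : ι × N, ∑ k, Ψ k p ^ 2 * (1 + E k ^ 2)⁻¹ ≤ C2 * (1 + a p.2 ^ 2)⁻¹)
    (G : Finset (ι × N)) (F : Finset ι)
    (hG : ∀ k ∈ G, ∀ n, ∀ u : ι → ℝ, ∑ y ∈ F, u y ^ 2 ≤ ε4 * ∑ y ∈ univ.erase x, (ρ y)⁻¹ *
      (∑ y' ∈ univ.erase x, (h y y' - if y = y' then E k - a n else 0) * u y') ^ 2) :
    ∑ p ∈ F ×ˢ (univ : Finset N), ∑ k ∈ G, Ψ k p ^ 2 * (1 + E k ^ 2)⁻¹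
      ≤ ε4 * (2 * D1 ^ 2 * Sρ * C2 * Sa + 8 * Lc ^ 2 * Sρ * C2 * Sa) := by
  have hs : ∀ k n y, y ≠ x → ∑ y' ∈ univ.erase x, (h y y' - if y = y' then E k - a n else 0) * Ψ k (y', n)
      = -(h y x * Ψ k (x, n)) - w y * ∑ n', nb n n' * Ψ k (y, n') := by
    intro k n y hy
    have e1 := hE.eig k (y, n)
    rw [Kfl_eq, ← Finset.add_sum_erase univ _ (Finset.mem_univ x)] at e1
    simp only [sub_mul, Finset.sum_sub_distrib, ite_mul, zero_mul]
    rw [Finset.sum_ite_eq, if_pos (Finset.mem_erase.2 ⟨hy, Finset.mem_univ _⟩)]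
    linarith
  have hsq : ∀ k n y, y ≠ x → (ρ y)⁻¹ * (∑ y' ∈ univ.erase x, (h y y' - if y = y' then E k - a n else 0) * Ψ k (y', n)) ^ 2
      ≤ 2 * D1 ^ 2 * ρ y * Ψ k (x, n) ^ 2 + 4 * Lc ^ 2 * ρ y * ∑ n', nb n n' * Ψ k (y, n') ^ 2 := by
    intro k n y hy
    rw [hs k n y hy]
    have hr := hρ y
    have c1 : (h y x) ^ 2 ≤ D1 ^ 2 * ρ y ^ 2 := by
      rw [← mul_pow, ← sq_abs (h y x)]; exact pow_le_pow_left₀ (abs_nonneg _) (hhx y hy) 2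
    have c2 : (w y) ^ 2 ≤ Lc ^ 2 * ρ y ^ 2 := by
      rw [← mul_pow, ← sq_abs (w y)]; exact pow_le_pow_left₀ (abs_nonneg _) (hw y) 2
    have c3 : (∑ n', nb n n' * Ψ k (y, n')) ^ 2 ≤ 2 * ∑ n', nb n n' * Ψ k (y, n') ^ 2 := by
      refine (Finset.sum_sq_le_sum_mul_sum_of_sq_le_mul univ (f := fun n' => nb n n')
        (g := fun n' => nb n n' * Ψ k (y, n') ^ 2) (fun _ _ => hnb _ _) (fun _ _ => mul_nonneg (hnb _ _) (sq_nonneg _))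
        (fun k _ => le_of_eq (by ring))).trans ?_
      exact mul_le_mul_of_nonneg_right (hnb2 n) (Finset.sum_nonneg fun _ _ => mul_nonneg (hnb _ _) (sq_nonneg _))
    set X := ∑ n', nb n n' * Ψ k (y, n')
    set Y := ∑ n', nb n n' * Ψ k (y, n') ^ 2 with hY
    have hY0 : 0 ≤ Y := Finset.sum_nonneg fun _ _ => mul_nonneg (hnb _ _) (sq_nonneg _)
    have c4 : (-(h y x * Ψ k (x, n)) - w y * X) ^ 2 ≤ 2 * (D1 ^ 2 * ρ y ^ 2 * Ψ k (x, n) ^ 2) + 2 * (Lc ^ 2 * ρ y ^ 2 * (2 * Y)) := by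
      have d1 : (h y x) ^ 2 * Ψ k (x, n) ^ 2 ≤ D1 ^ 2 * ρ y ^ 2 * Ψ k (x, n) ^ 2 :=
        mul_le_mul_of_nonneg_right c1 (sq_nonneg _)
      have d2 : (w y) ^ 2 * X ^ 2 ≤ Lc ^ 2 * ρ y ^ 2 * (2 * Y) :=
        mul_le_mul c2 c3 (sq_nonneg _) (by positivity)
      nlinarith [sq_nonneg (h y x * Ψ k (x, n) - w y * X)]
    calc (ρ y)⁻¹ * (-(h y x * Ψ k (x, n)) - w y * X) ^ 2
        ≤ (ρ y)⁻¹ * (2 * (D1 ^ 2 * ρ y ^ 2 * Ψ k (x, n) ^ 2) + 2 * (Lc ^ 2 * ρ y ^ 2 * (2 * Y))) :=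
          mul_le_mul_of_nonneg_left c4 (by positivity)
      _ = _ := by field_simp; ring
  set q : ι × N → ℝ := fun p => ∑ k, Ψ k p ^ 2 * (1 + E k ^ 2)⁻¹ with hq
  have hpk : ∀ k ∈ G, ∀ n, ∑ y ∈ F, Ψ k (y, n) ^ 2 ≤ ε4 * ∑ y, (2 * D1 ^ 2 * ρ y * Ψ k (x, n) ^ 2 + 4 * Lc ^ 2 * ρ y * ∑ n', nb n n' * Ψ k (y, n') ^ 2) := by
    intro k hk n
    refine (hG k hk n (fun y => Ψ k (y, n))).trans (mul_le_mul_of_nonneg_left ?_ hε)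
    refine (Finset.sum_le_sum fun y hy => hsq k n y (Finset.ne_of_mem_erase hy)).trans ?_
    refine Finset.sum_le_sum_of_subset_of_nonneg (Finset.subset_univ _) fun y _ _ => ?_
    have := hρ y
    have : 0 ≤ ∑ n', nb n n' * Ψ k (y, n') ^ 2 := Finset.sum_nonneg fun _ _ => mul_nonneg (hnb _ _) (sq_nonneg _)
    positivity
  have hSa0 : 0 ≤ Sa := (Finset.sum_nonneg fun n _ => by positivity).trans hSa
  calc ∑ p ∈ F ×ˢ (univ : Finset N), ∑ k ∈ G, Ψ k p ^ 2 * (1 + E k ^ 2)⁻¹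
      = ∑ k ∈ G, ∑ n, (∑ y ∈ F, Ψ k (y, n) ^ 2) * (1 + E k ^ 2)⁻¹ := by
        rw [Finset.sum_comm]
        refine Finset.sum_congr rfl fun k _ => ?_
        rw [Finset.sum_product_right]
        simp only [Finset.sum_mul]
    _ ≤ ∑ k ∈ G, ∑ n, (ε4 * ∑ y, (2 * D1 ^ 2 * ρ y * Ψ k (x, n) ^ 2 + 4 * Lc ^ 2 * ρ y * ∑ n', nb n n' * Ψ k (y, n') ^ 2)) * (1 + E k ^ 2)⁻¹ := by
        refine Finset.sum_le_sum fun k hk => Finset.sum_le_sum fun n _ => ?_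
        exact mul_le_mul_of_nonneg_right (hpk k hk n) (by positivity)
    _ ≤ ∑ k, ∑ n, (ε4 * ∑ y, (2 * D1 ^ 2 * ρ y * Ψ k (x, n) ^ 2 + 4 * Lc ^ 2 * ρ y * ∑ n', nb n n' * Ψ k (y, n') ^ 2)) * (1 + E k ^ 2)⁻¹ := by
        refine Finset.sum_le_sum_of_subset_of_nonneg (Finset.subset_univ _) fun k _ _ => Finset.sum_nonneg fun n _ => ?_
        refine mul_nonneg (mul_nonneg hε (Finset.sum_nonneg fun y _ => ?_)) (by positivity)
        have := hρ y
        have : 0 ≤ ∑ n', nb n n' * Ψ k (y, n') ^ 2 := Finset.sum_nonneg fun _ _ => mul_nonneg (hnb _ _) (sq_nonneg _)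
        positivity
    _ = ε4 * ∑ n, ∑ y, (2 * D1 ^ 2 * ρ y * q (x, n) + 4 * Lc ^ 2 * ρ y * ∑ n', nb n n' * q (y, n')) := by
        rw [Finset.sum_comm, Finset.mul_sum]
        refine Finset.sum_congr rfl fun n _ => ?_
        simp only [mul_assoc ε4]
        rw [← Finset.mul_sum]
        congr 1
        simp only [Finset.sum_mul]
        rw [Finset.sum_comm]
        refine Finset.sum_congr rfl fun y _ => ?_
        simp only [add_mul, Finset.sum_add_distrib, hq]
        congr 1
        · rw [Finset.mul_sum]; exact Finset.sum_congr rfl fun _ _ => by ring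
        · simp only [mul_assoc (4 * Lc ^ 2 * ρ y), ← Finset.mul_sum]
          congr 1
          simp only [Finset.sum_mul, Finset.mul_sum]
          rw [Finset.sum_comm]
          exact Finset.sum_congr rfl fun _ _ => Finset.sum_congr rfl fun _ _ => by ring
    _ ≤ ε4 * ∑ n, ∑ y, (2 * D1 ^ 2 * ρ y * (C2 * (1 + a n ^ 2)⁻¹) + 4 * Lc ^ 2 * ρ y * ∑ n', nb n n' * (C2 * (1 + a n' ^ 2)⁻¹)) := by
        refine mul_le_mul_of_nonneg_left (Finset.sum_le_sum fun n _ => Finset.sum_le_sum fun y _ => ?_) hε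
        have := hρ y
        refine add_le_add (mul_le_mul_of_nonneg_left (hQ (x, n)) (by positivity))
          (mul_le_mul_of_nonneg_left (Finset.sum_le_sum fun n' _ => ?_) (by positivity))
        exact mul_le_mul_of_nonneg_left (hQ (y, n')) (hnb _ _)
    _ = ε4 * (2 * D1 ^ 2 * (∑ y, ρ y) * C2 * (∑ n, (1 + a n ^ 2)⁻¹) + 4 * Lc ^ 2 * (∑ y, ρ y) * C2 * ∑ n, ∑ n', nb n n' * (1 + a n' ^ 2)⁻¹) := by
        congr 1
        simp only [Finset.sum_add_distrib]
        congr 1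
        · rw [Finset.mul_sum]
          refine Finset.sum_congr rfl fun n _ => ?_
          rw [Finset.mul_sum, Finset.sum_mul, Finset.sum_mul]
          exact Finset.sum_congr rfl fun _ _ => by ring
        · rw [Finset.mul_sum]
          refine Finset.sum_congr rfl fun n _ => ?_
          have e5 : ∑ n', nb n n' * (C2 * (1 + a n' ^ 2)⁻¹) = C2 * ∑ n', nb n n' * (1 + a n' ^ 2)⁻¹ := by
            rw [Finset.mul_sum]; exact Finset.sum_congr rfl fun _ _ => by ring
          rw [e5, ← Finset.sum_mul, ← Finset.mul_sum]
          ring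
    _ ≤ ε4 * (2 * D1 ^ 2 * Sρ * C2 * Sa + 4 * Lc ^ 2 * Sρ * C2 * (2 * Sa)) := by
        have hρ0 : 0 ≤ ∑ y, ρ y := Finset.sum_nonneg fun y _ => (hρ y).le
        have hn2 : ∑ n, ∑ n', nb n n' * (1 + a n' ^ 2)⁻¹ ≤ 2 * Sa := by
          rw [Finset.sum_comm]
          simp only [← Finset.sum_mul]
          refine le_trans (Finset.sum_le_sum fun n' _ => mul_le_mul_of_nonneg_right (b := ∑ n, nb n n') (c := 2) ?_ (by positivity)) ?_
          · simp only [hnbs _ n']; exact hnb2 n'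
          · rw [← Finset.mul_sum]; linarith
        have hS0 : 0 ≤ Sρ := hρ0.trans hSρ
        have hn0 : 0 ≤ ∑ n, ∑ n', nb n n' * (1 + a n' ^ 2)⁻¹ := Finset.sum_nonneg fun _ _ => Finset.sum_nonneg fun _ _ => mul_nonneg (hnb _ _) (by positivity)
        gcongr
    _ = _ := by ring

end Fl
end

section

section Fl
variable {ι N : Type*} [Fintype ι] [DecidableEq ι] [Fintype N] [DecidableEq N]

lemma layer_sum (A : ι × N → ℂ) (ζ : N → ℂ) (hζ : ∀ n, ‖ζ n‖ = 1) (a : N → ℝ) (S : Finset N) (F : Finset ι)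
    (η C4 T : ℝ) (hη : ∑ n ∈ Sᶜ, (1 + a n ^ 2)⁻¹ ≤ η)
    (hT : ∑ p ∈ F ×ˢ (univ : Finset N), ‖A p‖ ^ 2 ≤ T)
    (hC4 : ∑ p, (1 + a p.2 ^ 2) * ‖A p‖ ^ 2 ≤ C4) :
    ∑ y ∈ F, ‖∑ n, ζ n * A (y, n)‖ ^ 2 ≤ 2 * (S.card * T) + 2 * (η * C4) := by
  have hη0 : 0 ≤ η := (Finset.sum_nonneg fun _ _ => by positivity).trans hη
  have hn : ∀ (s : Finset N) y, ‖∑ n ∈ s, ζ n * A (y, n)‖ ≤ ∑ n ∈ s, ‖A (y, n)‖ := by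
    intro s y
    refine (norm_sum_le _ _).trans (le_of_eq (Finset.sum_congr rfl fun n _ => ?_))
    rw [norm_mul, hζ, one_mul]
  have h1 : ∀ y, ‖∑ n ∈ S, ζ n * A (y, n)‖ ^ 2 ≤ S.card * ∑ n, ‖A (y, n)‖ ^ 2 := by
    intro y
    refine (pow_le_pow_left₀ (norm_nonneg _) (hn S y) 2).trans ?_
    refine sq_sum_le_card_mul_sum_sq.trans ?_
    refine mul_le_mul_of_nonneg_left ?_ (by positivity)
    exact Finset.sum_le_sum_of_subset_of_nonneg (Finset.subset_univ _) fun _ _ _ => by positivity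
  have h2 : ∀ y, ‖∑ n ∈ Sᶜ, ζ n * A (y, n)‖ ^ 2 ≤ η * ∑ n, (1 + a n ^ 2) * ‖A (y, n)‖ ^ 2 := by
    intro y
    refine (pow_le_pow_left₀ (norm_nonneg _) (hn Sᶜ y) 2).trans ?_
    refine (Finset.sum_sq_le_sum_mul_sum_of_sq_le_mul _ (f := fun n => (1 + a n ^ 2)⁻¹)
      (g := fun n => (1 + a n ^ 2) * ‖A (y, n)‖ ^ 2) (fun _ _ => by positivity) (fun _ _ => by positivity)
      (fun n _ => ?_)).trans ?_
    · rw [inv_mul_cancel_left₀ (by positivity)]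
    · refine mul_le_mul hη ?_ (Finset.sum_nonneg fun _ _ => by positivity) hη0
      exact Finset.sum_le_sum_of_subset_of_nonneg (Finset.subset_univ _) fun _ _ _ => by positivity
  calc ∑ y ∈ F, ‖∑ n, ζ n * A (y, n)‖ ^ 2
      ≤ ∑ y ∈ F, (2 * (S.card * ∑ n, ‖A (y, n)‖ ^ 2) + 2 * (η * ∑ n, (1 + a n ^ 2) * ‖A (y, n)‖ ^ 2)) := by
        refine Finset.sum_le_sum fun y _ => ?_
        rw [← Finset.sum_add_sum_compl S]
        refine (norm_sq_add_le _ _).trans ?_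
        linarith [h1 y, h2 y]
    _ = 2 * (S.card * ∑ p ∈ F ×ˢ (univ : Finset N), ‖A p‖ ^ 2) + 2 * (η * ∑ y ∈ F, ∑ n, (1 + a n ^ 2) * ‖A (y, n)‖ ^ 2) := by
        rw [Finset.sum_add_distrib, Finset.sum_product]
        simp only [Finset.mul_sum]
    _ ≤ 2 * (S.card * T) + 2 * (η * C4) := by
        have : ∑ y ∈ F, ∑ n, (1 + a n ^ 2) * ‖A (y, n)‖ ^ 2 ≤ C4 := by
          refine le_trans ?_ hC4
          rw [Fintype.sum_prod_type]
          exact Finset.sum_le_sum_of_subset_of_nonneg (Finset.subset_univ _) fun _ _ _ => Finset.sum_nonneg fun _ _ => by positivity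
        gcongr

lemma det_tail (h : ι → ι → ℝ) (w : ι → ℝ) (a : N → ℝ) (nb : N → N → ℝ) (C0 c Lc D1 Sρ Sa ε4 η bad : ℝ)
    (ρ : ι → ℝ) (hρ : ∀ y, 0 < ρ y) (hρ1 : ∀ y, ρ y ≤ 1) (x : ι) (n0 : N) (ha0 : a n0 = 0)
    (hsym : ∀ y y', h y y' = h y' y) (hLc : 0 ≤ Lc) (hcdef : c = C0 + 2 * Lc)
    (hh : ∀ y, ∑ y', |h y y'| ≤ C0)
    (hw : ∀ y, |w y| ≤ Lc * ρ y) (hnb : ∀ n n', 0 ≤ nb n n') (hnbs : ∀ n n', nb n n' = nb n' n)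
    (hnb2 : ∀ n, ∑ n', nb n n' ≤ 2) (hhx : ∀ y, y ≠ x → |h y x| ≤ D1 * ρ y)
    (hSρ : ∑ y, ρ y ≤ Sρ) (hSa : ∑ n, (1 + a n ^ 2)⁻¹ ≤ Sa) (hε : 0 ≤ ε4)
    {E : ι × N → ℝ} {Ψ : ι × N → ι × N → ℝ} (hE : IsEig (Kfl h w a nb) E Ψ)
    (G : Finset (ι × N)) (F : Finset ι)
    (hG : ∀ k ∈ G, ∀ n, ∀ u : ι → ℝ, ∑ y ∈ F, u y ^ 2 ≤ ε4 * ∑ y ∈ univ.erase x, (ρ y)⁻¹ *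
      (∑ y' ∈ univ.erase x, (h y y' - if y = y' then E k - a n else 0) * u y') ^ 2)
    (hbad : ∑ k ∈ Gᶜ, Ψ k (x, n0) ^ 2 ≤ bad)
    (z : ι × N → ℂ) (hz : ∀ k, ‖z k‖ = 1) (ζ : N → ℂ) (hζ : ∀ n, ‖ζ n‖ = 1) (S : Finset N)
    (hη : ∑ n ∈ Sᶜ, (1 + a n ^ 2)⁻¹ ≤ η) :
    ∑ y ∈ F, ‖∑ n, ζ n * ∑ k, z k * Ψ k (x, n0) * (Ψ k (y, n) : ℂ)‖ ^ 2
      ≤ 2 * (S.card * (2 * bad + 2 * ((1 + c ^ 2) * (ε4 * (2 * D1 ^ 2 * Sρ * (2 * (1 + c ^ 2)) * Sa + 8 * Lc ^ 2 * Sρ * (2 * (1 + c ^ 2)) * Sa)))))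
        + 2 * (η * (1 + 2 * (1 + c ^ 2) + 2 * c ^ 2)) := by
  have hw1 : ∀ y, |w y| ≤ Lc := fun y => (hw y).trans (mul_le_of_le_one_right hLc (hρ1 y))
  have hrow : ∀ p : ι × N, ∑ q, |Kfl h w a nb p q - if p = q then a p.2 else 0| ≤ c := fun p => by
    rw [hcdef]; exact Kfl_row h w a nb C0 Lc hh hw1 hnb hnb2 p
  have hC1 : ∑ k, Ψ k (x, n0) ^ 2 * (1 + E k ^ 2) ≤ 1 + c ^ 2 := by
    have h1 := eig_shift_le hE (x, n0) (a n0) c (hrow (x, n0))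
    rw [ha0] at h1
    simp only [sub_zero] at h1
    simp only [mul_add, mul_one, Finset.sum_add_distrib, comp_one hE]
    linarith
  have hT := good_tail h w a nb (2 * (1 + c ^ 2)) Lc D1 Sρ Sa ε4 ρ hρ x hw hnb hnbs hnb2 hhx hSρ hSa
    (by positivity) hε hE (fun p => Q_le hE p (a p.2) c (hrow p)) G F hG
  have h2 := evo_split hE (x, n0) z hz G (F ×ˢ (univ : Finset N)) _ _ hC1 hT
  have h3 := evo_weight hE (Kfl_symm h w a nb hsym hnbs) (x, n0) z hz (fun p => a p.2) _ c hC1 hrow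
  refine (layer_sum (fun p => ∑ k, z k * Ψ k (x, n0) * (Ψ k p : ℂ)) ζ hζ a S F η _ _ hη (h2.trans ?_) h3).trans le_rfl
  linarith

end Fl
end

section

/-- neighbouring layers -/
def nbI (n n' : ℤ) : ℝ := (if n' = n + 1 then 1 else 0) + (if n' = n - 1 then 1 else 0)

lemma nbI_nonneg (n n' : ℤ) : 0 ≤ nbI n n' := by
  unfold nbI; split_ifs <;> norm_num

lemma nbI_symm (n n' : ℤ) : nbI n n' = nbI n' n := by
  unfold nbI
  have h1 : (n' = n + 1) ↔ (n = n' - 1) := by omega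
  have h2 : (n' = n - 1) ↔ (n = n' + 1) := by omega
  simp only [h1, h2]
  rw [add_comm]

lemma nbI_sum (s : Finset ℤ) (n : ℤ) : ∑ n' ∈ s, nbI n n' ≤ 2 := by
  unfold nbI
  rw [Finset.sum_add_distrib, Finset.sum_ite_eq', Finset.sum_ite_eq']
  split_ifs <;> norm_num

lemma nbI_sum' (s : Finset ℤ) (n : s) : ∑ n' : s, nbI n n' ≤ 2 := by
  rw [Finset.sum_coe_sort s (fun n' => nbI n n')]
  exact nbI_sum s n

/-- spatial boxes -/
def sbox (d m : ℕ) : Finset (Site d) := Fintype.piFinset fun _ => Finset.Icc (-(m:ℤ)) m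

/-- layers -/
def lay (m : ℕ) : Finset ℤ := Finset.Icc (-(m:ℤ)) m

lemma mem_sbox {d m : ℕ} (y : Site d) : l1 y ≤ m → y ∈ sbox d m := by
  intro h
  rw [sbox, Fintype.mem_piFinset]
  intro k
  have h2 : (y k).natAbs ≤ l1 y := Finset.single_le_sum (f := fun k => (y k).natAbs) (fun _ _ => Nat.zero_le _) (Finset.mem_univ k)
  rw [Finset.mem_Icc]
  omega

lemma zero_mem_lay (m : ℕ) : (0:ℤ) ∈ lay m := by
  rw [lay, Finset.mem_Icc]; omega

/-- The concrete truncated Floquet matrix. -/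
def Kc {d : ℕ} (γ ω lam : ℝ) (W : Site d → ℝ) (m : ℕ) (v : Site d → ℝ) :
    Matrix (sbox d m × lay m) (sbox d m × lay m) ℝ :=
  Kfl (fun y y' => hst γ v y y') (fun y => lam / 2 * W y) (fun n => 2 * Real.pi * ω * ((n:ℤ):ℝ))
    (fun n n' => nbI n n')

lemma Kc_symm {d : ℕ} (γ ω lam : ℝ) (W : Site d → ℝ) (m : ℕ) (v : Site d → ℝ) (p q) :
    Kc γ ω lam W m v p q = Kc γ ω lam W m v q p :=
  Kfl_symm _ _ _ _ (fun _ _ => hst_symm _ _ _ _) (fun _ _ => nbI_symm _ _) _ _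

lemma Kc_meas {d : ℕ} (γ ω lam : ℝ) (W : Site d → ℝ) (m : ℕ) (p q) :
    Measurable fun v => Kc γ ω lam W m v p q := by
  unfold Kc Kfl hst
  refine (Measurable.add ?_ measurable_const).add measurable_const
  by_cases h1 : p.2 = q.2
  · by_cases h2 : (p.1 : Site d) = q.1
    · simp only [h1, h2, if_true]
      have h3 : Measurable fun v : Site d → ℝ => v (q.1 : Site d) := measurable_pi_apply _
      exact measurable_const.add (h3.const_mul γ)
    · simp only [h1, h2, if_true, if_false]
      exact measurable_const
  · simp only [h1, if_false]
    exact measurable_const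

lemma Kc_update {d : ℕ} (γ ω lam : ℝ) (W : Site d → ℝ) (m : ℕ) (v : Site d → ℝ) (x : Site d) (p q) :
    Kc γ ω lam W m (Function.update v x 0) p q
      + (if p = q then (γ * v x) * (if (p.1 : Site d) = x then 1 else 0) else 0)
      = Kc γ ω lam W m v p q := by
  unfold Kc Kfl hst
  by_cases hpq : p = q
  · subst hpq
    by_cases hx : (p.1 : Site d) = x
    · simp only [if_true, hx, Function.update_self]; ring
    · simp only [if_true, hx, Function.update_of_ne hx, if_false]; ring
  · simp only [if_neg hpq, add_zero]
    congr 1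
    by_cases h2 : p.2 = q.2
    · have : (p.1 : Site d) ≠ q.1 := fun h => hpq (Prod.ext (Subtype.ext h) h2)
      simp [this]
    · simp [h2]

lemma summable_an {ω : ℝ} (hω : 0 < ω) : Summable fun n : ℤ => (1 + (2 * Real.pi * ω * (n:ℝ)) ^ 2)⁻¹ := by
  have h1 : Summable fun n : ℤ => ((2 * Real.pi * ω) ^ 2)⁻¹ * (1 / (n:ℝ) ^ 2) :=
    (Real.summable_one_div_int_pow.2 (by norm_num)).mul_left _
  refine Summable.of_norm_bounded_eventually h1 ?_
  have : ({0}ᶜ : Set ℤ) ∈ Filter.cofinite := (Set.finite_singleton (0:ℤ)).compl_mem_cofinite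
  filter_upwards [this] with n hn
  have hn' : (n:ℝ) ≠ 0 := by exact_mod_cast hn
  have hpi := Real.pi_pos
  rw [Real.norm_of_nonneg (by positivity), one_div, ← mul_inv, ← mul_pow]
  exact inv_anti₀ (by positivity) (by linarith)

lemma hst_off {d : ℕ} (γ : ℝ) (v : Site d → ℝ) {σ : ℝ} (hσ : 0 < σ) (hσ1 : σ < 1) (y x : Site d) (hyx : y ≠ x) :
    |hst γ v y x| ≤ (2 * d * ((σ ^ (l1 x + 1)) ^ 4)⁻¹) * (σ ^ l1 y) ^ 4 := by
  unfold hst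
  rw [if_neg hyx, add_zero, abs_of_nonneg (hop_nonneg _ _)]
  by_cases h0 : hop y x = 0
  · rw [h0]; positivity
  have h1 := hop_ne h0
  have h2 : l1 y ≤ l1 x + 1 := by
    have := l1_add_le (y - x) x
    rw [sub_add_cancel] at this; omega
  have h3 : σ ^ (l1 x + 1) ≤ σ ^ l1 y := pow_le_pow_of_le_one hσ.le hσ1.le h2
  have h4 : (σ ^ (l1 x + 1)) ^ 4 ≤ (σ ^ l1 y) ^ 4 := pow_le_pow_left₀ (by positivity) h3 4
  refine (hop_le y x).trans ?_
  rw [mul_assoc]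
  refine le_mul_of_one_le_right (by positivity) ?_
  rw [inv_mul_eq_div, one_le_div (by positivity)]
  exact h4

/-- the product measure of the space-energy bad set -/
lemma badset_measure {d : ℕ} {P : Measure (Site d → ℝ)} [IsProbabilityMeasure P]
    (D : Set ((Site d → ℝ) × ℝ)) (hD : IsOpen D) (p : ℝ≥0∞) (hDp : ∀ e, P {v | (v, e) ∈ D} ≤ p)
    (Nn : Finset ℤ) (a : ℤ → ℝ) (r : ℝ) :
    (P.prod volume) (⋃ n ∈ Nn, {w : (Site d → ℝ) × ℝ | |w.2 - a n| < r ∧ (w.1, w.2 - a n) ∈ D})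
      ≤ Nn.card * (ENNReal.ofReal (2 * r) * p) := by
  refine (measure_biUnion_finset_le Nn _).trans ?_
  rw [← nsmul_eq_mul]
  refine Finset.sum_le_card_nsmul _ _ _ fun n _ => ?_
  have ho : IsOpen {w : (Site d → ℝ) × ℝ | |w.2 - a n| < r ∧ (w.1, w.2 - a n) ∈ D} := by
    refine IsOpen.inter (isOpen_lt (f := fun w : (Site d → ℝ) × ℝ => |w.2 - a n|) (by fun_prop) continuous_const) ?_
    exact hD.preimage (f := fun w : (Site d → ℝ) × ℝ => (w.1, w.2 - a n)) (by fun_prop)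
  rw [Measure.prod_apply_symm ho.measurableSet]
  calc ∫⁻ e, P ((fun v => (v, e)) ⁻¹' {w : (Site d → ℝ) × ℝ | |w.2 - a n| < r ∧ (w.1, w.2 - a n) ∈ D})
      ≤ ∫⁻ e, (Metric.ball (a n) r).indicator (fun _ => p) e := by
        refine lintegral_mono fun e => ?_
        by_cases he : |e - a n| < r
        · rw [Set.indicator_of_mem (by simpa [Metric.mem_ball, Real.dist_eq] using he)]
          exact (measure_mono fun v hv => hv.2).trans (hDp (e - a n))
        · have : ((fun v => (v, e)) ⁻¹' {w : (Site d → ℝ) × ℝ | |w.2 - a n| < r ∧ (w.1, w.2 - a n) ∈ D}) = ∅ := by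
            ext v
            simp only [Set.mem_preimage, Set.mem_ofPred_eq, Set.mem_empty_iff_false, iff_false, not_and]
            intro h; exact absurd h he
          rw [this, measure_empty]; exact zero_le
    _ = _ := by
        rw [lintegral_indicator Metric.isOpen_ball.measurableSet, setLIntegral_const, Real.volume_ball, mul_comm]

end

section

lemma badset_open {d : ℕ} (D : Set ((Site d → ℝ) × ℝ)) (hD : IsOpen D)
    (Nn : Finset ℤ) (a : ℤ → ℝ) (r : ℝ) :
    IsOpen (⋃ n ∈ Nn, {w : (Site d → ℝ) × ℝ | |w.2 - a n| < r ∧ (w.1, w.2 - a n) ∈ D}) := by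
  refine isOpen_biUnion fun n _ => ?_
  refine IsOpen.inter (isOpen_lt (f := fun w : (Site d → ℝ) × ℝ => |w.2 - a n|) (by fun_prop) continuous_const) ?_
  exact hD.preimage (f := fun w : (Site d → ℝ) × ℝ => (w.1, w.2 - a n)) (by fun_prop)

lemma exists_layers {ω : ℝ} (hω : 0 < ω) (q : ℝ) :
    ∃ Nn : Finset ℤ, ∀ n : ℤ, |2 * Real.pi * ω * (n:ℝ)| ≤ q → n ∈ Nn := by
  have hpi := Real.pi_pos
  refine ⟨Finset.Icc (-⌈q / (2 * Real.pi * ω)⌉) ⌈q / (2 * Real.pi * ω)⌉, fun n hn => ?_⟩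
  rw [abs_mul, abs_of_pos (by positivity : 0 < 2 * Real.pi * ω), mul_comm, ← le_div_iff₀ (by positivity)] at hn
  have h1 := hn.trans (Int.le_ceil _)
  rw [abs_le] at h1
  rw [Finset.mem_Icc]
  exact_mod_cast h1

lemma tail_m {d : ℕ} {g : Measure ℝ} (hgp : IsProbabilityMeasure g) (hg : g (Set.Icc (-1 : ℝ) 1)ᶜ = 0) (C : ℝ≥0)
    (hC : ∀ A : Set ℝ, g A ≤ (C : ℝ≥0∞) * volume A)
    {P : Measure (Site d → ℝ)} (hP : IsProductMeasure g P)
    (γ : ℝ) (hγ : 1 ≤ γ) (KF : ℝ≥0) (hKF : ENNReal.ofReal (Real.sqrt γ⁻¹) * kap C ≤ KF)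
    (hKd : 4 * d * (KF:ℝ) ≤ 1) (σ : ℝ) (hσ : 0 < σ) (hσ1 : σ < 1)
    (ω lam : ℝ) (W : Site d → ℝ) (m : ℕ) (x : sbox d m) (R : ℕ) (hR : l1 (x:Site d) ≤ R)
    (ε M M' u β : ℝ) (hε : 0 < ε) (hu : 0 < u) (hM' : M' = 2 * (2 * d + γ) + 2 * (ε ^ 2)⁻¹)
    (hβ : ∑ y ∈ (sbox d m).filter (fun y => R < l1 y), ∑ y' ∈ sbox d m, ((1:ℝ)/2) ^ l1 (y - y') * σ ^ l1 y' ≤ β)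
    (Nn : Finset ℤ) (hNn : ∀ n : ℤ, |2 * Real.pi * ω * (n:ℝ)| ≤ M + M' → n ∈ Nn)
    (δ : ℝ≥0∞)
    (hδ : 2 * (C * ENNReal.ofReal (2 * Real.pi)) * (Nn.card * (ENNReal.ofReal (2 * M') * ENNReal.ofReal (KF * β / ε)))
      ≤ ENNReal.ofReal u * δ) :
    ∃ Z : Set (Site d → ℝ), P Z ≤ δ ∧ ∀ v ∉ Z, (∀ j, |v j| ≤ 1) → ∀ E Ψ, IsEig (Kc γ ω lam W m v) E Ψ →
      ∀ s : Finset (sbox d m × lay m), (∀ k ∈ s, |E k| ≤ M ∧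
        ∃ n : lay m, ¬ GoodE γ (sbox d m) x σ R ε v (E k - 2 * Real.pi * ω * ((n:ℤ):ℝ))) →
        ∑ k ∈ s, Ψ k (x, ⟨0, zero_mem_lay m⟩) ^ 2 ≤ u := by
  have hp := hP.1
  set D : Set ((Site d → ℝ) × ℝ) := {w | ¬ GoodE γ (sbox d m) x σ R ε w.1 w.2} with hD
  have hDo : IsOpen D := bad_open γ (sbox d m) x σ R ε
  set B : Set ((Site d → ℝ) × ℝ) := ⋃ n ∈ Nn, {w : (Site d → ℝ) × ℝ | |w.2 - 2 * Real.pi * ω * (n:ℝ)| < M' ∧ (w.1, w.2 - 2 * Real.pi * ω * (n:ℝ)) ∈ D} with hB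
  have hBo : IsOpen B := badset_open D hDo Nn (fun n => 2 * Real.pi * ω * (n:ℝ)) M'
  have hBx : ∀ v t e, (Function.update v (x:Site d) t, e) ∈ B ↔ (v, e) ∈ B := by
    intro v t e
    simp only [hB, Set.mem_iUnion, Set.mem_ofPred_eq, hD, good_update]
  have hBm := badset_measure (P := P) D hDo (ENNReal.ofReal (KF * β / ε))
    (fun e => bad_prob hgp C hC hP γ (by linarith) KF hKF hKd (sbox d m) x σ hσ R hR ε hε β hβ e)
    Nn (fun n => 2 * Real.pi * ω * (n:ℝ)) M'
  obtain ⟨Y, hYm, hYi, hY⟩ := wegner hgp hg C hC hP (x:Site d)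
    (fun v => Kc γ ω lam W m (Function.update v (x:Site d) 0)) (fun v p q => Kc_symm _ _ _ _ _ _ _ _)
    (fun p q => (Kc_meas γ ω lam W m p q).comp (by
      apply measurable_pi_lambda
      intro j
      by_cases h : j = (x:Site d)
      · subst h; simp only [Function.update_self]; exact measurable_const
      · simp only [Function.update_of_ne h]
        exact measurable_pi_apply j))
    (fun v t => by simp only [Function.update_idem])
    (fun p => if (p.1 : Site d) = x then 1 else 0) (fun p => by split_ifs <;> norm_num)
    (x, ⟨0, zero_mem_lay m⟩) (by simp) γ hγ B hBo hBx
  refine ⟨{v | ENNReal.ofReal u ≤ Y v}, ?_, ?_⟩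
  · refine (meas_ge_le_lintegral_div hYm.aemeasurable (by simpa using hu) ENNReal.ofReal_ne_top).trans ?_
    refine ENNReal.div_le_of_le_mul' ?_
    refine hYi.trans (le_trans ?_ hδ)
    exact mul_le_mul_right hBm _
  · intro v hv hv1 E Ψ hE s hs
    rw [Set.mem_ofPred_eq, not_le] at hv
    have hE' : IsEig (fun p q => Kc γ ω lam W m (Function.update v (x:Site d) 0) p q
      + (if p = q then (γ * v x) * (if (p.1 : Site d) = x then 1 else 0) else 0)) E Ψ := by
      have : (fun p q => Kc γ ω lam W m (Function.update v (x:Site d) 0) p q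
        + (if p = q then (γ * v x) * (if (p.1 : Site d) = x then 1 else 0) else 0)) = Kc γ ω lam W m v := by
        funext p q; exact Kc_update _ _ _ _ _ _ _ _ _
      rw [this]; exact hE
    have h1 := hY v E Ψ hE' s (fun k hk => by
      obtain ⟨hk1, n, hn⟩ := hs k hk
      have h2 : |E k - 2 * Real.pi * ω * ((n:ℤ):ℝ)| < M' := by
        by_contra hcon
        push Not at hcon
        rw [hM'] at hcon
        exact hn (good_large γ (by linarith) _ x σ hσ hσ1 R hR ε hε v hv1 _ hcon)
      rw [hB, Set.mem_iUnion₂]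
      refine ⟨n, hNn n ?_, h2, hn⟩
      have h3 := abs_sub_abs_le_abs_sub (2 * Real.pi * ω * ((n:ℤ):ℝ)) (E k)
      rw [abs_sub_comm] at h3
      linarith)
    exact (ENNReal.ofReal_le_ofReal_iff hu.le).1 (h1.trans hv.le)

lemma sub_sum_le {ι : Type*} (s : Finset ι) (f : ι → ℝ) (hf : ∀ i, 0 ≤ f i) (hs : Summable f) :
    ∑ i : s, f i ≤ ∑' i, f i := by
  rw [Finset.sum_coe_sort s f]
  exact hs.sum_le_tsum _ fun _ _ => hf _

lemma choose_M (u : ℝ) (hu0 : 0 < u) (q : ℝ) (hq : 0 ≤ q) : ∃ M : ℝ, 0 < M ∧ q / M ^ 2 ≤ u := by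
  refine ⟨q / u + 1, by positivity, ?_⟩
  have hq : 0 ≤ q / u := by positivity
  rw [div_le_iff₀ (by positivity)]
  have : q = u * (q / u) := by field_simp
  calc q = u * (q / u) := this
    _ ≤ _ := mul_le_mul_of_nonneg_left (by nlinarith) hu0.le

lemma choose_eps (u : ℝ) (hu0 : 0 < u) (a C3 : ℝ) (ha : 0 ≤ a) (hC30 : 0 ≤ C3) :
    ∃ ε : ℝ, 0 < ε ∧ a * (ε ^ 4 * C3) ≤ u := by
  have h5 : 0 ≤ a * C3 := by positivity
  obtain ⟨q, hq⟩ : ∃ q, q = a * C3 + 1 := ⟨_, rfl⟩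
  have hq1 : 0 < q := by linarith
  refine ⟨min 1 (u / q), lt_min one_pos (by positivity), ?_⟩
  obtain ⟨e, he⟩ : ∃ e, e = min 1 (u / q) := ⟨_, rfl⟩
  rw [← he]
  have he0 : 0 ≤ e := by rw [he]; exact (lt_min one_pos (by positivity)).le
  have he1 : e ^ 4 ≤ e := pow_le_of_le_one he0 (by rw [he]; exact min_le_left _ _) (by norm_num)
  have he2 : e * q ≤ u := by
    rw [← le_div_iff₀ hq1, he]; exact min_le_right _ _
  calc a * (e ^ 4 * C3) = e ^ 4 * (a * C3) := by ring
    _ ≤ e * q := mul_le_mul he1 (by linarith) h5 he0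
    _ ≤ u := he2

lemma ofReal_aux (C : ℝ≥0) (k : ℕ) (s r p : ℝ) (hs : 0 ≤ s) (hr : 0 ≤ r) (hp : 0 ≤ p) :
    2 * (C * ENNReal.ofReal s) * (k * (ENNReal.ofReal r * ENNReal.ofReal p))
      = ENNReal.ofReal (2 * (C * s) * (k * (r * p))) := by
  rw [ENNReal.ofReal_mul (p := 2 * (C * s)) (by positivity), ENNReal.ofReal_mul (p := 2) (by positivity),
    ENNReal.ofReal_mul (p := (C:ℝ)) (by positivity), ENNReal.ofReal_mul (p := (k:ℝ)) (by positivity),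
    ENNReal.ofReal_mul (p := r) hr, ENNReal.ofReal_coe_nnreal, ENNReal.ofReal_natCast, ENNReal.ofReal_ofNat]

lemma card_aux (n u η : ℝ) (hu : 0 < u) (h : u * (24 * (n + 1)) = η) : n * (6 * u) ≤ η / 4 := by
  rw [← h]; linarith

set_option maxHeartbeats 1000000 in
lemma prob_tail {d : ℕ} {g : Measure ℝ} (hgp : IsProbabilityMeasure g) (hg : g (Set.Icc (-1 : ℝ) 1)ᶜ = 0) (C : ℝ≥0)
    (hC : ∀ A : Set ℝ, g A ≤ (C : ℝ≥0∞) * volume A)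
    {P : Measure (Site d → ℝ)} (hP : IsProductMeasure g P)
    (γ : ℝ) (hγ : 1 ≤ γ) (KF : ℝ≥0) (hKF : ENNReal.ofReal (Real.sqrt γ⁻¹) * kap C ≤ KF)
    (hKd : 4 * d * (KF:ℝ) ≤ 1) (σ : ℝ) (hσ : 0 < σ) (hσ1 : σ < 1)
    (ω : ℝ) (hω : 0 < ω) (lam : ℝ) (W : Site d → ℝ) (hW : ∀ y, |W y| ≤ (σ ^ l1 y) ^ 4)
    (x : Site d) (η : ℝ) (hη : 0 < η) (δ : ℝ) (hδ : 0 < δ) :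
    ∃ R : ℕ, ∀ m, ∀ hxm : x ∈ sbox d m, ∃ Z : Set (Site d → ℝ), P Z ≤ ENNReal.ofReal δ ∧
      ∀ v ∉ Z, (∀ j, |v j| ≤ 1) → ∀ E Ψ, IsEig (Kc γ ω lam W m v) E Ψ →
      ∀ z : sbox d m × lay m → ℂ, (∀ k, ‖z k‖ = 1) → ∀ ζ : lay m → ℂ, (∀ n, ‖ζ n‖ = 1) →
      ∑ y ∈ univ.filter (fun y : sbox d m => R < l1 (y:Site d)),
        ‖∑ n, ζ n * ∑ k, z k * Ψ k (⟨x, hxm⟩, ⟨0, zero_mem_lay m⟩) * (Ψ k (y, n) : ℂ)‖ ^ 2 ≤ η := by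
  set Lc : ℝ := |lam| / 2 with hLc
  have hLc0 : 0 ≤ Lc := by positivity
  set C0 : ℝ := 2 * d + γ with hC0
  set c : ℝ := C0 + 2 * Lc with hc
  set D1 : ℝ := 2 * d * ((σ ^ (l1 x + 1)) ^ 4)⁻¹ with hD1
  have hsρ : Summable fun y : Site d => (σ ^ l1 y) ^ 4 := by
    refine Summable.of_nonneg_of_le (fun y => by positivity) (fun y => ?_) (summable_l1 hσ.le hσ1)
    exact pow_le_of_le_one (by positivity) (pow_le_one₀ hσ.le hσ1.le) (by norm_num)
  set Sρ : ℝ := ∑' y : Site d, (σ ^ l1 y) ^ 4 with hSρ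
  have hSρ0 : 0 ≤ Sρ := tsum_nonneg fun y => by positivity
  have hsa := summable_an hω
  set Sa : ℝ := ∑' n : ℤ, (1 + (2 * Real.pi * ω * (n:ℝ)) ^ 2)⁻¹ with hSa
  have hSa0 : 0 ≤ Sa := tsum_nonneg fun y => by positivity
  set C4 : ℝ := 1 + 2 * (1 + c ^ 2) + 2 * c ^ 2 with hC4
  have hC40 : 0 < C4 := by positivity
  set C3 : ℝ := 2 * D1 ^ 2 * Sρ * (2 * (1 + c ^ 2)) * Sa + 8 * Lc ^ 2 * Sρ * (2 * (1 + c ^ 2)) * Sa with hC3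
  have hC30 : 0 ≤ C3 := by positivity
  obtain ⟨S, hS⟩ := summable_iff_vanishing_norm.1 hsa (η / (4 * C4)) (by positivity)
  set u : ℝ := η / (24 * (S.card + 1)) with hu
  have hu0 : 0 < u := by positivity
  clear_value C3 u
  obtain ⟨M, hM0, hM⟩ := choose_M u hu0 (1 + c ^ 2) (by positivity)
  obtain ⟨ε, hε0, hε⟩ := choose_eps u hu0 (1 + c ^ 2) C3 (by positivity) hC30
  set M' : ℝ := 2 * (2 * d + γ) + 2 * (ε ^ 2)⁻¹ with hM'
  have hM'0 : 0 < M' := by positivity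
  have hpi := Real.pi_pos
  obtain ⟨Nn, hNn⟩ := exists_layers hω (M + M')
  set cst : ℝ := 2 * (C * (2 * Real.pi)) * (Nn.card * (2 * M')) with hcst
  have hcst0 : 0 ≤ cst := by positivity
  clear_value cst
  set β : ℝ := u * δ * ε / ((cst + 1) * (KF + 1)) with hβ
  have hβ0 : 0 < β := by positivity
  clear_value β
  obtain ⟨R, hRx, hR⟩ := far_sum (d := d) hσ.le hσ1 (l1 x) β hβ0
  have hfin : 2 * (C * ENNReal.ofReal (2 * Real.pi)) * (Nn.card * (ENNReal.ofReal (2 * M') * ENNReal.ofReal (KF * β / ε)))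
      ≤ ENNReal.ofReal u * ENNReal.ofReal δ := by
    have e1 : 2 * (C * ENNReal.ofReal (2 * Real.pi)) * (Nn.card * (ENNReal.ofReal (2 * M') * ENNReal.ofReal (KF * β / ε)))
      = ENNReal.ofReal (2 * (C * (2 * Real.pi)) * (Nn.card * ((2 * M') * (KF * β / ε)))) := by
      exact ofReal_aux C Nn.card _ _ _ (by positivity) (by positivity) (by positivity)
    rw [e1, ← ENNReal.ofReal_mul hu0.le]
    apply ENNReal.ofReal_le_ofReal
    have e2 : 2 * (C * (2 * Real.pi)) * (Nn.card * ((2 * M') * (KF * β / ε))) = cst * KF * (u * δ) / ((cst + 1) * (KF + 1)) := by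
      rw [hβ, hcst]; field_simp
    rw [e2, div_le_iff₀ (by positivity), mul_comm]
    refine mul_le_mul_of_nonneg_left ?_ (by positivity)
    nlinarith [NNReal.coe_nonneg KF]
  refine ⟨R, fun m hxm => ?_⟩
  obtain ⟨Z, hZ, hZ2⟩ := tail_m hgp hg C hC hP γ hγ KF hKF hKd σ hσ hσ1 ω lam W m ⟨x, hxm⟩ R hRx ε M M' u β hε0 hu0
    hM' (hR _) Nn hNn (ENNReal.ofReal δ) hfin
  refine ⟨Z, hZ, fun v hv hv1 E Ψ hE z hz ζ hζ => ?_⟩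
  classical
  set a : lay m → ℝ := fun n => 2 * Real.pi * ω * ((n:ℤ):ℝ) with ha
  set n0 : lay m := ⟨0, zero_mem_lay m⟩ with hn0
  set x' : sbox d m := ⟨x, hxm⟩ with hx'
  have ha0 : a n0 = 0 := by simp [ha, hn0]
  have hrowh : ∀ y : sbox d m, ∑ y' : sbox d m, |hst γ v y y'| ≤ C0 := fun y => hst_row γ (by linarith) _ v hv1 y
  have hwb : ∀ y : sbox d m, |lam / 2 * W y| ≤ Lc * (σ ^ l1 (y:Site d)) ^ 4 := fun y => by
    rw [abs_mul, abs_div, abs_two]; exact mul_le_mul_of_nonneg_left (hW y) hLc0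
  have hρ1 : ∀ y : sbox d m, (σ ^ l1 (y:Site d)) ^ 4 ≤ 1 := fun y => pow_le_one₀ (by positivity) (pow_le_one₀ hσ.le hσ1.le)
  have hrow0 := Kfl_row (fun y y' : sbox d m => hst γ v y y') (fun y => lam / 2 * W y) a (fun n n' : lay m => nbI n n') C0 Lc hrowh
      (fun y => (hwb y).trans (mul_le_of_le_one_right hLc0 (hρ1 y))) (fun _ _ => nbI_nonneg _ _) (nbI_sum' (lay m)) (x', n0)
  have h1 := eig_shift_le hE (x', n0) (a n0) c hrow0
  rw [ha0] at h1
  simp only [sub_zero] at h1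
  set G : Finset (sbox d m × lay m) := univ.filter fun k => |E k| ≤ M ∧ ∀ n : lay m, GoodE γ (sbox d m) x' σ R ε v (E k - a n) with hG
  have hbad : ∑ k ∈ Gᶜ, Ψ k (x', n0) ^ 2 ≤ u + u := by
    rw [← Finset.sum_filter_add_sum_filter_not Gᶜ (fun k => |E k| ≤ M)]
    refine add_le_add (hZ2 v hv hv1 E Ψ hE _ fun k hk => ?_) ?_
    · rw [Finset.mem_filter, Finset.mem_compl, hG, Finset.mem_filter] at hk
      refine ⟨hk.2, ?_⟩
      have h3 := hk.1
      by_contra hcon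
      push Not at hcon
      exact h3 ⟨Finset.mem_univ _, hk.2, hcon⟩
    · refine le_trans ?_ hM
      rw [le_div_iff₀ (by positivity), Finset.sum_mul]
      refine le_trans ?_ (le_trans h1 (by linarith : c ^ 2 ≤ 1 + c ^ 2))
      refine le_trans (Finset.sum_le_sum fun k hk => ?_) (Finset.sum_le_sum_of_subset_of_nonneg (Finset.subset_univ _) fun k _ _ => by positivity)
      rw [Finset.mem_filter, not_le] at hk
      refine mul_le_mul_of_nonneg_left ?_ (sq_nonneg _)
      rw [← sq_abs (E k)]
      exact pow_le_pow_left₀ hM0.le hk.2.le 2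
  have hη' : ∑ n ∈ (univ.filter fun n : lay m => (n:ℤ) ∈ S)ᶜ, (1 + a n ^ 2)⁻¹ ≤ η / (4 * C4) := by
    have e3 : ∑ n ∈ (univ.filter fun n : lay m => (n:ℤ) ∈ S)ᶜ, (1 + a n ^ 2)⁻¹
        = ∑ n ∈ (lay m).filter (fun n => n ∉ S), (1 + (2 * Real.pi * ω * (n:ℝ)) ^ 2)⁻¹ := by
      rw [Finset.compl_filter, Finset.sum_filter, Finset.sum_filter, ← Finset.sum_coe_sort (lay m)]
    rw [e3]
    refine (le_abs_self _).trans (hS _ ?_).le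
    rw [Finset.disjoint_left]
    intro n hn
    exact (Finset.mem_filter.1 hn).2
  have hmain := det_tail (fun y y' : sbox d m => hst γ v y y') (fun y => lam / 2 * W y) a (fun n n' : lay m => nbI n n')
    C0 c Lc D1 Sρ Sa (ε ^ 4) (η / (4 * C4)) (u + u) (fun y => (σ ^ l1 (y:Site d)) ^ 4) (fun y => by positivity) hρ1 x' n0 ha0
    (fun y y' => hst_symm _ _ _ _) hLc0 hc hrowh hwb (fun _ _ => nbI_nonneg _ _) (fun _ _ => nbI_symm _ _) (nbI_sum' (lay m))
    (fun y hy => hst_off γ v hσ hσ1 y x (fun h => hy (Subtype.ext h)))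
    (sub_sum_le (sbox d m) (fun y => (σ ^ l1 y) ^ 4) (fun y => by positivity) hsρ)
    (sub_sum_le (lay m) (fun n => (1 + (2 * Real.pi * ω * (n:ℝ)) ^ 2)⁻¹) (fun y => by positivity) hsa) (by positivity)
    hE G (univ.filter (fun y : sbox d m => R < l1 (y:Site d)))
    (fun k hk n w => (Finset.mem_filter.1 hk).2.2 n w) hbad z hz ζ hζ _ hη'
  refine hmain.trans ?_
  have hcard : (((univ.filter fun n : lay m => (n:ℤ) ∈ S).card : ℕ) : ℝ) ≤ S.card := by
    have : (univ.filter fun n : lay m => (n:ℤ) ∈ S).card ≤ S.card := 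
      Finset.card_le_card_of_injOn (fun n => (n:ℤ)) (fun n hn => (Finset.mem_filter.1 hn).2) (fun _ _ _ _ h => Subtype.ext h)
    exact_mod_cast this
  have hε' : (1 + c ^ 2) * (ε ^ 4 * (2 * D1 ^ 2 * Sρ * (2 * (1 + c ^ 2)) * Sa + 8 * Lc ^ 2 * Sρ * (2 * (1 + c ^ 2)) * Sa)) ≤ u := by
    rw [hC3] at hε; exact hε
  have hlast : 2 * (η / (4 * C4) * C4) = η / 2 := by field_simp; norm_num
  have hA : 0 ≤ (1 + c ^ 2) * (ε ^ 4 * (2 * D1 ^ 2 * Sρ * (2 * (1 + c ^ 2)) * Sa + 8 * Lc ^ 2 * Sρ * (2 * (1 + c ^ 2)) * Sa)) := by positivity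
  have hu1 : u * (24 * (S.card + 1)) = η := by rw [hu]; field_simp
  have h7 : (((univ.filter fun n : lay m => (n:ℤ) ∈ S).card : ℕ) : ℝ) * (2 * (u + u) + 2 * ((1 + c ^ 2) * (ε ^ 4 * (2 * D1 ^ 2 * Sρ * (2 * (1 + c ^ 2)) * Sa + 8 * Lc ^ 2 * Sρ * (2 * (1 + c ^ 2)) * Sa)))) ≤ S.card * (6 * u) :=
    mul_le_mul hcard (by linarith) (by linarith) (by positivity)
  have h8 : (S.card:ℝ) * (6 * u) ≤ η / 4 := card_aux _ _ _ hu0 hu1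
  rw [hlast]
  linarith

end

section

lemma gron (f f' : ℝ → ℝ) (hf : ∀ t, HasDerivAt f (f' t) t) (K ε T : ℝ)
    (hb : ∀ t, |t| ≤ T → |f' t| ≤ K * |f t| + ε) (t : ℝ) (ht : |t| ≤ T) :
    |f t| ≤ gronwallBound |f 0| K ε |t| := by
  rcases le_total 0 t with h | h
  · rw [abs_of_nonneg h] at ht ⊢
    have := norm_le_gronwallBound_of_norm_deriv_right_le (f := f) (f' := f') (δ := |f 0|) (K := K) (ε := ε) (a := 0) (b := T)
      (fun x _ => (hf x).continuousAt.continuousWithinAt) (fun x _ => (hf x).hasDerivWithinAt) le_rfl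
      (fun x hx => hb x (by rw [abs_of_nonneg hx.1]; exact hx.2.le)) t ⟨h, ht⟩
    simpa using this
  · rw [abs_of_nonpos h] at ht ⊢
    have hg : ∀ x, HasDerivAt (fun x => f (-x)) (-f' (-x)) x := fun x => by
      have := (hf (-x)).scomp x (hasDerivAt_neg x)
      simpa [Function.comp_def] using this
    have := norm_le_gronwallBound_of_norm_deriv_right_le (f := fun x => f (-x)) (f' := fun x => -f' (-x)) (δ := |f 0|) (K := K) (ε := ε) (a := 0) (b := T)
      (fun x _ => (hg x).continuousAt.continuousWithinAt) (fun x _ => (hg x).hasDerivWithinAt) (by simp)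
      (fun x hx => by
        have := hb (-x) (by rw [abs_neg, abs_of_nonneg hx.1]; exact hx.2.le)
        simpa using this) (-t) ⟨by linarith, ht⟩
    simpa using this

lemma weighted_growth {I : Type*} [Fintype I] [DecidableEq I] (K : Matrix I I ℝ)
    (hK : ∀ p q, K p q = K q p) (D : I → ℝ) (s : I → ℝ) (hs : ∀ p, 0 ≤ s p)
    (hnb : ∀ p q, p ≠ q → K p q ≠ 0 → s p ≤ 4 * s q) (c : ℝ)
    (hrow : ∀ p, ∑ q, |K p q - if p = q then D p else 0| ≤ c)
    (a : ℝ → I → ℂ) (ha : ∀ t p, HasDerivAt (fun t => a t p) (-Complex.I * ∑ q, (K p q : ℂ) * a t q) t) (t : ℝ) :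
    ∑ p, (s p) ^ 2 * ‖a t p‖ ^ 2 ≤ (∑ p, (s p) ^ 2 * ‖a 0 p‖ ^ 2) * Real.exp (8 * c * |t|) := by
  have hd : ∀ t, HasDerivAt (fun t => ∑ p, (s p) ^ 2 * ‖a t p‖ ^ 2)
      (∑ p, (s p) ^ 2 * (2 * inner ℝ (a t p) (-Complex.I * ∑ q, (K p q : ℂ) * a t q))) t := by
    intro t
    exact HasDerivAt.fun_sum fun p _ => ((ha t p).norm_sq).const_mul _
  have hpos : ∀ t, 0 ≤ ∑ p, (s p) ^ 2 * ‖a t p‖ ^ 2 := fun t => Finset.sum_nonneg fun p _ => by positivity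
  set J : I → I → ℝ := fun p q => K p q - if p = q then D p else 0 with hJ
  have hJs : ∀ p q, J p q = J q p := fun p q => by
    simp only [hJ]; rw [hK p q]
    by_cases h : p = q
    · subst h; rfl
    · simp [h, Ne.symm h]
  have hsJ : ∀ p q, |J p q| * s p ≤ |J p q| * (4 * s q) := fun p q => by
    by_cases h : p = q
    · subst h; exact mul_le_mul_of_nonneg_left (by linarith [hs p]) (abs_nonneg _)
    · by_cases h0 : K p q = 0
      · simp [hJ, h, h0]
      · exact mul_le_mul_of_nonneg_left (hnb p q h h0) (abs_nonneg _)
  have hterm : ∀ t p, |inner ℝ (a t p) (-Complex.I * ∑ q, (K p q : ℂ) * a t q)| ≤ ∑ q, |J p q| * (‖a t p‖ * ‖a t q‖) := by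
    intro t p
    have e1 : ∑ q, (K p q : ℂ) * a t q = ∑ q, (J p q : ℂ) * a t q + (D p : ℂ) * a t p := by
      have : ∀ q, (K p q : ℂ) * a t q = (J p q : ℂ) * a t q + if p = q then (D p : ℂ) * a t q else 0 := fun q => by
        simp only [hJ]; split_ifs <;> push_cast <;> ring
      rw [Finset.sum_congr rfl fun q _ => this q, Finset.sum_add_distrib, Finset.sum_ite_eq]
      simp
    have e2 : inner ℝ (a t p) (-Complex.I * ((D p : ℂ) * a t p)) = 0 := by
      rw [Complex.inner]
      simp; ring
    rw [e1, mul_add, inner_add_right, e2, add_zero]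
    refine (abs_real_inner_le_norm _ _).trans ?_
    rw [norm_mul, norm_neg, Complex.norm_I, one_mul]
    refine (mul_le_mul_of_nonneg_left (norm_sum_le _ _) (norm_nonneg _)).trans ?_
    rw [Finset.mul_sum]
    refine Finset.sum_le_sum fun q _ => ?_
    rw [norm_mul, Complex.norm_real, Real.norm_eq_abs]
    exact le_of_eq (by ring)
  have hbd : ∀ t, |∑ p, (s p) ^ 2 * (2 * inner ℝ (a t p) (-Complex.I * ∑ q, (K p q : ℂ) * a t q))|
      ≤ 8 * c * |∑ p, (s p) ^ 2 * ‖a t p‖ ^ 2| + 0 := by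
    intro t
    rw [abs_of_nonneg (hpos t), add_zero]
    refine (Finset.abs_sum_le_sum_abs _ _).trans ?_
    have h1 : ∀ p, |(s p) ^ 2 * (2 * inner ℝ (a t p) (-Complex.I * ∑ q, (K p q : ℂ) * a t q))|
        ≤ ∑ q, (4 * (|J p q| * ((s p) ^ 2 * ‖a t p‖ ^ 2)) + 4 * (|J q p| * ((s q) ^ 2 * ‖a t q‖ ^ 2))) := by
      intro p
      rw [abs_mul, abs_mul, abs_two, abs_of_nonneg (by positivity : 0 ≤ (s p) ^ 2)]
      have := mul_le_mul_of_nonneg_left (hterm t p) (by positivity : 0 ≤ 2 * (s p) ^ 2)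
      refine (le_of_eq (by ring)).trans (this.trans ?_)
      rw [Finset.mul_sum]
      refine Finset.sum_le_sum fun q _ => ?_
      have h2 := mul_le_mul_of_nonneg_left (hsJ p q) (by have := hs p; positivity : 0 ≤ 2 * s p * ‖a t p‖ * ‖a t q‖)
      refine (le_of_eq (by ring)).trans (h2.trans ?_)
      rw [← hJs p q]
      have h3 := mul_nonneg (abs_nonneg (J p q)) (sq_nonneg (s p * ‖a t p‖ - s q * ‖a t q‖))
      nlinarith
    refine (Finset.sum_le_sum fun p _ => h1 p).trans ?_
    simp only [Finset.sum_add_distrib]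
    rw [Finset.sum_comm (f := fun p q => 4 * (|J q p| * ((s q) ^ 2 * ‖a t q‖ ^ 2)))]
    rw [← two_mul, Finset.mul_sum, Finset.mul_sum]
    refine Finset.sum_le_sum fun p _ => ?_
    rw [← Finset.mul_sum, ← Finset.sum_mul]
    have := mul_le_mul_of_nonneg_right (hrow p) (by positivity : 0 ≤ (s p) ^ 2 * ‖a t p‖ ^ 2)
    linarith
  have := gron _ _ hd (8 * c) 0 |t| (fun t _ => hbd t) t le_rfl
  rw [gronwallBound_ε0, abs_of_nonneg (hpos t), abs_of_nonneg (hpos 0)] at this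
  exact this

/-- finite-dimensional evolution -/
def aev {I : Type*} [Fintype I] (E : I → ℝ) (Ψ : I → I → ℝ) (p0 : I) (t : ℝ) (p : I) : ℂ :=
  ∑ k, Complex.exp (-Complex.I * t * E k) * Ψ k p0 * (Ψ k p : ℂ)

lemma aev_deriv {I : Type*} [Fintype I] [DecidableEq I] {K : Matrix I I ℝ} {E : I → ℝ} {Ψ : I → I → ℝ}
    (h : IsEig K E Ψ) (p0 : I) (t : ℝ) (p : I) :
    HasDerivAt (fun t => aev E Ψ p0 t p) (-Complex.I * ∑ q, (K p q : ℂ) * aev E Ψ p0 t q) t := by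
  have h1 : ∀ k, HasDerivAt (fun t : ℝ => Complex.exp (-Complex.I * t * E k) * Ψ k p0 * (Ψ k p : ℂ))
      (Complex.exp (-Complex.I * t * E k) * (-Complex.I * 1 * E k) * Ψ k p0 * (Ψ k p : ℂ)) t := fun k =>
    ((((Complex.ofRealCLM.hasDerivAt (x := t)).const_mul (-Complex.I)).mul_const (E k : ℂ)).cexp.mul_const _).mul_const _
  have h2 := HasDerivAt.fun_sum (u := univ) fun k _ => h1 k
  have h4 : HasDerivAt (fun t => aev E Ψ p0 t p) _ t := h2
  refine h4.congr_deriv (Eq.symm ?_)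
  unfold aev
  simp only [Finset.mul_sum]
  rw [Finset.sum_comm]
  refine Finset.sum_congr rfl fun k _ => ?_
  have h3 : ((∑ q, K p q * Ψ k q : ℝ) : ℂ) = ((E k * Ψ k p : ℝ) : ℂ) := by rw [h.eig k p]
  push_cast at h3
  calc _ = -Complex.I * Complex.exp (-Complex.I * t * E k) * Ψ k p0 * ∑ q, (K p q : ℂ) * Ψ k q := by
        rw [Finset.mul_sum]; exact Finset.sum_congr rfl fun q _ => by ring
    _ = _ := by rw [h3]; ring

lemma aev_zero {I : Type*} [Fintype I] [DecidableEq I] {K : Matrix I I ℝ} {E : I → ℝ} {Ψ : I → I → ℝ}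
    (h : IsEig K E Ψ) (p0 : I) (p : I) : aev E Ψ p0 0 p = if p0 = p then 1 else 0 := by
  unfold aev
  have h3 : ((∑ k, Ψ k p0 * Ψ k p : ℝ) : ℂ) = ((if p0 = p then 1 else 0 : ℝ) : ℂ) := by rw [h.comp p0 p]
  have h4 : ((if p0 = p then 1 else 0 : ℝ) : ℂ) = if p0 = p then 1 else 0 := by split_ifs <;> simp
  rw [h4] at h3
  rw [← h3]
  simp

end

section

/-- the Hilbert space -/
abbrev L2 (d : ℕ) := lp (fun _ : Site d => ℂ) 2

lemma l2_summable {d : ℕ} (ψ : L2 d) : Summable fun i => ‖ψ i‖ ^ 2 := by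
  have := (lp.memℓp ψ).summable (by norm_num)
  simpa using this

lemma l2_norm {d : ℕ} (ψ : L2 d) : ‖ψ‖ ^ 2 = ∑' i, ‖ψ i‖ ^ 2 := by
  have := lp.norm_rpow_eq_tsum (p := 2) (by norm_num) ψ
  simpa using this

lemma summable_shift {d : ℕ} (f : Site d → ℝ) (h : Summable f) (u : Site d) : Summable fun i => f (i + u) :=
  (Equiv.addRight u).summable_iff.2 h

lemma hasSum_shift {d : ℕ} (f : Site d → ℝ) (a : ℝ) (h : HasSum f a) (u : Site d) : HasSum (fun i => f (i - u)) a :=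
  (Equiv.subRight u).hasSum_iff.2 h

lemma ham_symm {d : ℕ} (H : L2 d →L[ℂ] L2 d) (c : Site d → ℝ)
    (hH : ∀ (ψ : L2 d) (i : Site d), (H ψ) i = (∑ k, (ψ (i + unitVec k) + ψ (i - unitVec k))) + (c i : ℂ) * ψ i)
    (ψ : L2 d) : (inner ℂ ψ (H ψ)).im = 0 := by
  set F : Fin d → Site d → ℝ := fun k i => ((starRingEnd ℂ) (ψ i) * ψ (i + unitVec k)).im with hF
  have hFs : ∀ k, Summable (F k) := by
    intro k
    have h1 := l2_summable ψ
    have h2 : Summable fun i => ‖ψ (i + unitVec k)‖ ^ 2 :=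
      summable_shift (fun i => ‖ψ i‖ ^ 2) h1 (unitVec k)
    refine Summable.of_norm_bounded (h1.add h2) fun i => ?_
    rw [Real.norm_eq_abs]
    refine (Complex.abs_im_le_norm _).trans ?_
    rw [norm_mul, RCLike.norm_conj]
    nlinarith [sq_nonneg (‖ψ i‖ - ‖ψ (i + unitVec k)‖), sq_nonneg (‖ψ i‖ ), sq_nonneg (‖ψ (i + unitVec k)‖)]
  have h3 : ∀ k, HasSum (fun i => F k i - F k (i - unitVec k)) 0 := fun k => by
    have h4 := (hFs k).hasSum
    have := h4.sub (hasSum_shift (F k) _ h4 (unitVec k))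
    rwa [sub_self] at this
  have h6 : HasSum (fun i => ∑ k, (F k i - F k (i - unitVec k))) 0 := by
    simpa using hasSum_sum (s := univ) fun k _ => h3 k
  have h7 := Complex.hasSum_im (lp.hasSum_inner (𝕜 := ℂ) ψ (H ψ))
  refine h7.unique ?_
  convert h6 using 2 with i
  rw [hH, RCLike.inner_apply', mul_add, Complex.add_im, Finset.mul_sum, Complex.im_sum]
  have : ((starRingEnd ℂ) (ψ i) * ((c i : ℂ) * ψ i)).im = 0 := by
    simp; ring
  rw [this, add_zero]
  refine Finset.sum_congr rfl fun k _ => ?_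
  simp only [hF, sub_add_cancel]
  simp
  ring

lemma norm_deriv {d : ℕ} (e : ℝ → L2 d) (e' : L2 d) (t : ℝ) (h : HasDerivAt e e' t) :
    HasDerivAt (fun t => ‖e t‖ ^ 2) (2 * (inner ℂ (e t) e').re) t := by
  have h1 := h.inner ℂ h
  have h2 := Complex.reCLM.hasFDerivAt.comp_hasDerivAt t h1
  have h3 : (fun t => ‖e t‖ ^ 2) = (Complex.reCLM ∘ fun t => inner ℂ (e t) (e t)) := by
    ext t
    simp only [Function.comp, Complex.reCLM_apply]
    rw [inner_self_eq_norm_sq_to_K]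
    norm_cast
  rw [h3]
  refine h2.congr_deriv ?_
  rw [map_add, Complex.reCLM_apply, Complex.reCLM_apply, ← inner_conj_symm e' (e t), Complex.conj_re]
  ring

lemma re_inner_ham {d : ℕ} (ψ φ : L2 d) (h : (inner ℂ ψ φ).im = 0) :
    (inner ℂ ψ ((-Complex.I) • φ)).re = 0 := by
  rw [inner_smul_right]; simp [h]

/-- energy estimate -/
lemma energy {d : ℕ} (H : ℝ → L2 d →L[ℂ] L2 d) (hH : ∀ t ψ, (inner ℂ ψ (H t ψ)).im = 0)
    (e : ℝ → L2 d) (ρ : ℝ → L2 d) (he : ∀ t, HasDerivAt e ((-Complex.I) • H t (e t) + ρ t) t) (h0 : e 0 = 0)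
    (r T : ℝ) (hρ : ∀ t, |t| ≤ T → ‖ρ t‖ ≤ r) (t : ℝ) (ht : |t| ≤ T) :
    ‖e t‖ ^ 2 ≤ gronwallBound 0 1 (r ^ 2) |t| := by
  have := gron (fun t => ‖e t‖ ^ 2) _ (fun t => norm_deriv e _ t (he t)) 1 (r ^ 2) T (fun t ht => ?_) t ht
  · simpa [h0] using this
  · rw [inner_add_right, Complex.add_re, re_inner_ham _ _ (hH _ _), zero_add, abs_mul, abs_two, one_mul,
      abs_of_nonneg (sq_nonneg ‖e t‖)]
    have h1 := (Complex.abs_re_le_norm _).trans (norm_inner_le_norm (𝕜 := ℂ) (e t) (ρ t))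
    have h2 := hρ t ht
    nlinarith [norm_nonneg (e t), norm_nonneg (ρ t), sq_nonneg (‖e t‖ - ‖ρ t‖)]

lemma norm_cons {d : ℕ} (H : ℝ → L2 d →L[ℂ] L2 d) (hH : ∀ t ψ, (inner ℂ ψ (H t ψ)).im = 0)
    (e : ℝ → L2 d) (he : ∀ t, HasDerivAt e ((-Complex.I) • H t (e t)) t) (t : ℝ) : ‖e t‖ = ‖e 0‖ := by
  have h1 : ∀ t, HasDerivAt (fun t => ‖e t‖ ^ 2) 0 t := fun t => by
    have := norm_deriv e _ t (he t)
    rwa [re_inner_ham _ _ (hH _ _), mul_zero] at this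
  have h2 := is_const_of_deriv_eq_zero (f := fun t => ‖e t‖ ^ 2) (fun t => (h1 t).differentiableAt) (fun t => (h1 t).deriv) t 0
  exact (sq_eq_sq₀ (norm_nonneg _) (norm_nonneg _)).1 h2

end

section

/-- site basis -/
def dl {d : ℕ} (y : Site d) : L2 d := lp.single 2 y (1:ℂ)

lemma dl_apply {d : ℕ} (y i : Site d) : (dl y : L2 d) i = if i = y then 1 else 0 := by
  unfold dl
  rw [lp.single_apply, Pi.single_apply]

lemma dl_norm {d : ℕ} (y : Site d) : ‖(dl y : L2 d)‖ = 1 := by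
  unfold dl
  rw [lp.norm_single (by norm_num)]; simp

/-- layer phases -/
def ph (ω θ t : ℝ) (n : ℤ) : ℂ := Complex.exp (2 * Real.pi * Complex.I * n * (ω * t + θ))

lemma ph_norm (ω θ t : ℝ) (n : ℤ) : ‖ph ω θ t n‖ = 1 := by
  unfold ph
  have : (2 * Real.pi * Complex.I * n * (ω * t + θ) : ℂ) = ((2 * Real.pi * n * (ω * t + θ) : ℝ) : ℂ) * Complex.I := by
    push_cast; ring
  rw [this, Complex.norm_exp_ofReal_mul_I]

lemma ph_deriv (ω θ t : ℝ) (n : ℤ) :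
    HasDerivAt (fun t => ph ω θ t n) (ph ω θ t n * (Complex.I * ((2 * Real.pi * ω * n : ℝ) : ℂ))) t := by
  have h := ((((Complex.ofRealCLM.hasDerivAt (x := t)).const_mul (ω:ℂ)).add_const (θ:ℂ)).const_mul (2 * Real.pi * Complex.I * n : ℂ)).cexp
  have h4 : HasDerivAt (fun t => ph ω θ t n) _ t := h
  refine h4.congr_deriv ?_
  unfold ph
  simp only [Complex.ofRealCLM_apply]
  push_cast
  simp
  ring

lemma ph_cos (ω θ t : ℝ) (n : ℤ) :
    ph ω θ t (n + 1) + ph ω θ t (n - 1) = 2 * (Real.cos (2 * Real.pi * (ω * t + θ)) : ℂ) * ph ω θ t n := by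
  unfold ph
  rw [Complex.ofReal_cos, Complex.two_cos, add_mul, ← Complex.exp_add, ← Complex.exp_add]
  congr 2 <;> · push_cast; ring

lemma alg_deriv {I V : Type*} [Fintype I] [AddCommGroup V] [Module ℂ V] (K : I → I → ℂ) (a e w : I → ℂ) (D : I → V) (H : V →ₗ[ℂ] V) :
    ∑ p, ((-Complex.I * ∑ q, K p q * a q) * e p + a p * (e p * (Complex.I * w p))) • D p
      = (-Complex.I) • H (∑ p, (a p * e p) • D p)
        + ∑ q, (Complex.I * a q) • (e q • H (D q) + (w q * e q) • D q - ∑ p, (K p q * e p) • D p) := by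
  simp only [map_sum, map_smul, smul_sub, smul_add, Finset.sum_sub_distrib, Finset.sum_add_distrib, Finset.smul_sum, smul_smul, add_smul]
  rw [Finset.sum_comm (f := fun x x_1 => (Complex.I * a x * (K x_1 x * e x_1)) • D x_1)]
  have h1 : ∑ p, ((-Complex.I * ∑ q, K p q * a q) * e p) • D p = -∑ y, ∑ x, (Complex.I * a x * (K y x * e y)) • D y := by
    rw [← Finset.sum_neg_distrib]
    refine Finset.sum_congr rfl fun p _ => ?_
    rw [← Finset.sum_smul, ← neg_smul]
    congr 1
    rw [Finset.mul_sum, Finset.sum_mul, ← Finset.sum_neg_distrib]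
    exact Finset.sum_congr rfl fun q _ => by ring
  have h2 : ∑ p, (a p * (e p * (Complex.I * w p))) • D p = ∑ p, (Complex.I * a p * (w p * e p)) • D p :=
    Finset.sum_congr rfl fun p _ => by congr 1; ring
  have h3 : ∑ x, (-Complex.I * (a x * e x)) • H (D x) = - ∑ x, (Complex.I * a x * e x) • H (D x) := by
    rw [← Finset.sum_neg_distrib]
    refine Finset.sum_congr rfl fun p _ => ?_
    rw [← neg_smul]; congr 1; ring
  rw [h1, h2, h3]
  abel

lemma ham_dl {d : ℕ} (H : L2 d →L[ℂ] L2 d) (c : Site d → ℝ)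
    (hH : ∀ (ψ : L2 d) (i : Site d), (H ψ) i = (∑ k, (ψ (i + unitVec k) + ψ (i - unitVec k))) + (c i : ℂ) * ψ i)
    (y : Site d) : H (dl y) = ∑ k, (dl (y + unitVec k) + dl (y - unitVec k)) + (c y : ℂ) • dl y := by
  ext i
  rw [hH, lp.coeFn_add, Pi.add_apply, lp.coeFn_smul, Pi.smul_apply, lp.coeFn_sum, Finset.sum_apply]
  congr 1
  · refine Finset.sum_congr rfl fun k _ => ?_
    rw [lp.coeFn_add, Pi.add_apply, dl_apply, dl_apply, dl_apply, dl_apply, add_comm]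
    simp only [sub_eq_iff_eq_add, eq_sub_iff_add_eq]
  · rw [dl_apply]
    split_ifs with h
    · rw [h]; simp
    · simp

lemma hop_dl {d : ℕ} (L : Finset (Site d)) (y : Site d) :
    ∑ i ∈ L, (hop i y : ℂ) • (dl i : L2 d) = ∑ k, ((if y + unitVec k ∈ L then dl (y + unitVec k) else 0)
      + (if y - unitVec k ∈ L then dl (y - unitVec k) else 0)) := by
  have h1 : ∀ i, (hop i y : ℂ) • (dl i : L2 d) = ∑ k, ((if i = y + unitVec k then dl i else 0) + (if i = y - unitVec k then dl i else 0)) := by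
    intro i
    rw [hop_symm]
    unfold hop
    push_cast
    rw [Finset.sum_smul]
    refine Finset.sum_congr rfl fun k _ => ?_
    rw [add_smul]
    congr 1
    · split_ifs <;> simp
    · split_ifs <;> simp
  rw [Finset.sum_congr rfl fun i _ => h1 i, Finset.sum_comm]
  refine Finset.sum_congr rfl fun k _ => ?_
  rw [Finset.sum_add_distrib, Finset.sum_ite_eq', Finset.sum_ite_eq']

/-- residual vectors -/
lemma res_eq {d : ℕ} (γ ω lam θ t : ℝ) (W : Site d → ℝ) (m : ℕ) (v : Site d → ℝ) (H : L2 d →L[ℂ] L2 d)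
    (hH : ∀ (ψ : L2 d) (i : Site d), (H ψ) i = (∑ k, (ψ (i + unitVec k) + ψ (i - unitVec k))) +
      ((γ * v i + lam * Real.cos (2 * Real.pi * (ω * t + θ)) * W i : ℝ) : ℂ) * ψ i) (q : sbox d m × lay m) :
    ph ω θ t q.2 • H (dl q.1) + (((2 * Real.pi * ω * ((q.2:ℤ):ℝ) : ℝ) : ℂ) * ph ω θ t q.2) • dl (q.1 : Site d)
      - ∑ p, ((Kc γ ω lam W m v p q : ℂ) * ph ω θ t p.2) • dl (p.1 : Site d)
    = ph ω θ t q.2 • ∑ k, ((if (q.1:Site d) + unitVec k ∈ sbox d m then 0 else dl ((q.1:Site d) + unitVec k))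
      + (if (q.1:Site d) - unitVec k ∈ sbox d m then 0 else dl ((q.1:Site d) - unitVec k)))
      + (((lam / 2 * W q.1 : ℝ) : ℂ) * ((if (q.2:ℤ) + 1 ∈ lay m then 0 else ph ω θ t (q.2 + 1))
        + (if (q.2:ℤ) - 1 ∈ lay m then 0 else ph ω θ t (q.2 - 1)))) • dl (q.1 : Site d) := by
  obtain ⟨y, n⟩ := q
  have hsum : ∑ p, ((Kc γ ω lam W m v p (y, n) : ℂ) * ph ω θ t p.2) • dl (p.1 : Site d)
      = ph ω θ t n • (∑ i ∈ sbox d m, (hop i (y:Site d) : ℂ) • dl i + ((γ * v y : ℝ) : ℂ) • dl (y:Site d))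
        + (((lam / 2 * W y : ℝ) : ℂ) * ∑ n' ∈ lay m, (nbI n n' : ℂ) * ph ω θ t n') • dl (y:Site d)
        + (((2 * Real.pi * ω * ((n:ℤ):ℝ) : ℝ) : ℂ) * ph ω θ t n) • dl (y : Site d) := by
    have h1 : ∀ p : sbox d m × lay m, ((Kc γ ω lam W m v p (y, n) : ℂ) * ph ω θ t p.2) • dl (p.1 : Site d)
        = (if p.2 = n then ((hst γ v p.1 y : ℂ) * ph ω θ t n) • dl (p.1 : Site d) else 0)
          + (if p.1 = y then ((((lam / 2 * W y : ℝ) : ℂ) * ((nbI n p.2 : ℂ) * ph ω θ t p.2)) • dl (y : Site d)) else 0)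
          + (if p = (y, n) then (((2 * Real.pi * ω * ((n:ℤ):ℝ) : ℝ) : ℂ) * ph ω θ t n) • dl (y : Site d) else 0) := by
      rintro ⟨i, n'⟩
      unfold Kc Kfl
      rw [nbI_symm n n']
      simp only [Complex.ofReal_add, add_mul, add_smul]
      congr 1
      · congr 1
        · by_cases h : n' = n
          · subst h; simp
          · simp [h]
        · by_cases h : i = y
          · subst h; simp [mul_assoc]
          · simp [h]
      · by_cases h : (i, n') = (y, n)
        · obtain ⟨rfl, rfl⟩ := Prod.mk.inj h
          simp
        · simp only [if_neg h]; simp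
    rw [Finset.sum_congr rfl fun p _ => h1 p, Finset.sum_add_distrib, Finset.sum_add_distrib, Finset.sum_ite_eq',
      Fintype.sum_prod_type, Fintype.sum_prod_type]
    simp only [Finset.sum_ite_eq', Finset.mem_univ, if_true]
    congr 1
    congr 1
    · have h2 : ∀ i : sbox d m, ((hst γ v i y : ℂ) * ph ω θ t n) • dl (i : Site d)
          = ph ω θ t n • ((hop (i:Site d) (y:Site d) : ℂ) • dl (i : Site d) + if i = y then ((γ * v y : ℝ) : ℂ) • dl (y:Site d) else 0) := by
        intro i
        unfold hst
        by_cases h : i = y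
        · subst h; simp only [if_true]; push_cast; module
        · have h' : (i:Site d) ≠ y := fun hh => h (Subtype.ext hh)
          simp only [if_neg h, if_neg h', add_zero]; module
      rw [Finset.sum_congr rfl fun p _ => h2 p, ← Finset.smul_sum, Finset.sum_add_distrib, Finset.sum_ite_eq',
        Finset.sum_coe_sort (sbox d m) (fun i => (hop i (y:Site d) : ℂ) • dl i)]
      simp
    · rw [Finset.sum_comm]
      simp only [Finset.sum_ite_eq', Finset.mem_univ, if_true]
      rw [← Finset.sum_smul, ← Finset.mul_sum, Finset.sum_coe_sort (lay m) (fun n' => (nbI n n' : ℂ) * ph ω θ t n')]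
  have hnb : ∑ n' ∈ lay m, (nbI n n' : ℂ) * ph ω θ t n' = (if (n:ℤ) + 1 ∈ lay m then ph ω θ t (n + 1) else 0)
        + (if (n:ℤ) - 1 ∈ lay m then ph ω θ t (n - 1) else 0) := by
    have : ∀ n', (nbI n n' : ℂ) * ph ω θ t n' = (if n' = (n:ℤ) + 1 then ph ω θ t n' else 0) + (if n' = (n:ℤ) - 1 then ph ω θ t n' else 0) := by
      intro n'
      unfold nbI; push_cast
      rw [add_mul]
      congr 1 <;> · split_ifs <;> simp
    rw [Finset.sum_congr rfl fun i _ => this i, Finset.sum_add_distrib, Finset.sum_ite_eq', Finset.sum_ite_eq']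
  rw [hsum, hnb, hop_dl, ham_dl H _ hH]
  have hA : ∑ k, (dl ((y:Site d) + unitVec k) + dl ((y:Site d) - unitVec k))
    = ∑ k, ((if (y:Site d) + unitVec k ∈ sbox d m then dl ((y:Site d) + unitVec k) else 0)
      + (if (y:Site d) - unitVec k ∈ sbox d m then dl ((y:Site d) - unitVec k) else 0)) +
     ∑ k, ((if (y:Site d) + unitVec k ∈ sbox d m then 0 else dl ((y:Site d) + unitVec k))
      + (if (y:Site d) - unitVec k ∈ sbox d m then 0 else dl ((y:Site d) - unitVec k))) := by
    rw [← Finset.sum_add_distrib]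
    refine Finset.sum_congr rfl fun k _ => ?_
    split_ifs <;> abel
  have hB : (if (n:ℤ) + 1 ∈ lay m then ph ω θ t (n + 1) else 0)
        + (if (n:ℤ) - 1 ∈ lay m then ph ω θ t (n - 1) else 0) = 2 * (Real.cos (2 * Real.pi * (ω * t + θ)) : ℂ) * ph ω θ t n
      - ((if (n:ℤ) + 1 ∈ lay m then 0 else ph ω θ t (n + 1))
        + (if (n:ℤ) - 1 ∈ lay m then 0 else ph ω θ t (n - 1))) := by
    rw [← ph_cos]
    split_ifs <;> ring
  rw [hA, hB]
  module

end

section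

lemma res_norm {d : ℕ} (ω lam θ t : ℝ) (W : Site d → ℝ) (hW : ∀ y, |W y| ≤ 1) (m : ℕ) (y : Site d) (n : ℤ) :
    ‖ph ω θ t n • ∑ k, ((if y + unitVec k ∈ sbox d m then 0 else dl (y + unitVec k))
      + (if y - unitVec k ∈ sbox d m then 0 else dl (y - unitVec k)))
      + (((lam / 2 * W y : ℝ) : ℂ) * ((if n + 1 ∈ lay m then 0 else ph ω θ t (n + 1))
        + (if n - 1 ∈ lay m then 0 else ph ω θ t (n - 1)))) • (dl y : L2 d)‖
      ≤ (2 * d + |lam|) * (if l1 y + n.natAbs < m then 0 else 1) := by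
  by_cases h : l1 y + n.natAbs < m
  · rw [if_pos h]
    have h1 : ∀ k, y + unitVec k ∈ sbox d m := fun k => mem_sbox _ (by
      have := l1_add_le y (unitVec k); rw [l1_unitVec] at this; omega)
    have h2 : ∀ k, y - unitVec k ∈ sbox d m := fun k => mem_sbox _ (by
      have := l1_add_le y (-unitVec k); rw [l1_neg, l1_unitVec, ← sub_eq_add_neg] at this; omega)
    have h3 : n + 1 ∈ lay m := by rw [lay, Finset.mem_Icc]; omega
    have h4 : n - 1 ∈ lay m := by rw [lay, Finset.mem_Icc]; omega
    simp [h1, h2, h3, h4]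
  · rw [if_neg h, mul_one]
    have hz : ∀ (Q : Prop) [Decidable Q] (z : Site d), ‖(if Q then 0 else dl z : L2 d)‖ ≤ 1 := fun Q _ z => by
      split_ifs
      · simp
      · rw [dl_norm]
    have hp : ∀ (Q : Prop) [Decidable Q] (n : ℤ), ‖(if Q then 0 else ph ω θ t n : ℂ)‖ ≤ 1 := fun Q _ z => by
      split_ifs
      · simp
      · rw [ph_norm]
    refine (norm_add_le _ _).trans (add_le_add ?_ ?_)
    · rw [norm_smul, ph_norm, one_mul]
      refine (norm_sum_le _ _).trans ?_
      calc _ ≤ ∑ _k : Fin d, (2:ℝ) := Finset.sum_le_sum fun k _ => (norm_add_le _ _).trans (by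
            have := hz (y + unitVec k ∈ sbox d m) (y + unitVec k)
            have := hz (y - unitVec k ∈ sbox d m) (y - unitVec k)
            linarith)
        _ = _ := by simp; ring
    · rw [norm_smul, dl_norm, mul_one, norm_mul, Complex.norm_real, Real.norm_eq_abs, abs_mul, abs_div, abs_two]
      have h1 := (norm_add_le (if n + 1 ∈ lay m then 0 else ph ω θ t (n + 1)) (if n - 1 ∈ lay m then 0 else ph ω θ t (n - 1))).trans
        (add_le_add (hp _ _) (hp _ _))
      have h2 := hW y
      calc _ ≤ |lam| / 2 * 1 * (1 + 1) :=
            mul_le_mul (mul_le_mul_of_nonneg_left h2 (by positivity)) h1 (norm_nonneg _) (by positivity)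
        _ = _ := by ring

/-- the approximating solution -/
def Psi {d : ℕ} (ω θ : ℝ) (m : ℕ) (E : sbox d m × lay m → ℝ) (Ψ : sbox d m × lay m → sbox d m × lay m → ℝ)
    (p0 : sbox d m × lay m) (t : ℝ) : L2 d :=
  ∑ p, (aev E Ψ p0 t p * ph ω θ t p.2) • dl (p.1 : Site d)

lemma Psi_apply {d : ℕ} (ω θ : ℝ) (m : ℕ) (E : sbox d m × lay m → ℝ) (Ψ : sbox d m × lay m → sbox d m × lay m → ℝ)
    (p0 : sbox d m × lay m) (t : ℝ) (y : sbox d m) :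
    (Psi ω θ m E Ψ p0 t) y = ∑ n : lay m, ph ω θ t n * aev E Ψ p0 t (y, n) := by
  unfold Psi
  rw [lp.coeFn_sum, Finset.sum_apply, Fintype.sum_prod_type, Finset.sum_comm]
  refine Finset.sum_congr rfl fun n _ => ?_
  rw [Finset.sum_eq_single y]
  · rw [lp.coeFn_smul, Pi.smul_apply, dl_apply, if_pos rfl]; simp [mul_comm]
  · intro z _ hz
    rw [lp.coeFn_smul, Pi.smul_apply, dl_apply, if_neg (fun h => hz (Subtype.ext h.symm))]; simp
  · simp

lemma Psi_zero {d : ℕ} (ω θ : ℝ) (m : ℕ) {K : Matrix (sbox d m × lay m) (sbox d m × lay m) ℝ} (E : sbox d m × lay m → ℝ) (Ψ : sbox d m × lay m → sbox d m × lay m → ℝ)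
    (hE : IsEig K E Ψ) (y : sbox d m) : Psi ω θ m E Ψ (y, ⟨0, zero_mem_lay m⟩) 0 = dl (y:Site d) := by
  unfold Psi
  rw [Finset.sum_eq_single (y, ⟨0, zero_mem_lay m⟩)]
  · rw [aev_zero hE, if_pos rfl]; simp [ph]
  · intro p _ hp
    rw [aev_zero hE, if_neg hp.symm]; simp
  · simp

lemma Psi_deriv {d : ℕ} (γ ω lam θ : ℝ) (W : Site d → ℝ) (m : ℕ) (v : Site d → ℝ) (E : sbox d m × lay m → ℝ)
    (Ψ : sbox d m × lay m → sbox d m × lay m → ℝ) (hE : IsEig (Kc γ ω lam W m v) E Ψ) (p0) (t : ℝ) (H : L2 d →L[ℂ] L2 d) :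
    HasDerivAt (Psi ω θ m E Ψ p0) ((-Complex.I) • H (Psi ω θ m E Ψ p0 t) +
      ∑ q, (Complex.I * aev E Ψ p0 t q) • (ph ω θ t q.2 • H (dl q.1) + (((2 * Real.pi * ω * ((q.2:ℤ):ℝ) : ℝ) : ℂ) * ph ω θ t q.2) • dl (q.1 : Site d)
      - ∑ p, ((Kc γ ω lam W m v p q : ℂ) * ph ω θ t p.2) • dl (p.1 : Site d))) t := by
  have h1 : HasDerivAt (Psi ω θ m E Ψ p0) (∑ p, ((-Complex.I * ∑ q, (Kc γ ω lam W m v p q : ℂ) * aev E Ψ p0 t q) * ph ω θ t p.2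
      + aev E Ψ p0 t p * (ph ω θ t p.2 * (Complex.I * ((2 * Real.pi * ω * ((p.2:ℤ):ℝ) : ℝ) : ℂ)))) • dl (p.1 : Site d)) t := by
    unfold Psi
    exact HasDerivAt.fun_sum fun p _ => ((aev_deriv hE p0 t p).mul (ph_deriv ω θ t p.2)).smul_const _
  refine h1.congr_deriv ?_
  exact alg_deriv (fun p q => (Kc γ ω lam W m v p q : ℂ)) (fun p => aev E Ψ p0 t p) (fun p => ph ω θ t p.2)
    (fun p => ((2 * Real.pi * ω * ((p.2:ℤ):ℝ) : ℝ) : ℂ)) (fun p => dl (p.1 : Site d)) H.toLinearMap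

lemma Kc_near {d : ℕ} (γ ω lam : ℝ) (W : Site d → ℝ) (m : ℕ) (v : Site d → ℝ) (p q : sbox d m × lay m) (hpq : p ≠ q)
    (h : Kc γ ω lam W m v p q ≠ 0) : l1 (p.1:Site d) + (p.2:ℤ).natAbs ≤ l1 (q.1:Site d) + (q.2:ℤ).natAbs + 1 := by
  obtain ⟨y, n⟩ := p
  obtain ⟨y', n'⟩ := q
  by_cases hn : n = n'
  · subst hn
    have hy : y ≠ y' := fun h => hpq (by rw [h])
    have hy' : (y:Site d) ≠ y' := fun h => hy (Subtype.ext h)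
    unfold Kc Kfl at h
    simp only [if_true, if_neg hy, if_neg hpq, add_zero] at h
    unfold hst at h
    rw [if_neg hy', add_zero] at h
    have h1 := hop_ne h
    have h2 := l1_add_le ((y:Site d) - (y':Site d)) y'
    rw [sub_add_cancel] at h2
    simp only
    omega
  · unfold Kc Kfl at h
    simp only [if_neg hn, if_neg hpq, add_zero, zero_add] at h
    by_cases hy : y = y'
    · subst hy
      simp only [if_true] at h
      have h1 := right_ne_zero_of_mul h
      unfold nbI at h1
      have : (n':ℤ) = n + 1 ∨ (n':ℤ) = n - 1 := by
        by_contra hc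
        push Not at hc
        simp [hc.1, hc.2] at h1
      simp only
      omega
    · simp [hy] at h

lemma aev_decay {d : ℕ} (γ ω lam : ℝ) (hγ : 0 ≤ γ) (W : Site d → ℝ) (hW : ∀ y, |W y| ≤ 1) (m : ℕ) (v : Site d → ℝ)
    (hv : ∀ j, |v j| ≤ 1) (E : sbox d m × lay m → ℝ)
    (Ψ : sbox d m × lay m → sbox d m × lay m → ℝ) (hE : IsEig (Kc γ ω lam W m v) E Ψ) (x : sbox d m) (t : ℝ) (q : sbox d m × lay m) :
    4 ^ (l1 (q.1:Site d) + (q.2:ℤ).natAbs) * ‖aev E Ψ (x, ⟨0, zero_mem_lay m⟩) t q‖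
      ≤ 4 ^ (l1 (x:Site d)) * Real.exp (4 * (2 * d + γ + 2 * (|lam| / 2)) * |t|) := by
  have h1 := weighted_growth (Kc γ ω lam W m v) (Kc_symm γ ω lam W m v) (fun p => 2 * Real.pi * ω * ((p.2:ℤ):ℝ))
    (fun p => 4 ^ (l1 (p.1:Site d) + (p.2:ℤ).natAbs)) (fun p => by positivity) (fun p q hpq h => by
      rw [← pow_succ']; exact pow_le_pow_right₀ (by norm_num) (Kc_near _ _ _ _ _ _ p q hpq h))
    (2 * d + γ + 2 * (|lam| / 2)) (fun p => Kfl_row _ _ _ _ _ _ (fun y => hst_row γ hγ _ v hv y) (fun y => by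
      rw [abs_mul, abs_div, abs_two]; exact mul_le_of_le_one_right (by positivity) (hW _)) (fun _ _ => nbI_nonneg _ _) (nbI_sum' (lay m)) p)
    (fun t p => aev E Ψ (x, ⟨0, zero_mem_lay m⟩) t p) (fun t p => aev_deriv hE _ t p) t
  have h2 : ∑ p : sbox d m × lay m, ((4:ℝ) ^ (l1 (p.1:Site d) + (p.2:ℤ).natAbs)) ^ 2 * ‖aev E Ψ (x, ⟨0, zero_mem_lay m⟩) 0 p‖ ^ 2 = (4 ^ l1 (x:Site d)) ^ 2 := by
    rw [Finset.sum_eq_single (x, ⟨0, zero_mem_lay m⟩)]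
    · rw [aev_zero hE, if_pos rfl]; simp
    · intro p _ hp
      rw [aev_zero hE, if_neg hp.symm]; simp
    · simp
  rw [h2] at h1
  have h3 := (Finset.single_le_sum (f := fun p : sbox d m × lay m => ((4:ℝ) ^ (l1 (p.1:Site d) + (p.2:ℤ).natAbs)) ^ 2 * ‖aev E Ψ (x, ⟨0, zero_mem_lay m⟩) t p‖ ^ 2)
    (fun p _ => by positivity) (Finset.mem_univ q)).trans h1
  refine le_of_sq_le_sq ?_ (by positivity)
  rw [mul_pow, mul_pow, ← Real.exp_nat_mul]
  refine h3.trans (le_of_eq ?_)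
  congr 2
  push_cast; ring

end

section

lemma half_sum {d : ℕ} (m : ℕ) :
    ∑ q : sbox d m × lay m, (1/2:ℝ) ^ (l1 (q.1:Site d) + (q.2:ℤ).natAbs)
      ≤ (∑' y : Site d, (1/2:ℝ) ^ l1 y) * ∑' n : ℤ, (1/2:ℝ) ^ n.natAbs := by
  simp only [pow_add]
  rw [Fintype.sum_prod_type]
  simp only [← Finset.mul_sum, ← Finset.sum_mul]
  refine mul_le_mul ?_ ?_ (Finset.sum_nonneg fun _ _ => by positivity) (tsum_nonneg fun _ => by positivity)
  · exact sub_sum_le (sbox d m) (fun y => (1/2:ℝ) ^ l1 y) (fun y => by positivity) (summable_l1 (by norm_num) (by norm_num))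
  · exact sub_sum_le (lay m) (fun n => (1/2:ℝ) ^ n.natAbs) (fun y => by positivity) (summable_int_pow (by norm_num) (by norm_num))

lemma rho_bound {I : Type*} [Fintype I] {V : Type*} [NormedAddCommGroup V] [NormedSpace ℂ V] (a : I → ℂ) (R : I → V)
    (N : I → ℕ) (m : ℕ) (B A S : ℝ) (hB : 0 ≤ B) (hA : 0 ≤ A)
    (hR : ∀ q, ‖R q‖ ≤ B * (if N q < m then 0 else 1)) (ha : ∀ q, 4 ^ N q * ‖a q‖ ≤ A)
    (hS : ∑ q, (1/2:ℝ) ^ N q ≤ S) : ‖∑ q, (Complex.I * a q) • R q‖ ≤ B * A * S * (1/2) ^ m := by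
  refine (norm_sum_le _ _).trans ?_
  have h1 : ∀ q, ‖(Complex.I * a q) • R q‖ ≤ B * A * (1/2) ^ m * (1/2) ^ N q := by
    intro q
    rw [norm_smul, norm_mul, Complex.norm_I, one_mul]
    by_cases h : N q < m
    · have := hR q
      rw [if_pos h, mul_zero] at this
      have h0 : ‖R q‖ = 0 := le_antisymm this (norm_nonneg _)
      rw [h0, mul_zero]; positivity
    · have h2 := hR q
      rw [if_neg h, mul_one] at h2
      have h3 : ‖a q‖ ≤ A * (1/4) ^ N q := by
        have := ha q
        rw [one_div, inv_pow, ← div_eq_mul_inv, le_div_iff₀ (by positivity)]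
        linarith
      have h4 : (1/4:ℝ) ^ N q ≤ (1/2) ^ m * (1/2) ^ N q := by
        rw [show (1/4:ℝ) = (1/2) * (1/2) by norm_num, mul_pow]
        exact mul_le_mul_of_nonneg_right (pow_le_pow_of_le_one (by norm_num) (by norm_num) (by omega)) (by positivity)
      calc ‖a q‖ * ‖R q‖ ≤ (A * ((1/2) ^ m * (1/2) ^ N q)) * B :=
            mul_le_mul (h3.trans (mul_le_mul_of_nonneg_left h4 hA)) h2 (norm_nonneg _) (by positivity)
        _ = _ := by ring
  refine (Finset.sum_le_sum fun q _ => h1 q).trans ?_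
  rw [← Finset.mul_sum]
  calc _ ≤ B * A * (1/2) ^ m * S := mul_le_mul_of_nonneg_left hS (by positivity)
    _ = _ := by ring

lemma conv_bound {d : ℕ} (γ ω lam θ : ℝ) (hγ : 0 ≤ γ) (W : Site d → ℝ) (hW : ∀ y, |W y| ≤ 1) (v : Site d → ℝ)
    (hv : ∀ j, |v j| ≤ 1) (H : ℝ → L2 d →L[ℂ] L2 d)
    (hH : ∀ t (ψ : L2 d) (i : Site d), (H t ψ) i = (∑ k, (ψ (i + unitVec k) + ψ (i - unitVec k))) +
      ((γ * v i + lam * Real.cos (2 * Real.pi * (ω * t + θ)) * W i : ℝ) : ℂ) * ψ i)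
    (x : Site d) (u : ℝ → L2 d) (hu : ∀ t, HasDerivAt u ((-Complex.I) • H t (u t)) t) (hu0 : u 0 = dl x) (t : ℝ) :
    ∃ κ : ℕ → ℝ, Filter.Tendsto κ Filter.atTop (nhds 0) ∧ ∀ m (hxm : x ∈ sbox d m) E Ψ, IsEig (Kc γ ω lam W m v) E Ψ →
      ‖u t - Psi ω θ m E Ψ (⟨x, hxm⟩, ⟨0, zero_mem_lay m⟩) t‖ ^ 2 ≤ κ m := by
  set A : ℝ := 4 ^ (l1 x) * Real.exp (4 * (2 * d + γ + 2 * (|lam| / 2)) * |t|) with hA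
  set S : ℝ := (∑' y : Site d, (1/2:ℝ) ^ l1 y) * ∑' n : ℤ, (1/2:ℝ) ^ n.natAbs with hS
  refine ⟨fun m => gronwallBound 0 1 (((2 * d + |lam|) * A * S * (1/2) ^ m) ^ 2) |t|, ?_, fun m hxm E Ψ hE => ?_⟩
  · have h1 : Filter.Tendsto (fun m : ℕ => ((2 * d + |lam|) * A * S * (1/2) ^ m) ^ 2) Filter.atTop (nhds 0) := by
      have := ((tendsto_pow_atTop_nhds_zero_of_lt_one (r := (1/2:ℝ)) (by norm_num) (by norm_num)).const_mul ((2 * d + |lam|) * A * S)).pow 2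
      simpa using this
    have h2 := ((gronwallBound_continuous_ε 0 1 |t|).tendsto 0).comp h1
    rw [gronwallBound_ε0_δ0] at h2
    exact h2
  · set p0 : sbox d m × lay m := (⟨x, hxm⟩, ⟨0, zero_mem_lay m⟩) with hp0
    have hP := fun s => Psi_deriv γ ω lam θ W m v E Ψ hE p0 s (H s)
    refine energy H (fun s => ham_symm (H s) _ (hH s)) (fun s => u s - Psi ω θ m E Ψ p0 s) (fun s => - ∑ q, (Complex.I * aev E Ψ p0 s q) • (ph ω θ s q.2 • H s (dl q.1) + (((2 * Real.pi * ω * ((q.2:ℤ):ℝ) : ℝ) : ℂ) * ph ω θ s q.2) • dl (q.1 : Site d)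
      - ∑ p, ((Kc γ ω lam W m v p q : ℂ) * ph ω θ s p.2) • dl (p.1 : Site d))) (fun s => ?_) ?_ _ |t| (fun s hs => ?_) t le_rfl
    · refine ((hu s).sub (hP s)).congr_deriv ?_
      rw [map_sub, smul_sub]
      abel
    · rw [hu0, hp0, Psi_zero ω θ m E Ψ hE, sub_self]
    · rw [norm_neg]
      refine rho_bound (fun q => aev E Ψ p0 s q) _ (fun q => l1 (q.1:Site d) + (q.2:ℤ).natAbs) m (2 * d + |lam|) A S (by positivity) (by positivity)
        (fun q => ?_) (fun q => ?_) (half_sum m)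
      · rw [res_eq γ ω lam θ s W m v (H s) (hH s) q]
        exact res_norm ω lam θ s W hW m q.1 q.2
      · refine (aev_decay γ ω lam hγ W hW m v hv E Ψ hE ⟨x, hxm⟩ s q).trans ?_
        rw [hA]
        gcongr

end

section

/-- good tail event at scale `m` -/
def TailOK {d : ℕ} (γ ω lam : ℝ) (W : Site d → ℝ) (x : Site d) (η : ℝ) (R m : ℕ) (v : Site d → ℝ) : Prop :=
  ∃ hxm : x ∈ sbox d m, ∀ E Ψ, IsEig (Kc γ ω lam W m v) E Ψ →
      ∀ z : sbox d m × lay m → ℂ, (∀ k, ‖z k‖ = 1) → ∀ ζ : lay m → ℂ, (∀ n, ‖ζ n‖ = 1) →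
      ∑ y ∈ univ.filter (fun y : sbox d m => R < l1 (y:Site d)),
        ‖∑ n, ζ n * ∑ k, z k * Ψ k (⟨x, hxm⟩, ⟨0, zero_mem_lay m⟩) * (Ψ k (y, n) : ℂ)‖ ^ 2 ≤ η

lemma ae_bdd {d : ℕ} {g : Measure ℝ} (hgp : IsProbabilityMeasure g) (hg : g (Set.Icc (-1 : ℝ) 1)ᶜ = 0)
    {P : Measure (Site d → ℝ)} (hP : IsProductMeasure g P) : ∀ᵐ v ∂P, ∀ j, |v j| ≤ 1 := by
  have := hP.1
  rw [ae_all_iff]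
  intro j
  have h1 := hP.2 {j} (fun _ => (Set.Icc (-1:ℝ) 1)ᶜ) (fun _ => measurableSet_Icc.compl)
  simp only [Finset.mem_singleton, forall_eq, Finset.prod_singleton, hg] at h1
  rw [ae_iff]
  refine le_antisymm (le_trans (measure_mono fun v hv => ?_) h1.le) zero_le
  intro h
  exact hv (abs_le.2 h)

lemma liminf_le {α : Type*} [MeasurableSpace α] (P : Measure α) (Z : ℕ → Set α) (N0 : ℕ) (δ : ℝ≥0∞) (hZ : ∀ m, N0 ≤ m → P (Z m) ≤ δ) :
    P {v | ∃ N, ∀ m, N ≤ m → v ∈ Z m} ≤ δ := by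
  have h1 : {v | ∃ N, ∀ m, N ≤ m → v ∈ Z m} = ⋃ N, {v | ∀ m, N ≤ m → v ∈ Z m} := by ext; simp
  have hm : Monotone fun N => {v | ∀ m, N ≤ m → v ∈ Z m} := fun a b hab v hv m hm => hv m (hab.trans hm)
  rw [h1, hm.measure_iUnion]
  refine iSup_le fun N => (measure_mono fun v hv => ?_).trans (hZ (max N N0) (le_max_right _ _))
  exact hv _ (le_max_left _ _)

lemma ae_tail {d : ℕ} {g : Measure ℝ} (hgp : IsProbabilityMeasure g) (hg : g (Set.Icc (-1 : ℝ) 1)ᶜ = 0) (C : ℝ≥0)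
    (hC : ∀ A : Set ℝ, g A ≤ (C : ℝ≥0∞) * volume A)
    {P : Measure (Site d → ℝ)} (hP : IsProductMeasure g P)
    (γ : ℝ) (hγ : 1 ≤ γ) (KF : ℝ≥0) (hKF : ENNReal.ofReal (Real.sqrt γ⁻¹) * kap C ≤ KF)
    (hKd : 4 * d * (KF:ℝ) ≤ 1) (σ : ℝ) (hσ : 0 < σ) (hσ1 : σ < 1)
    (ω : ℝ) (hω : 0 < ω) (lam : ℝ) (W : Site d → ℝ) (hW : ∀ y, |W y| ≤ (σ ^ l1 y) ^ 4)
    (x : Site d) (η : ℝ) (hη : 0 < η) :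
    ∀ᵐ v ∂P, ∃ R : ℕ, ∃ᶠ m in Filter.atTop, TailOK γ ω lam W x η R m v := by
  have := hP.1
  have hbd := ae_bdd hgp hg hP
  rw [ae_iff] at hbd ⊢
  refine le_antisymm (ENNReal.le_of_forall_pos_le_add fun δ hδ _ => ?_) zero_le
  obtain ⟨R, hR⟩ := prob_tail hgp hg C hC hP γ hγ KF hKF hKd σ hσ hσ1 ω hω lam W hW x η hη δ hδ
  have hR' : ∀ m, ∃ Z : Set (Site d → ℝ), (l1 x ≤ m → P Z ≤ δ) ∧ ∀ v ∉ Z, (∀ j, |v j| ≤ 1) → l1 x ≤ m → TailOK γ ω lam W x η R m v := by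
    intro m
    by_cases h : l1 x ≤ m
    · obtain ⟨Z, h1, h2⟩ := hR m (mem_sbox x h)
      refine ⟨Z, fun _ => by simpa using h1, fun v hv hv1 _ => ⟨mem_sbox x h, fun E Ψ hE => h2 v hv hv1 E Ψ hE⟩⟩
    · exact ⟨∅, fun h' => absurd h' h, fun v _ _ h' => absurd h' h⟩
  choose Z hZ1 hZ2 using hR'
  have h1 := liminf_le P Z (l1 x) δ hZ1
  calc _ ≤ P ({v | ¬ ∀ j, |v j| ≤ 1} ∪ {v | ∃ N, ∀ m, N ≤ m → v ∈ Z m}) := by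
        refine measure_mono fun v hv => ?_
        by_cases hb : ∀ j, |v j| ≤ 1
        · right
          have h3 : ¬ ∃ᶠ m in Filter.atTop, TailOK γ ω lam W x η R m v := fun h => hv ⟨R, h⟩
          rw [Filter.not_frequently, Filter.eventually_atTop] at h3
          obtain ⟨N, hN⟩ := h3
          refine ⟨max N (l1 x), fun m hm => ?_⟩
          by_contra hc
          exact hN m ((le_max_left _ _).trans hm) (hZ2 m v hc hb ((le_max_right _ _).trans hm))
        · left; exact hb
    _ ≤ 0 + δ := (measure_union_le _ _).trans (add_le_add hbd.le h1)

/-- localization in the finite-sum form -/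
def Loc {d : ℕ} (U : ℝ → L2 d →L[ℂ] L2 d) (φ : L2 d) : Prop :=
  ∀ ε > (0:ℝ), ∃ R : ℕ, ∀ t, ∀ F : Finset (Site d), (∀ y ∈ F, R < l1 y) → ∑ y ∈ F, ‖(U t φ) y‖ ^ 2 ≤ ε

lemma fin_le_norm {d : ℕ} (ψ : L2 d) (F : Finset (Site d)) : ∑ y ∈ F, ‖ψ y‖ ^ 2 ≤ ‖ψ‖ ^ 2 := by
  rw [l2_norm]
  exact (l2_summable ψ).sum_le_tsum F (fun _ _ => by positivity)

lemma fin_add {d : ℕ} (ψ φ : L2 d) (F : Finset (Site d)) :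
    ∑ y ∈ F, ‖(ψ + φ) y‖ ^ 2 ≤ 2 * ∑ y ∈ F, ‖ψ y‖ ^ 2 + 2 * ∑ y ∈ F, ‖φ y‖ ^ 2 := by
  rw [Finset.mul_sum, Finset.mul_sum, ← Finset.sum_add_distrib]
  refine Finset.sum_le_sum fun y _ => ?_
  rw [lp.coeFn_add, Pi.add_apply]
  exact norm_sq_add_le _ _

lemma Loc_add {d : ℕ} {U : ℝ → L2 d →L[ℂ] L2 d} {φ ψ : L2 d} (h1 : Loc U φ) (h2 : Loc U ψ) : Loc U (φ + ψ) := by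
  intro ε hε
  obtain ⟨R1, hR1⟩ := h1 (ε / 4) (by positivity)
  obtain ⟨R2, hR2⟩ := h2 (ε / 4) (by positivity)
  refine ⟨max R1 R2, fun t F hF => ?_⟩
  rw [map_add]
  have h3 := hR1 t F fun y hy => (le_max_left _ _).trans_lt (hF y hy)
  have h4 := hR2 t F fun y hy => (le_max_right _ _).trans_lt (hF y hy)
  have := fin_add (U t φ) (U t ψ) F
  linarith

lemma Loc_smul {d : ℕ} {U : ℝ → L2 d →L[ℂ] L2 d} {φ : L2 d} (h1 : Loc U φ) (c : ℂ) : Loc U (c • φ) := by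
  intro ε hε
  obtain ⟨R1, hR1⟩ := h1 (ε / (‖c‖ ^ 2 + 1)) (by positivity)
  refine ⟨R1, fun t F hF => ?_⟩
  have h2 := hR1 t F hF
  rw [le_div_iff₀ (by positivity)] at h2
  have h3 : ∑ y ∈ F, ‖(U t (c • φ)) y‖ ^ 2 = (∑ y ∈ F, ‖(U t φ) y‖ ^ 2) * ‖c‖ ^ 2 := by
    rw [Finset.sum_mul]
    refine Finset.sum_congr rfl fun y _ => ?_
    rw [map_smul, lp.coeFn_smul, Pi.smul_apply, norm_smul]; ring
  rw [h3]
  have : 0 ≤ ∑ y ∈ F, ‖(U t φ) y‖ ^ 2 := Finset.sum_nonneg fun _ _ => by positivity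
  linarith

lemma Loc_zero {d : ℕ} {U : ℝ → L2 d →L[ℂ] L2 d} : Loc U 0 := by
  intro ε hε
  refine ⟨0, fun t F _ => ?_⟩
  simpa using hε.le

lemma Loc_all {d : ℕ} {U : ℝ → L2 d →L[ℂ] L2 d} (hU : ∀ t φ, ‖U t φ‖ = ‖φ‖) (h : ∀ x, Loc U (dl x)) (φ : L2 d) : Loc U φ := by
  intro ε hε
  have hfin : ∀ s : Finset (Site d), Loc U (∑ i ∈ s, lp.single 2 i (φ i)) := by
    intro s
    induction s using Finset.induction_on with
    | empty => simpa using Loc_zero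
    | insert i s hi ih =>
      rw [Finset.sum_insert hi]
      refine Loc_add ?_ ih
      have : (lp.single 2 i (φ i) : L2 d) = φ i • dl i := by
        unfold dl; rw [← lp.single_smul, smul_eq_mul, mul_one]
      rw [this]; exact Loc_smul (h i) _
  have hs := lp.hasSum_single (p := 2) (by norm_num) φ
  have h2 : Filter.Tendsto (fun s : Finset (Site d) => ‖φ - ∑ i ∈ s, lp.single 2 i (φ i)‖ ^ 2) Filter.atTop (nhds 0) := by
    have := ((tendsto_const_nhds (x := φ)).sub hs).norm.pow 2
    simpa using this
  obtain ⟨s, hs⟩ := (h2.eventually (gt_mem_nhds (by positivity : 0 < ε / 4))).exists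
  obtain ⟨R, hR⟩ := hfin s (ε / 4) (by positivity)
  refine ⟨R, fun t F hF => ?_⟩
  have h3 := hR t F hF
  have h4 := fin_le_norm (U t (φ - ∑ i ∈ s, lp.single 2 i (φ i))) F
  rw [hU] at h4
  have h5 := fin_add (U t (φ - ∑ i ∈ s, lp.single 2 i (φ i))) (U t (∑ i ∈ s, lp.single 2 i (φ i))) F
  rw [← map_add, sub_add_cancel] at h5
  linarith

lemma Loc_tsum {d : ℕ} {U : ℝ → L2 d →L[ℂ] L2 d} {φ : L2 d} (h : Loc U φ) (ε : ℝ) (hε : 0 < ε) :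
    ∃ R > (0:ℝ), ∀ t : ℝ, ∑' j : {j : Site d // R < (l1 j : ℝ)}, ‖(U t φ) j.1‖ ^ 2 < ε := by
  obtain ⟨R, hR⟩ := h (ε / 2) (by positivity)
  refine ⟨R + 1, by positivity, fun t => ?_⟩
  refine lt_of_le_of_lt (Real.tsum_le_of_sum_le (fun _ => by positivity) fun s => ?_) (half_lt_self hε)
  have h1 := hR t (s.map ⟨Subtype.val, Subtype.val_injective⟩) (fun y hy => by
    obtain ⟨j, _, rfl⟩ := Finset.mem_map.1 hy
    have := j.2
    have h2 : ((R:ℝ)) < (l1 j.1 : ℝ) := by linarith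
    exact_mod_cast h2)
  rw [Finset.sum_map] at h1
  exact h1

lemma Loc_dl {d : ℕ} (γ ω lam θ : ℝ) (hγ : 0 ≤ γ) (W : Site d → ℝ) (hW : ∀ y, |W y| ≤ 1) (v : Site d → ℝ)
    (hv : ∀ j, |v j| ≤ 1) (H : ℝ → L2 d →L[ℂ] L2 d)
    (hH : ∀ t (ψ : L2 d) (i : Site d), (H t ψ) i = (∑ k, (ψ (i + unitVec k) + ψ (i - unitVec k))) +
      ((γ * v i + lam * Real.cos (2 * Real.pi * (ω * t + θ)) * W i : ℝ) : ℂ) * ψ i)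
    (U : ℝ → L2 d →L[ℂ] L2 d) (hU : ∀ φ t, HasDerivAt (fun t => U t φ) ((-Complex.I) • H t (U t φ)) t)
    (hU0 : ∀ φ, U 0 φ = φ) (x : Site d)
    (hT : ∀ k : ℕ, ∃ R : ℕ, ∃ᶠ m in Filter.atTop, TailOK γ ω lam W x (1 / ((k:ℝ) + 1)) R m v) : Loc U (dl x) := by
  intro ε hε
  obtain ⟨k, hk⟩ := exists_nat_one_div_lt (by positivity : 0 < ε / 4)
  obtain ⟨R, hR⟩ := hT k
  refine ⟨R, fun t F hF => ?_⟩
  obtain ⟨κ, hκ, hκ2⟩ := conv_bound γ ω lam θ hγ W hW v hv H hH x (fun t => U t (dl x)) (hU (dl x)) (hU0 _) t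
  have e1 := hκ.eventually (gt_mem_nhds (by positivity : 0 < ε / 4))
  have e2 : ∀ᶠ m in Filter.atTop, F ⊆ sbox d m := by
    filter_upwards [Filter.eventually_ge_atTop (F.sup l1)] with m hm y hy
    exact mem_sbox y ((Finset.le_sup (f := l1) hy).trans hm)
  obtain ⟨m, ⟨hxm, hm⟩, hm1, hm2⟩ := (hR.and_eventually (e1.and e2)).exists
  obtain ⟨E, Ψ, hE⟩ := exists_isEig (Kc γ ω lam W m v) (Kc_symm γ ω lam W m v)
  have h1 := hκ2 m hxm E Ψ hE
  have h2 := hm E Ψ hE (fun k => Complex.exp (-Complex.I * t * E k)) (fun k => by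
      have : (-Complex.I * t * E k : ℂ) = ((-(t * E k) : ℝ) : ℂ) * Complex.I := by push_cast; ring
      rw [this, Complex.norm_exp_ofReal_mul_I]) (fun n => ph ω θ t n) (fun n => ph_norm _ _ _ _)
  set X := Psi ω θ m E Ψ (⟨x, hxm⟩, ⟨0, zero_mem_lay m⟩) t with hX
  have h3 : ∑ y ∈ F, ‖X y‖ ^ 2 ≤ ε / 4 := by
    refine le_trans ?_ hk.le
    refine le_trans (le_of_eq_of_le ?_ (Finset.sum_le_sum_of_subset_of_nonneg (s := univ.filter fun y : sbox d m => (y:Site d) ∈ F) ?_ fun _ _ _ => by positivity)) h2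
    · have h6 : ∑ y ∈ F, ‖X y‖ ^ 2 = ∑ y ∈ (sbox d m).filter (fun y => y ∈ F), ‖X y‖ ^ 2 := by
        congr 1
        ext y
        rw [Finset.mem_filter]
        exact ⟨fun h => ⟨hm2 h, h⟩, fun h => h.2⟩
      rw [h6, Finset.sum_filter, Finset.sum_filter, ← Finset.sum_coe_sort (sbox d m)]
      refine Finset.sum_congr rfl fun y _ => ?_
      rw [hX, Psi_apply]
      rfl
    · intro y hy
      rw [Finset.mem_filter] at hy ⊢
      exact ⟨hy.1, hF _ hy.2⟩
  have h4 := fin_add X (U t (dl x) - X) F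
  rw [add_sub_cancel] at h4
  have h5 := fin_le_norm (U t (dl x) - X) F
  linarith


lemma gamma_choice (d : ℕ) (C : ℝ≥0) : ∃ γ₀ : ℝ, 1 ≤ γ₀ ∧ ∀ γ, γ₀ < γ →
    ∃ KF : ℝ≥0, ENNReal.ofReal (Real.sqrt γ⁻¹) * kap C ≤ KF ∧ 4 * d * (KF:ℝ) ≤ 1 := by
  set q : ℝ := (kap C).toReal with hq
  have hq0 : 0 ≤ q := ENNReal.toReal_nonneg
  refine ⟨max 1 ((4 * d * q) ^ 2), le_max_left _ _, fun γ hγ => ?_⟩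
  have h1 : 1 < γ := (le_max_left _ _).trans_lt hγ
  have h2 : (4 * d * q) ^ 2 ≤ γ := ((le_max_right _ _).trans_lt hγ).le
  have hne : ENNReal.ofReal (Real.sqrt γ⁻¹) * kap C ≠ ⊤ := ENNReal.mul_ne_top ENNReal.ofReal_ne_top (kap_lt C).ne
  refine ⟨(ENNReal.ofReal (Real.sqrt γ⁻¹) * kap C).toNNReal, (ENNReal.coe_toNNReal hne).ge, ?_⟩
  rw [ENNReal.coe_toNNReal_eq_toReal, ENNReal.toReal_mul, ENNReal.toReal_ofReal (Real.sqrt_nonneg _), ← hq, Real.sqrt_inv]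
  have h3 : 4 * d * q ≤ Real.sqrt γ := Real.le_sqrt_of_sq_le h2
  have h4 : 0 < Real.sqrt γ := Real.sqrt_pos.2 (by linarith)
  calc 4 * d * ((Real.sqrt γ)⁻¹ * q) = (4 * d * q) / Real.sqrt γ := by field_simp
    _ ≤ 1 := (div_le_one h4).2 h3

end

lemma prob_one_of_ae {α : Type*} [MeasurableSpace α] (P : Measure α) [IsProbabilityMeasure P] (S : Set α)
    (h : ∀ᵐ v ∂P, v ∈ S) : P S = 1 := by
  have h2 : S =ᵐ[P] Set.univ := Filter.eventuallyEq_univ.2 h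
  rw [measure_congr h2, measure_univ]

/-- **Dynamical localization / quantum stability (Corollary 1.2).** For all sufficiently
large `γ`, with probability `1`: for every `φ ∈ ℓ²(ℤ^d)`, every `θ ∈ S¹` and every
`ε > 0` there is `R > 0` such that `sup_t Σ_{|j|>R} |(U(t,0;θ)φ)(j)|² < ε`, where
`U(t,s;θ)` is the unitary propagator of
`i∂ψ/∂t = (Δ + γV + λcos(2π(ωt+θ))W)ψ`, characterized by `U(s,s;θ) = 1` and
`(d/dt)U(t,s;θ)φ = -i·H(t,θ)·U(t,s;θ)φ`.  In particular Anderson localization is stable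
under the bounded, spatially localized, time-periodic perturbation `λcos(2π(ωt+θ))W`. -/
theorem anderson_localization_stable (d : ℕ) (hd : 1 ≤ d) (g : Measure ℝ)
    (hg : NiceDisorder g) (P : Measure (Site d → ℝ)) (hP : IsProductMeasure g P)
    (ω : ℝ) (hω : 0 < ω) (lam : ℝ) :
    ∃ γ₀ : ℝ, ∀ γ : ℝ, γ₀ < γ → ∀ b : ℝ, 0 < b →
    ∀ W : Site d → ℝ, (∀ j, |W j| ≤ Real.exp (-(b * Real.log γ) * (l1 j : ℝ))) →
    P {v | ∀ (H : ℝ → ℝ → (lp (fun _ : Site d => ℂ) 2 →L[ℂ] lp (fun _ : Site d => ℂ) 2))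
        (U : ℝ → ℝ → ℝ → (lp (fun _ : Site d => ℂ) 2 →L[ℂ] lp (fun _ : Site d => ℂ) 2)),
      (∀ t θ ψ (i : Site d), (H t θ ψ) i =
        (∑ k, (ψ (i + unitVec k) + ψ (i - unitVec k))) + ((γ * v i : ℝ) : ℂ) * ψ i +
          ((lam * Real.cos (2 * Real.pi * (ω * t + θ)) * W i : ℝ) : ℂ) * ψ i) →
      (∀ s θ, U s s θ = ContinuousLinearMap.id ℂ _) →
      (∀ φ s θ t, HasDerivAt (fun r => U r s θ φ) ((-Complex.I) • (H t θ (U t s θ φ))) t) →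
      ∀ (φ : lp (fun _ : Site d => ℂ) 2) (θ : ℝ), ∀ ε > (0:ℝ), ∃ R > (0:ℝ), ∀ t : ℝ,
        ∑' j : {j : Site d // R < (l1 j : ℝ)}, ‖(U t 0 θ φ) j.1‖ ^ 2 < ε} = 1 := by
  obtain ⟨hgp, hgs, C, hC⟩ := hg
  have := hP.1
  obtain ⟨γ₀, hγ₀, hγ1⟩ := gamma_choice d C
  refine ⟨γ₀, fun γ hγ b hb W hW => ?_⟩
  obtain ⟨KF, hKF, hKd⟩ := hγ1 γ hγ
  have hγ' : 1 < γ := hγ₀.trans_lt hγ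
  have hlog : 0 < b * Real.log γ := mul_pos hb (Real.log_pos hγ')
  have hW4 : ∀ y, |W y| ≤ (Real.exp (-(b * Real.log γ) / 4) ^ l1 y) ^ 4 := fun y => by
    refine (hW y).trans (le_of_eq ?_)
    rw [← Real.exp_nat_mul, ← Real.exp_nat_mul]
    congr 1; push_cast; ring
  have hW1 : ∀ y, |W y| ≤ 1 := fun y => (hW y).trans (Real.exp_le_one_iff.2 (by
    have : 0 ≤ (b * Real.log γ) * (l1 y : ℝ) := by positivity
    linarith))
  have hT : ∀ᵐ v ∂P, ∀ x : Site d, ∀ k : ℕ, ∃ R : ℕ, ∃ᶠ m in Filter.atTop, TailOK γ ω lam W x (1 / ((k:ℝ) + 1)) R m v := by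
    rw [ae_all_iff]; intro x
    rw [ae_all_iff]; intro k
    exact ae_tail hgp hgs C hC hP γ hγ'.le KF hKF hKd (Real.exp (-(b * Real.log γ) / 4)) (Real.exp_pos _)
      (Real.exp_lt_one_iff.2 (by linarith)) ω hω lam W hW4 x _ (by positivity)
  refine prob_one_of_ae P _ ?_
  filter_upwards [hT, ae_bdd hgp hgs hP] with v hv hv1
  intro H U hH hU0 hU φ θ ε hε
  have hH' : ∀ t (ψ : L2 d) (i : Site d), (H t θ ψ) i = (∑ k, (ψ (i + unitVec k) + ψ (i - unitVec k))) +
      ((γ * v i + lam * Real.cos (2 * Real.pi * (ω * t + θ)) * W i : ℝ) : ℂ) * ψ i := by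
    intro t ψ i
    rw [hH, Complex.ofReal_add, add_mul, add_assoc]
  refine Loc_tsum (U := fun t => U t 0 θ) (Loc_all (fun t ψ => ?_) (fun x => ?_) φ) ε hε
  · have := norm_cons (fun t => H t θ) (fun s => ham_symm (H s θ) _ (hH' s)) (fun r => U r 0 θ ψ) (fun s => hU ψ 0 θ s) t
    simpa [hU0] using this
  · exact Loc_dl γ ω lam θ (by linarith) W hW1 v hv1 (fun t => H t θ) hH' (fun t => U t 0 θ) (fun ψ t => hU ψ 0 θ t)
      (fun ψ => by simp [hU0]) x (hv x)
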